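/- Let Ω be a bounded domain of an n-dimensional Alexandrov space with curvature ≥ k, let p > 1, Y a complete metric space, and u ∈ W^{1,p}(Ω,Y). Then for any sequence of numbers {ε_j} converging to 0 there exists a subsequence {ε'_j} ⊂ {ε_j} such that for almost every x ∈ Ω, lim_{j→∞} e^u_{p,ε'_j}(x) = |∇u|_p(x). -/

import Mathlib

open MeasureTheory Metric Filter Set Asymptotics
open scoped Topology ENNReal NNReal

noncomputable section

namespace Paper

/-- A unit-speed geodesic of length `L`. -/
def IsUnitGeodesic {M : Type*} [MetricSpace M] (γ : ℝ → M) (L : ℝ) : Prop :=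
  0 ≤ L ∧ ∀ s ∈ Set.Icc (0:ℝ) L, ∀ t ∈ Set.Icc (0:ℝ) L, dist (γ s) (γ t) = |s - t|

/-- A geodesic metric space: every pair of points is joined by a unit-speed
shortest geodesic. -/
def GeodesicSpace (M : Type*) [MetricSpace M] : Prop :=
  ∀ x y : M, ∃ γ : ℝ → M, IsUnitGeodesic γ (dist x y) ∧ γ 0 = x ∧ γ (dist x y) = y

/-- The comparison angle `∠̃_k` in the model plane `𝕄²_k` at the vertex between two
sides of lengths `a`, `b` whose opposite side has length `c`, given by the law of
cosines in the model plane of constant curvature `k`. -/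
def cmpAngle (k a b c : ℝ) : ℝ :=
  if k = 0 then Real.arccos ((a ^ 2 + b ^ 2 - c ^ 2) / (2 * a * b))
  else if k < 0 then
    Real.arccos ((Real.cosh (Real.sqrt (-k) * a) * Real.cosh (Real.sqrt (-k) * b) -
        Real.cosh (Real.sqrt (-k) * c)) /
      (Real.sinh (Real.sqrt (-k) * a) * Real.sinh (Real.sqrt (-k) * b)))
  else
    Real.arccos ((Real.cos (Real.sqrt k * c) -
        Real.cos (Real.sqrt k * a) * Real.cos (Real.sqrt k * b)) /
      (Real.sin (Real.sqrt k * a) * Real.sin (Real.sqrt k * b)))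

/-- A (complete, locally compact) geodesic space has curvature `≥ k` in the sense of
Alexandrov: near every point, comparison angles along pairs of geodesics issuing from a common
point are non-increasing in each of the two parameters. -/
structure CurvBddBelow (M : Type*) [MetricSpace M] (k : ℝ) : Prop where
  locallyCompact : LocallyCompactSpace M
  geodesic : GeodesicSpace M
  comparison : ∀ x : M, ∃ U ∈ 𝓝 x,
    ∀ (p : M) (γ σ : ℝ → M) (L₁ L₂ : ℝ),
      IsUnitGeodesic γ L₁ → IsUnitGeodesic σ L₂ →
      (∀ s ∈ Set.Icc (0:ℝ) L₁, γ s ∈ U) → (∀ t ∈ Set.Icc (0:ℝ) L₂, σ t ∈ U) →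
      γ 0 = p → σ 0 = p →
      ∀ s t s' t' : ℝ, 0 < s → s ≤ s' → s' ≤ L₁ → 0 < t → t ≤ t' → t' ≤ L₂ →
        cmpAngle k s' t' (dist (γ s') (σ t')) ≤ cmpAngle k s t (dist (γ s) (σ t))

/-- An `n`-dimensional Alexandrov space with curvature `≥ k` (without boundary);
its Hausdorff dimension equals `n` and it carries the `n`-dimensional Hausdorff
measure `μH[n]` as its volume. -/
structure AlexandrovSpace (M : Type*) [MetricSpace M] (n : ℕ) (k : ℝ) : Prop where
  curv : CurvBddBelow M k
  dim : dimH (Set.univ : Set M) = n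

/-- An NPC space: a complete geodesic space which is globally non-positively curved in
the sense of Alexandrov (CAT(0)); the comparison inequality `d(P,S) ≤ |P̄S̄|` for the
midpoint `S` of the side `QR` is expressed through the Euclidean median formula. -/
structure NPCSpace (Y : Type*) [MetricSpace Y] : Prop where
  complete : CompleteSpace Y
  geodesic : GeodesicSpace Y
  cat0 : ∀ p q r m : Y, dist q m = dist q r / 2 → dist r m = dist q r / 2 →
    dist p m ^ 2 ≤ (dist p q ^ 2 + dist p r ^ 2) / 2 - dist q r ^ 2 / 4

/-- `Lip_0(Ω)`: Lipschitz functions with compact support contained in `Ω`. -/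
def IsLip0 {M : Type*} [MetricSpace M] (Ω : Set M) (φ : M → ℝ) : Prop :=
  (∃ c : ℝ≥0, LipschitzWith c φ) ∧ IsCompact (tsupport φ) ∧ tsupport φ ⊆ Ω

/-- `C_0(Ω)`: continuous functions with compact support contained in `Ω`. -/
def IsC0 {M : Type*} [MetricSpace M] (Ω : Set M) (φ : M → ℝ) : Prop :=
  Continuous φ ∧ IsCompact (tsupport φ) ∧ tsupport φ ⊆ Ω

/-- `A ⊂⊂ B` : `A` is compactly contained in `B`. -/
def CptIn {M : Type*} [TopologicalSpace M] (A B : Set M) : Prop :=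
  IsCompact (closure A) ∧ closure A ⊆ B

/-- An abstract first-order Sobolev calculus on the metric measure space `(M, d, μ)`:
it records the Sobolev spaces `W^{1,2}(Ω)`, `W^{1,2}_0(Ω)` and the pointwise inner
product of weak gradients `⟨∇f, ∇g⟩`, with the basic compatibility properties. -/
structure SobolevFramework (M : Type*) [MetricSpace M] [MeasurableSpace M]
    (μ : Measure M) where
  memW12 : Set M → (M → ℝ) → Prop
  memW12_0 : Set M → (M → ℝ) → Prop
  innerGrad : (M → ℝ) → (M → ℝ) → M → ℝ
  innerGrad_symm : ∀ f g, innerGrad f g = innerGrad g f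
  innerGrad_add_left : ∀ f g h, innerGrad (f + g) h = innerGrad f h + innerGrad g h
  innerGrad_smul_left : ∀ (c : ℝ) (f g : M → ℝ),
    innerGrad (fun x => c * f x) g = fun x => c * innerGrad f g x
  innerGrad_nonneg : ∀ f x, 0 ≤ innerGrad f f x
  innerGrad_lip_le : ∀ (f : M → ℝ) (c : ℝ≥0), LipschitzWith c f →
    ∀ x, innerGrad f f x ≤ (c : ℝ) ^ 2
  lip_memW12 : ∀ (Ω : Set M) (f : M → ℝ), Bornology.IsBounded Ω →
    (∃ c : ℝ≥0, LipschitzWith c f) → memW12 Ω f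
  lip0_memW12_0 : ∀ (Ω : Set M) (f : M → ℝ), IsLip0 Ω f → memW12_0 Ω f
  memW12_0_sub : ∀ (Ω : Set M) (f : M → ℝ), memW12_0 Ω f → memW12 Ω f

variable {M : Type*} [MetricSpace M] [MeasurableSpace M] {μ : Measure M}

/-- `f ∈ W^{1,2}_loc(Ω)`. -/
def memW12loc (F : SobolevFramework M μ) (Ω : Set M) (f : M → ℝ) : Prop :=
  ∀ Ω' : Set M, IsOpen Ω' → CptIn Ω' Ω → F.memW12 Ω' f

/-- `f` is a super-solution of the Poisson equation `𝓛_f = h·vol` on `Ω`: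
`𝓛_f(φ) = -∫_Ω ⟨∇f,∇φ⟩ ≤ ∫_Ω hφ` for all nonnegative `φ ∈ Lip_0(Ω)`. -/
def IsSupersolution (F : SobolevFramework M μ) (Ω : Set M) (f h : M → ℝ) : Prop :=
  ∀ φ : M → ℝ, IsLip0 Ω φ → (∀ x, 0 ≤ φ x) →
    -∫ x in Ω, F.innerGrad f φ x ∂μ ≤ ∫ x in Ω, h x * φ x ∂μ

/-- `f` is a sub-solution of the Poisson equation `𝓛_f = h·vol` on `Ω`. -/
def IsSubsolution (F : SobolevFramework M μ) (Ω : Set M) (f h : M → ℝ) : Prop :=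
  ∀ φ : M → ℝ, IsLip0 Ω φ → (∀ x, 0 ≤ φ x) →
    ∫ x in Ω, h x * φ x ∂μ ≤ -∫ x in Ω, F.innerGrad f φ x ∂μ

/-- `f` is a weak solution of `𝓛_f = h·vol` on `Ω`. -/
def IsWeakSolution (F : SobolevFramework M μ) (Ω : Set M) (f h : M → ℝ) : Prop :=
  IsSupersolution F Ω f h ∧ IsSubsolution F Ω f h

/-- The normalizing constant `c_{n,p} = ∫_{𝕊^{n-1}} |x¹|^p dσ
    = 2 π^{(n-1)/2} Γ((p+1)/2) / Γ((n+p)/2)`. -/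
def cnp (n : ℕ) (p : ℝ) : ℝ :=
  2 * Real.pi ^ (((n : ℝ) - 1) / 2) * Real.Gamma ((p + 1) / 2) /
    Real.Gamma (((n : ℝ) + p) / 2)

/-- `ω_{n-1}`, the volume of the standard unit sphere `𝕊^{n-1} ⊂ ℝⁿ`. -/
def sphereVol (n : ℕ) : ℝ := 2 * Real.pi ^ ((n : ℝ) / 2) / Real.Gamma ((n : ℝ) / 2)

variable {Y : Type*} [MetricSpace Y]

/-- The approximating energy density
`e^u_{p,ε}(x) = ((n+p)/(c_{n,p} ε^{n+p})) ∫_{B_x(ε)∩Ω} d_Y^p(u(x),u(y)) dμ(y)`. -/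
def ksDensity (n : ℕ) (p : ℝ) (μ : Measure M) (Ω : Set M) (u : M → Y) (ε : ℝ)
    (x : M) : ℝ :=
  ((n : ℝ) + p) / (cnp n p * ε ^ ((n : ℝ) + p)) *
    ∫ y in Metric.ball x ε ∩ Ω, dist (u x) (u y) ^ p ∂μ

/-- The approximating energy `E^u_{p,ε}(φ) = ∫_Ω φ e^u_{p,ε} dμ`. -/
def ksApproxEnergy (n : ℕ) (p : ℝ) (μ : Measure M) (Ω : Set M) (u : M → Y)
    (φ : M → ℝ) (ε : ℝ) : ℝ :=
  ∫ x in Ω, φ x * ksDensity n p μ Ω u ε x ∂μ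

/-- Membership in the Korevaar-Schoen type Sobolev space `W^{1,p}(Ω,Y)`:
`u ∈ L^p(Ω,Y)` is Borel with separable range, the energy functional
`E^u_p(φ) = lim_{ε→0⁺} E^u_{p,ε}(φ)` exists for every `φ ∈ C_0(Ω)`, and the total
energy `sup {E^u_p(φ) : φ ∈ C_0(Ω), 0 ≤ φ ≤ 1}` is finite. -/
def MemKS (n : ℕ) (p : ℝ) (μ : Measure M) (Ω : Set M) (u : M → Y) : Prop :=
  (∀ P : Y, Measurable fun x => dist (u x) P) ∧
  TopologicalSpace.IsSeparable (Set.range u) ∧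
  (∃ P : Y, IntegrableOn (fun x => dist (u x) P ^ p) Ω μ) ∧
  (∀ φ : M → ℝ, IsC0 Ω φ → ∃ e : ℝ,
    Tendsto (fun ε => ksApproxEnergy n p μ Ω u φ ε) (𝓝[>] (0:ℝ)) (𝓝 e)) ∧
  ∃ C : ℝ, ∀ (φ : M → ℝ) (e : ℝ), IsC0 Ω φ → (∀ x, 0 ≤ φ x ∧ φ x ≤ 1) →
    Tendsto (fun ε => ksApproxEnergy n p μ Ω u φ ε) (𝓝[>] (0:ℝ)) (𝓝 e) → e ≤ C

/-- The total energy `E^u_p = sup {E^u_p(φ) : φ ∈ C_0(Ω), 0 ≤ φ ≤ 1}`. -/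
def ksEnergy (n : ℕ) (p : ℝ) (μ : Measure M) (Ω : Set M) (u : M → Y) : ℝ :=
  sSup { e : ℝ | ∃ φ : M → ℝ, IsC0 Ω φ ∧ (∀ x, 0 ≤ φ x ∧ φ x ≤ 1) ∧
    Tendsto (fun ε => ksApproxEnergy n p μ Ω u φ ε) (𝓝[>] (0:ℝ)) (𝓝 e) }

/-- `ν` is the (finite Borel) energy measure `E^u_p` of `u` on `Ω`:
`E^u_{p,ε}(φ) → ∫ φ dν` for every nonnegative `φ ∈ C_0(Ω)`. -/
def IsEnergyMeasure (n : ℕ) (p : ℝ) (μ : Measure M) (Ω : Set M) (u : M → Y)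
    (ν : Measure M) : Prop :=
  IsFiniteMeasure ν ∧
  ∀ φ : M → ℝ, IsC0 Ω φ → (∀ x, 0 ≤ φ x) →
    Tendsto (fun ε => ksApproxEnergy n p μ Ω u φ ε) (𝓝[>] (0:ℝ)) (𝓝 (∫ x, φ x ∂ν))

/-- `|∇u|_p`, the density of the absolutely continuous part of the energy measure `ν`
with respect to `μ` (the Radon–Nikodym derivative). -/
def ksDens (μ ν : Measure M) (x : M) : ℝ := (ν.rnDeriv μ x).toReal

/-- `u` is a harmonic map: `u ∈ W^{1,2}(Ω,Y)` minimizes the energy `E^w_2` among all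
`w ∈ W^{1,2}(Ω,Y)` with `d_Y(w(·),u(·)) ∈ W^{1,2}_0(Ω)`. -/
def IsHarmonicMap (F : SobolevFramework M μ) (n : ℕ) (Ω : Set M) (u : M → Y) : Prop :=
  MemKS n 2 μ Ω u ∧
  ∀ w : M → Y, MemKS n 2 μ Ω w → F.memW12_0 Ω (fun x => dist (w x) (u x)) →
    ksEnergy n 2 μ Ω u ≤ ksEnergy n 2 μ Ω w

/-- The oscillation `osc_A u = max_{x,y ∈ A} d_Y(u(x),u(y))`. -/
def oscOn (u : M → Y) (A : Set M) : ℝ :=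
  sSup { d : ℝ | ∃ x ∈ A, ∃ y ∈ A, d = dist (u x) (u y) }

/-- The pointwise Lipschitz constant `Lip u(x) = limsup_{y→x} d_Y(u(x),u(y))/|xy|`. -/
def pLipMap (u : M → Y) (x : M) : ℝ :=
  Filter.limsup (fun y => dist (u x) (u y) / dist x y) (𝓝[≠] x)

/-- The volume `vol(Σ_x)` of the space of directions at `x`, recovered as
`lim_{r→0⁺} n · vol(B_x(r)) / rⁿ`. -/
def dirVolume (μ : Measure M) (n : ℕ) (x : M) : ℝ :=
  limUnder (𝓝[>] (0:ℝ)) (fun r => (n : ℝ) * (μ (Metric.ball x r)).toReal / r ^ n)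

/-- The model function `s_k`. -/
def snk (k r : ℝ) : ℝ :=
  if k < 0 then Real.sinh (Real.sqrt (-k) * r) / Real.sqrt (-k)
  else if k = 0 then r
  else Real.sin (Real.sqrt k * r) / Real.sqrt k

/-- The set `M^δ = {x : vol(Σ_x) > (1-δ)·vol(𝕊^{n-1})}` of `δ`-regular points. -/
def Mdelta (μ : Measure M) (n : ℕ) (δ : ℝ) : Set M :=
  { x : M | (1 - δ) * sphereVol n < dirVolume μ n x }

/-- The auxiliary function
`f_t(x,λ) = inf_{y∈Ω'} { e^{-2nkλ} |xy|²/(2t) - d_Y(u(x),u(y)) }`. -/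
def auxF (n : ℕ) (k : ℝ) (u : M → Y) (Ω' : Set M) (t : ℝ) (x : M) (l : ℝ) : ℝ :=
  sInf { v : ℝ | ∃ y ∈ Ω',
    v = Real.exp (-2 * (n : ℝ) * k * l) * dist x y ^ 2 / (2 * t) - dist (u x) (u y) }

/-- The set `S_t(x,λ)` of points realizing the infimum defining `f_t(x,λ)`. -/
def auxS (n : ℕ) (k : ℝ) (u : M → Y) (Ω' : Set M) (t : ℝ) (l : ℝ) (x : M) : Set M :=
  { y ∈ Ω' | auxF n k u Ω' t x l
      = Real.exp (-2 * (n : ℝ) * k * l) * dist x y ^ 2 / (2 * t) - dist (u x) (u y) }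

/-- `L_{t,λ}(x) = dist(x, S_t(x,λ))`. -/
def auxL (n : ℕ) (k : ℝ) (u : M → Y) (Ω' : Set M) (t : ℝ) (l : ℝ) (x : M) : ℝ :=
  Metric.infDist x (auxS n k u Ω' t l x)

/-- Distance between two sets. -/
def setDist (A B : Set M) : ℝ := sInf { d : ℝ | ∃ x ∈ A, ∃ y ∈ B, d = dist x y }

/-- `g` is a (weak) super-solution of the heat equation `𝓛_g = ∂g/∂λ` on the parabolic
cylinder `Q = G×I`: `-∫_Q ⟨∇g,∇φ⟩ dν ≤ ∫_Q (∂g/∂λ)φ dν` for all nonnegative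
`φ ∈ Lip_0(Q)`, with `ν = μ × 𝓛¹` and spatial weak gradients. -/
def IsHeatSupersolution (F : SobolevFramework M μ) (G : Set M) (I : Set ℝ)
    (g : M × ℝ → ℝ) : Prop :=
  ∀ φ : M × ℝ → ℝ, IsLip0 (G ×ˢ I) φ → (∀ z, 0 ≤ φ z) →
    -∫ z in G ×ˢ I, F.innerGrad (fun x => g (x, z.2)) (fun x => φ (x, z.2)) z.1
        ∂(μ.prod volume) ≤
      ∫ z in G ×ˢ I, deriv (fun s => g (z.1, s)) z.2 * φ z ∂(μ.prod volume)

/-- `g` is a (weak) sub-solution of the heat equation `𝓛_g = ∂g/∂λ` on `Q = G×I`. -/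
def IsHeatSubsolution (F : SobolevFramework M μ) (G : Set M) (I : Set ℝ)
    (g : M × ℝ → ℝ) : Prop :=
  ∀ φ : M × ℝ → ℝ, IsLip0 (G ×ˢ I) φ → (∀ z, 0 ≤ φ z) →
    ∫ z in G ×ˢ I, deriv (fun s => g (z.1, s)) z.2 * φ z ∂(μ.prod volume) ≤
      -∫ z in G ×ˢ I, F.innerGrad (fun x => g (x, z.2)) (fun x => φ (x, z.2)) z.1
        ∂(μ.prod volume)

/-- `|∇⁺v|(x) = limsup_{r→0} sup_{y∈B_x(r)} (v(y)-v(x))_+ / r`. -/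
def upGrad (v : M → ℝ) (x : M) : ℝ :=
  Filter.limsup
    (fun r => sSup { d : ℝ | ∃ y ∈ Metric.ball x r, d = max (v y - v x) 0 / r })
    (𝓝[>] (0:ℝ))

end Paper

namespace Paper

theorem hasDerivAt_snk_zero (k : ℝ) : HasDerivAt (snk k) 1 0 := by
  rcases lt_trichotomy k 0 with hk | rfl | hk
  · have hs : Real.sqrt (-k) ≠ 0 := (Real.sqrt_pos.2 (by linarith)).ne'
    have h := (((hasDerivAt_id (0 : ℝ)).const_mul (Real.sqrt (-k))).sinh).div_const
      (Real.sqrt (-k))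
    have e : snk k = fun x => Real.sinh (Real.sqrt (-k) * id x) / Real.sqrt (-k) := by
      funext x; simp [snk, hk]
    rw [e]
    exact h.congr_deriv (by simp [hs])
  · have e : snk 0 = id := by funext x; simp [snk]
    rw [e]
    exact hasDerivAt_id 0
  · have hs : Real.sqrt k ≠ 0 := (Real.sqrt_pos.2 hk).ne'
    have h := (((hasDerivAt_id (0 : ℝ)).const_mul (Real.sqrt k)).sin).div_const
      (Real.sqrt k)
    have e : snk k = fun x => Real.sin (Real.sqrt k * id x) / Real.sqrt k := by
      funext x; simp [snk, hk.not_gt, hk.ne']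
    rw [e]
    exact h.congr_deriv (by simp [hs])

theorem snk_zero (k : ℝ) : snk k 0 = 0 := by
  unfold snk; split_ifs <;> simp

theorem exists_abs_snk_sub_le (k : ℝ) {θ : ℝ} (hθ : 0 < θ) :
    ∃ r > 0, ∀ x, |x| < r → |snk k x - x| ≤ θ * |x| := by
  have h := (hasDerivAt_iff_isLittleO.1 (hasDerivAt_snk_zero k)).def hθ
  obtain ⟨r, hr, h⟩ := Metric.eventually_nhds_iff.1 h
  refine ⟨r, hr, fun x hx => ?_⟩
  have := h (y := x) (by simpa [Real.dist_eq] using hx)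
  simpa [snk_zero] using this

/-- The law of cosines in half-side form. -/
theorem cmpAngle_eq (k : ℝ) {a b : ℝ} (c : ℝ) (ha : snk k a ≠ 0) (hb : snk k b ≠ 0) :
    cmpAngle k a b c = Real.arccos
      (1 - 2 * (snk k ((c + a - b) / 2) * snk k ((c - a + b) / 2)) / (snk k a * snk k b)) := by
  unfold cmpAngle
  rcases lt_trichotomy k 0 with hk | rfl | hk
  · have hs : Real.sqrt (-k) ≠ 0 := (Real.sqrt_pos.2 (by linarith)).ne'
    simp only [snk, hk, hk.ne, if_true, if_false] at ha hb ⊢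
    set q := Real.sqrt (-k)
    have ha' : Real.sinh (q * a) ≠ 0 := fun h => ha (by rw [h, zero_div])
    have hb' : Real.sinh (q * b) ≠ 0 := fun h => hb (by rw [h, zero_div])
    congr 1
    have e : Real.cosh (q * c) - Real.cosh (q * a - q * b) =
        2 * (Real.sinh (q * ((c + a - b) / 2)) * Real.sinh (q * ((c - a + b) / 2))) := by
      have e1 : q * c = q * ((c + a - b) / 2) + q * ((c - a + b) / 2) := by ring
      have e2 : q * a - q * b = q * ((c + a - b) / 2) - q * ((c - a + b) / 2) := by ring
      rw [e2, Real.cosh_sub]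
      conv_lhs => rw [e1, Real.cosh_add]
      ring
    rw [Real.cosh_sub] at e
    generalize Real.sinh (q * ((c + a - b) / 2)) = S₁ at *
    generalize Real.sinh (q * ((c - a + b) / 2)) = S₂ at *
    field_simp
    linarith
  · simp only [snk, lt_irrefl, if_true, if_false] at ha hb ⊢
    congr 1
    field_simp
    ring
  · have hs : Real.sqrt k ≠ 0 := (Real.sqrt_pos.2 hk).ne'
    simp only [snk, hk.not_gt, hk.ne', if_false] at ha hb ⊢
    set q := Real.sqrt k
    have ha' : Real.sin (q * a) ≠ 0 := fun h => ha (by rw [h, zero_div])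
    have hb' : Real.sin (q * b) ≠ 0 := fun h => hb (by rw [h, zero_div])
    congr 1
    have e : Real.cos (q * a - q * b) - Real.cos (q * c) =
        2 * (Real.sin (q * ((c + a - b) / 2)) * Real.sin (q * ((c - a + b) / 2))) := by
      have e1 : q * c = q * ((c + a - b) / 2) + q * ((c - a + b) / 2) := by ring
      have e2 : q * a - q * b = q * ((c + a - b) / 2) - q * ((c - a + b) / 2) := by ring
      rw [e2, Real.cos_sub]
      conv_lhs => rw [e1, Real.cos_add]
      ring
    rw [Real.cos_sub] at e
    generalize Real.sin (q * ((c + a - b) / 2)) = S₁ at *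
    generalize Real.sin (q * ((c - a + b) / 2)) = S₂ at *
    field_simp
    linarith

theorem one_sub_halfSide_ge (k : ℝ) {a b : ℝ} (c : ℝ) (ha : snk k a ≠ 0) (hb : snk k b ≠ 0) :
    1 - 2 * (snk k ((c + a - b) / 2) * snk k ((c - a + b) / 2)) / (snk k a * snk k b) =
      -1 + 2 * (snk k ((a + b + c) / 2) * snk k ((a + b - c) / 2)) / (snk k a * snk k b) := by
  rcases lt_trichotomy k 0 with hk | rfl | hk
  · have hs : Real.sqrt (-k) ≠ 0 := (Real.sqrt_pos.2 (by linarith)).ne'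
    simp only [snk, hk, if_true] at ha hb ⊢
    set q := Real.sqrt (-k)
    have ha' : Real.sinh (q * a) ≠ 0 := fun h => ha (by rw [h, zero_div])
    have hb' : Real.sinh (q * b) ≠ 0 := fun h => hb (by rw [h, zero_div])
    have f (x y : ℝ) : 2 * (Real.sinh x * Real.sinh y) = Real.cosh (x + y) - Real.cosh (x - y) := by
      rw [Real.cosh_add, Real.cosh_sub]; ring
    have e1 := f (q * ((c + a - b) / 2)) (q * ((c - a + b) / 2))
    have e2 := f (q * ((a + b + c) / 2)) (q * ((a + b - c) / 2))
    have e3 := f (q * a) (q * b)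
    have g1 : q * ((c + a - b) / 2) + q * ((c - a + b) / 2) = q * c := by ring
    have g2 : q * ((c + a - b) / 2) - q * ((c - a + b) / 2) = q * a - q * b := by ring
    have g3 : q * ((a + b + c) / 2) + q * ((a + b - c) / 2) = q * a + q * b := by ring
    have g4 : q * ((a + b + c) / 2) - q * ((a + b - c) / 2) = q * c := by ring
    rw [g1, g2] at e1
    rw [g3, g4] at e2
    generalize Real.sinh (q * ((c + a - b) / 2)) = S₁ at *
    generalize Real.sinh (q * ((c - a + b) / 2)) = S₂ at *
    generalize Real.sinh (q * ((a + b + c) / 2)) = S₃ at *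
    generalize Real.sinh (q * ((a + b - c) / 2)) = S₄ at *
    field_simp
    linarith
  · simp only [snk, lt_irrefl, if_true, if_false] at ha hb ⊢
    field_simp
    ring
  · have hs : Real.sqrt k ≠ 0 := (Real.sqrt_pos.2 hk).ne'
    simp only [snk, hk.not_gt, hk.ne', if_false] at ha hb ⊢
    set q := Real.sqrt k
    have ha' : Real.sin (q * a) ≠ 0 := fun h => ha (by rw [h, zero_div])
    have hb' : Real.sin (q * b) ≠ 0 := fun h => hb (by rw [h, zero_div])
    have f (x y : ℝ) : 2 * (Real.sin x * Real.sin y) = Real.cos (x - y) - Real.cos (x + y) := by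
      rw [Real.cos_add, Real.cos_sub]; ring
    have e1 := f (q * ((c + a - b) / 2)) (q * ((c - a + b) / 2))
    have e2 := f (q * ((a + b + c) / 2)) (q * ((a + b - c) / 2))
    have e3 := f (q * a) (q * b)
    have g1 : q * ((c + a - b) / 2) + q * ((c - a + b) / 2) = q * c := by ring
    have g2 : q * ((c + a - b) / 2) - q * ((c - a + b) / 2) = q * a - q * b := by ring
    have g3 : q * ((a + b + c) / 2) + q * ((a + b - c) / 2) = q * a + q * b := by ring
    have g4 : q * ((a + b + c) / 2) - q * ((a + b - c) / 2) = q * c := by ring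
    rw [g1, g2] at e1
    rw [g3, g4] at e2
    generalize Real.sin (q * ((c + a - b) / 2)) = S₁ at *
    generalize Real.sin (q * ((c - a + b) / 2)) = S₂ at *
    generalize Real.sin (q * ((a + b + c) / 2)) = S₃ at *
    generalize Real.sin (q * ((a + b - c) / 2)) = S₄ at *
    field_simp
    linarith

theorem mul_le_of_cmpAngle_le (k : ℝ) {η : ℝ} (hη : 0 < η) :
    ∃ r > 0, ∀ a b c c' s : ℝ, 0 < a → a < r → 0 < b → b < r → 0 < s → s ≤ 1 →
      |a - b| ≤ c → c ≤ a + b → s * |a - b| ≤ c' → c' ≤ s * (a + b) →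
      cmpAngle k a b c ≤ cmpAngle k (s * a) (s * b) c' → s * c ≤ (1 + η) * c' := by
  obtain ⟨θ, hθ, hθ4, hθη⟩ : ∃ θ : ℝ, 0 < θ ∧ θ ≤ 1 / 4 ∧ θ ≤ η / 16 :=
    ⟨min (1 / 4) (η / 16), by positivity, min_le_left _ _, min_le_right _ _⟩
  have t6 : (1 + θ) ^ 2 ≤ (1 + η) * (1 - θ) ^ 2 := by
    have : (3 / 4 : ℝ) ^ 2 ≤ (1 - θ) ^ 2 := pow_le_pow_left₀ (by norm_num) (by linarith) 2
    nlinarith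
  obtain ⟨r, hr, hS⟩ := exists_abs_snk_sub_le k hθ
  have up : ∀ x, 0 ≤ x → x < r → snk k x ≤ (1 + θ) * x := fun x h0 h1 => by
    have := (abs_le.1 (hS x (by rwa [abs_of_nonneg h0]))).2
    rw [abs_of_nonneg h0] at this; linarith
  have lo : ∀ x, 0 ≤ x → x < r → (1 - θ) * x ≤ snk k x := fun x h0 h1 => by
    have := (abs_le.1 (hS x (by rwa [abs_of_nonneg h0]))).1
    rw [abs_of_nonneg h0] at this; linarith
  have nn : ∀ x, 0 ≤ x → x < r → 0 ≤ snk k x := fun x h0 h1 =>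
    le_trans (mul_nonneg (by linarith) h0) (lo x h0 h1)
  have pos : ∀ x, 0 < x → x < r → 0 < snk k x := fun x h0 h1 =>
    lt_of_lt_of_le (mul_pos (by linarith) h0) (lo x h0.le h1)
  refine ⟨r / 2, by positivity, fun a b c c' s ha har hb hbr hs hs1 h1 h2 h3 h4 h => ?_⟩
  have h1' := abs_le.1 h1
  have hc : 0 ≤ c := (abs_nonneg _).trans h1
  have hc' : 0 ≤ c' := (mul_nonneg hs.le (abs_nonneg _)).trans h3
  have h3' : |s * a - s * b| ≤ c' := by rwa [← mul_sub, abs_mul, abs_of_pos hs]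
  have h3'' := abs_le.1 h3'
  have hsa : s * a ≤ a := by nlinarith
  have hsb : s * b ≤ b := by nlinarith
  have hsa0 : 0 < s * a := mul_pos hs ha
  have hsb0 : 0 < s * b := mul_pos hs hb
  have pa := pos a ha (by linarith)
  have pb := pos b hb (by linarith)
  have psa := pos (s * a) hsa0 (by linarith)
  have psb := pos (s * b) hsb0 (by linarith)
  rw [cmpAngle_eq k c pa.ne' pb.ne', cmpAngle_eq k c' psa.ne' psb.ne'] at h
  have nu := nn ((c + a - b) / 2) (by linarith) (by linarith)
  have nv := nn ((c - a + b) / 2) (by linarith) (by linarith)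
  have lu := lo ((c + a - b) / 2) (by linarith) (by linarith)
  have lv := lo ((c - a + b) / 2) (by linarith) (by linarith)
  have nu' := nn ((c' + s * a - s * b) / 2) (by linarith) (by linarith)
  have nv' := nn ((c' - s * a + s * b) / 2) (by linarith) (by linarith)
  have uu' := up ((c' + s * a - s * b) / 2) (by linarith) (by linarith)
  have uv' := up ((c' - s * a + s * b) / 2) (by linarith) (by linarith)
  have hX : 1 - 2 * (snk k ((c' + s * a - s * b) / 2) * snk k ((c' - s * a + s * b) / 2)) /
      (snk k (s * a) * snk k (s * b)) ≤
      1 - 2 * (snk k ((c + a - b) / 2) * snk k ((c - a + b) / 2)) / (snk k a * snk k b) := by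
    by_contra! hlt
    refine absurd (Real.arccos_lt_arccos ?_ hlt ?_) (not_lt.2 h)
    · rw [one_sub_halfSide_ge k c pa.ne' pb.ne']
      have := nn ((a + b + c) / 2) (by linarith) (by linarith)
      have := nn ((a + b - c) / 2) (by linarith) (by linarith)
      have : 0 ≤ 2 * (snk k ((a + b + c) / 2) * snk k ((a + b - c) / 2)) / (snk k a * snk k b) := by
        positivity
      linarith
    · have : 0 ≤ 2 * (snk k ((c' + s * a - s * b) / 2) * snk k ((c' - s * a + s * b) / 2)) /
        (snk k (s * a) * snk k (s * b)) := by positivity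
      linarith
  have hX2 : (snk k ((c + a - b) / 2) * snk k ((c - a + b) / 2)) / (snk k a * snk k b) ≤
      (snk k ((c' + s * a - s * b) / 2) * snk k ((c' - s * a + s * b) / 2)) /
      (snk k (s * a) * snk k (s * b)) := by
    have e (P Q : ℝ) : 2 * P / Q = 2 * (P / Q) := mul_div_assoc _ _ _
    simp only [e] at hX
    linarith
  have ua := up a ha.le (by linarith)
  have ub := up b hb.le (by linarith)
  have la := lo (s * a) hsa0.le (by linarith)
  have lb := lo (s * b) hsb0.le (by linarith)
  have t1 : (1 - θ) ^ 2 * (((c + a - b) / 2) * ((c - a + b) / 2)) / ((1 + θ) ^ 2 * (a * b)) ≤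
      (1 + θ) ^ 2 * (((c' + s * a - s * b) / 2) * ((c' - s * a + s * b) / 2)) /
        ((1 - θ) ^ 2 * ((s * a) * (s * b))) := by
    refine le_trans (le_trans ?_ hX2) ?_
    · apply div_le_div₀ (mul_nonneg nu nv) _ (mul_pos pa pb)
      · calc snk k a * snk k b ≤ ((1 + θ) * a) * ((1 + θ) * b) :=
              mul_le_mul ua ub pb.le (by positivity)
          _ = _ := by ring
      · calc _ = ((1 - θ) * ((c + a - b) / 2)) * ((1 - θ) * ((c - a + b) / 2)) := by ring
          _ ≤ _ := mul_le_mul lu lv (mul_nonneg (by linarith) (by linarith)) nu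
    · have : 0 < 1 - θ := by linarith
      apply div_le_div₀ _ _ (by positivity)
      · calc _ = ((1 - θ) * (s * a)) * ((1 - θ) * (s * b)) := by ring
          _ ≤ _ := mul_le_mul la lb (by positivity) psa.le
      · exact mul_nonneg (by positivity) (mul_nonneg (by linarith) (by linarith))
      · calc _ ≤ ((1 + θ) * ((c' + s * a - s * b) / 2)) * ((1 + θ) * ((c' - s * a + s * b) / 2)) :=
              mul_le_mul uu' uv' nv' (mul_nonneg (by linarith) (by linarith))
          _ = _ := by ring
  have hθ1 : 0 < 1 - θ := by linarith
  rw [div_le_div_iff₀ (by positivity) (by positivity)] at t1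
  have t2 : (1 - θ) ^ 4 * s ^ 2 * (c ^ 2 - (a - b) ^ 2) ≤
      (1 + θ) ^ 4 * (c' ^ 2 - s ^ 2 * (a - b) ^ 2) := by
    have hab : 0 < a * b := mul_pos ha hb
    refine le_of_mul_le_mul_right ?_ hab
    calc _ = 4 * ((1 - θ) ^ 2 * ((c + a - b) / 2 * ((c - a + b) / 2)) *
          ((1 - θ) ^ 2 * (s * a * (s * b)))) := by ring
      _ ≤ _ := mul_le_mul_of_nonneg_left t1 (by norm_num)
      _ = _ := by ring
  have t3 : (1 - θ) ^ 4 ≤ (1 + θ) ^ 4 := pow_le_pow_left₀ hθ1.le (by linarith) 4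
  have t4 : ((1 - θ) ^ 2 * (s * c)) ^ 2 ≤ ((1 + θ) ^ 2 * c') ^ 2 := by
    have := mul_le_mul_of_nonneg_right t3 (mul_nonneg (sq_nonneg s) (sq_nonneg (a - b)))
    calc _ = (1 - θ) ^ 4 * s ^ 2 * (c ^ 2 - (a - b) ^ 2) +
          (1 - θ) ^ 4 * (s ^ 2 * (a - b) ^ 2) := by ring
      _ ≤ (1 + θ) ^ 4 * (c' ^ 2 - s ^ 2 * (a - b) ^ 2) +
          (1 + θ) ^ 4 * (s ^ 2 * (a - b) ^ 2) := add_le_add t2 this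
      _ = _ := by ring
  have t5 := (sq_le_sq₀ (by positivity) (by positivity)).1 t4
  have t7 : (1 - θ) ^ 2 * (s * c) ≤ (1 - θ) ^ 2 * ((1 + η) * c') :=
    t5.trans ((mul_le_mul_of_nonneg_right t6 hc').trans_eq (by ring))
  exact le_of_mul_le_mul_left t7 (by positivity)

/-- `z` divides the pair `(x, y)` in the ratio `t : 1 - t`. -/
def IsBtw {M : Type*} [MetricSpace M] (t : ℝ) (x y z : M) : Prop :=
  dist x z = t * dist x y ∧ dist z y = (1 - t) * dist x y

theorem IsBtw.symm {M : Type*} [MetricSpace M] {t : ℝ} {x y z : M} (h : IsBtw t x y z) :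
    IsBtw (1 - t) y x z := by
  refine ⟨?_, ?_⟩
  · rw [dist_comm y z, h.2, dist_comm y x]
  · rw [dist_comm z x, h.1, dist_comm y x]; ring

theorem IsBtw.dist_add {M : Type*} [MetricSpace M] {t : ℝ} {x y z : M} (h : IsBtw t x y z) :
    dist x z + dist z y = dist x y := by
  rw [h.1, h.2]; ring

theorem GeodesicSpace.exists_isBtw {M : Type*} [MetricSpace M] (hG : GeodesicSpace M)
    (x y : M) {t : ℝ} (ht : t ∈ Icc (0 : ℝ) 1) : ∃ z, IsBtw t x y z := by
  obtain ⟨γ, ⟨-, h⟩, h0, h1⟩ := hG x y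
  have hd := dist_nonneg (x := x) (y := y)
  have m : t * dist x y ∈ Icc 0 (dist x y) :=
    ⟨mul_nonneg ht.1 hd, mul_le_of_le_one_left hd ht.2⟩
  refine ⟨γ (t * dist x y), ?_, ?_⟩
  · have := h 0 ⟨le_rfl, hd⟩ _ m
    rwa [h0, zero_sub, abs_neg, abs_of_nonneg m.1] at this
  · have := h _ m _ ⟨hd, le_rfl⟩
    rw [h1, abs_sub_comm, abs_of_nonneg (sub_nonneg.2 m.2)] at this
    rw [this]; ring

theorem GeodesicSpace.exists_geodesic_through {M : Type*} [MetricSpace M] (hG : GeodesicSpace M)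
    {x y z : M} (h : dist x z + dist z y = dist x y) :
    ∃ γ : ℝ → M, IsUnitGeodesic γ (dist x y) ∧ γ 0 = x ∧ γ (dist x z) = z ∧
      γ (dist x y) = y := by
  obtain ⟨γ, ⟨-, hγ⟩, hγ0, hγ1⟩ := hG x z
  obtain ⟨σ, ⟨-, hσ⟩, hσ0, hσ1⟩ := hG z y
  have ha := dist_nonneg (x := x) (y := z)
  have hb := dist_nonneg (x := z) (y := y)
  set a := dist x z
  set b := dist z y
  set τ : ℝ → M := fun t => if t ≤ a then γ t else σ (t - a) with hτ
  have τ0 : τ 0 = x := by simp [hτ, ha, hγ0]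
  have τ1 : τ (dist x y) = y := by
    rw [← h]
    simp only [hτ]
    split_ifs with hh
    · have hb0 : b = 0 := by linarith
      rw [hb0, add_zero, hγ1]
      exact dist_eq_zero.1 hb0
    · rw [add_sub_cancel_left, hσ1]
  have key : ∀ s ∈ Icc (0 : ℝ) (dist x y), ∀ t ∈ Icc (0 : ℝ) (dist x y), s ≤ t →
      dist (τ s) (τ t) ≤ t - s := by
    intro s hs t ht hst
    have h1 := hs.1
    have h2 := ht.2
    simp only [hτ]
    split_ifs with i1 i2 i2
    · rw [hγ s ⟨h1, i1⟩ t ⟨h1.trans hst, i2⟩, abs_sub_comm, abs_of_nonneg (by linarith)]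
    · calc dist (γ s) (σ (t - a)) ≤ dist (γ s) z + dist z (σ (t - a)) := dist_triangle _ _ _
        _ = dist (γ s) (γ a) + dist (σ 0) (σ (t - a)) := by rw [hγ1, hσ0]
        _ = (a - s) + (t - a) := by
          rw [hγ s ⟨h1, i1⟩ a ⟨ha, le_rfl⟩, hσ 0 ⟨le_rfl, hb⟩ (t - a)
            ⟨by linarith, by linarith⟩, abs_sub_comm, abs_of_nonneg (by linarith),
            abs_sub_comm, abs_of_nonneg (by linarith), sub_zero]
        _ = t - s := by ring
    · linarith
    · rw [hσ (s - a) ⟨by linarith, by linarith⟩ (t - a) ⟨by linarith, by linarith⟩,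
        abs_sub_comm, abs_of_nonneg (by linarith)]
      linarith
  have key2 : ∀ s ∈ Icc (0 : ℝ) (dist x y), ∀ t ∈ Icc (0 : ℝ) (dist x y), s ≤ t →
      dist (τ s) (τ t) = t - s := by
    intro s hs t ht hst
    refine le_antisymm (key s hs t ht hst) ?_
    have d0 := dist_nonneg (x := x) (y := y)
    have e1 := key 0 ⟨le_rfl, d0⟩ s hs hs.1
    have e2 := key t ht (dist x y) ⟨d0, le_rfl⟩ ht.2
    rw [τ0] at e1
    rw [τ1] at e2
    have := dist_triangle4 x (τ s) (τ t) y
    linarith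
  refine ⟨τ, ⟨dist_nonneg, fun s hs t ht => ?_⟩, τ0, by simp [hτ, hγ1], τ1⟩
  rcases le_total s t with hst | hst
  · rw [key2 s hs t ht hst, abs_sub_comm, abs_of_nonneg (by linarith)]
  · rw [dist_comm, key2 t ht s hs hst, abs_of_nonneg (by linarith)]

/-- Homothetic contractions centred at points of `ball x₀ R` are almost expanding,
after rescaling, on sufficiently small balls. -/
def GoodBall {M : Type*} [MetricSpace M] (x₀ : M) (R : ℝ) : Prop :=
  0 < R ∧ IsCompact (closedBall x₀ R) ∧ ∀ η > 0, ∃ δ > 0, ∀ p ∈ ball x₀ R,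
    ∀ y ∈ ball p δ, ∀ y' ∈ ball p δ, ∀ s ∈ Ioc (0 : ℝ) 1, ∀ z z',
      IsBtw s p y z → IsBtw s p y' z' → s * dist y y' ≤ (1 + η) * dist z z'

theorem CurvBddBelow.exists_goodBall {M : Type*} [MetricSpace M] {k : ℝ} (h : CurvBddBelow M k)
    (x₀ : M) : ∃ R, GoodBall x₀ R := by
  obtain ⟨U, hU, hcmp⟩ := h.comparison x₀
  have := h.locallyCompact
  obtain ⟨K, hK, hKx⟩ := exists_compact_mem_nhds x₀
  obtain ⟨ρ, hρ, hρU⟩ := Metric.mem_nhds_iff.1 (Filter.inter_mem hU hKx)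
  refine ⟨ρ / 2, by positivity, hK.of_isClosed_subset isClosed_closedBall
    ((closedBall_subset_ball (by linarith)).trans (hρU.trans inter_subset_right)),
    fun η hη => ?_⟩
  obtain ⟨r, hr, hmain⟩ := mul_le_of_cmpAngle_le k hη
  refine ⟨min r (ρ / 2), by positivity, fun p hp y hy y' hy' s hs z z' hz hz' => ?_⟩
  have hp : dist p x₀ < ρ / 2 := hp
  have hy : dist p y < min r (ρ / 2) := by rw [dist_comm]; exact hy
  have hy' : dist p y' < min r (ρ / 2) := by rw [dist_comm]; exact hy'
  have triv : ∀ {y z y' z' : M}, IsBtw s p y z → IsBtw s p y' z' → dist p y = 0 →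
      s * dist y y' ≤ (1 + η) * dist z z' := by
    intro y z y' z' hz hz' h0
    have h1 : dist p z = 0 := by rw [hz.1, h0, mul_zero]
    rw [← dist_eq_zero.1 h0, ← dist_eq_zero.1 h1, ← hz'.1]
    have := dist_nonneg (x := p) (y := z')
    nlinarith
  rcases (dist_nonneg (x := p) (y := y)).eq_or_lt with h0 | ha
  · exact triv hz hz' h0.symm
  rcases (dist_nonneg (x := p) (y := y')).eq_or_lt with h0 | hb
  · have := triv hz' hz h0.symm
    rwa [dist_comm y', dist_comm z'] at this
  obtain ⟨γ, hγ, γ0, γz, γy⟩ := h.geodesic.exists_geodesic_through hz.dist_add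
  obtain ⟨σ, hσ, σ0, σz, σy⟩ := h.geodesic.exists_geodesic_through hz'.dist_add
  have inU : ∀ (γ : ℝ → M) (y : M), IsUnitGeodesic γ (dist p y) → γ 0 = p →
      dist p y < min r (ρ / 2) → ∀ t ∈ Icc (0 : ℝ) (dist p y), γ t ∈ U := by
    intro γ y hγ γ0 hy t ht
    refine (hρU ?_).1
    have h1 := hγ.2 t ht 0 ⟨le_rfl, dist_nonneg⟩
    rw [γ0, sub_zero, abs_of_nonneg ht.1] at h1
    have h2 := dist_triangle (γ t) p x₀
    have := min_le_right r (ρ / 2)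
    have := ht.2
    rw [mem_ball]; linarith
  have sa : s * dist p y ≤ dist p y := mul_le_of_le_one_left dist_nonneg hs.2
  have sb : s * dist p y' ≤ dist p y' := mul_le_of_le_one_left dist_nonneg hs.2
  have hc := hcmp p γ σ _ _ hγ hσ (inU γ y hγ γ0 hy) (inU σ y' hσ σ0 hy') γ0 σ0
    (s * dist p y) (s * dist p y') (dist p y) (dist p y')
    (mul_pos hs.1 ha) sa le_rfl (mul_pos hs.1 hb) sb le_rfl
  rw [γy, σy, ← hz.1, γz, ← hz'.1, σz, hz.1, hz'.1] at hc
  have tri : ∀ y y' : M, |dist p y - dist p y'| ≤ dist y y' ∧ dist y y' ≤ dist p y + dist p y' := by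
    intro y y'
    rw [dist_comm p y, dist_comm p y']
    exact ⟨abs_dist_sub_le y y' p, dist_triangle_right y y' p⟩
  refine hmain _ _ _ _ s ha (hy.trans_le (min_le_left _ _)) hb (hy'.trans_le (min_le_left _ _))
    hs.1 hs.2 (tri y y').1 (tri y y').2 ?_ ?_ hc
  · have := (tri z z').1
    rwa [hz.1, hz'.1, ← mul_sub, abs_mul, abs_of_pos hs.1] at this
  · have := (tri z z').2
    rwa [hz.1, hz'.1, ← mul_add] at this

theorem GoodBall.mono {M : Type*} [MetricSpace M] {x₀ : M} {R R' : ℝ} (h : GoodBall x₀ R)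
    (h0 : 0 < R') (hR : R' ≤ R) : GoodBall x₀ R' :=
  ⟨h0, h.2.1.of_isClosed_subset isClosed_closedBall (closedBall_subset_closedBall hR),
    fun η hη => (h.2.2 η hη).imp fun _ hδ => ⟨hδ.1, fun p hp => hδ.2 p (ball_subset_ball hR hp)⟩⟩

/-- Geodesics that can be prolonged are unique. -/
theorem IsBtw.unique {M : Type*} [MetricSpace M] {C δ τ : ℝ} {x w y z z' : M}
    (hy : ∀ a ∈ ball y δ, ∀ a' ∈ ball y δ, ∀ s ∈ Ioc (0 : ℝ) 1, ∀ b b',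
      IsBtw s y a b → IsBtw s y a' b' → s * dist a a' ≤ C * dist b b')
    (hxy : dist x y < δ) (hadd : dist x w + dist w y = dist x y) (hw : 0 < dist w y)
    (hτ : τ ∈ Icc (0 : ℝ) 1) (hz : IsBtw τ x w z) (hz' : IsBtw τ x w z') : z = z' := by
  have dxw := dist_nonneg (x := x) (y := w)
  have dz : ∀ {z}, IsBtw τ x w z → dist z y = dist w y + (1 - τ) * dist x w := by
    intro z hz
    have h1 := dist_triangle z w y
    have h2 := dist_triangle x z y
    rw [hz.2] at h1
    rw [hz.1] at h2
    apply le_antisymm <;> linarith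
  set L := dist w y + (1 - τ) * dist x w with hL
  have hL1 : 0 ≤ (1 - τ) * dist x w := mul_nonneg (by linarith [hτ.2]) dxw
  have hL0 : 0 < L := by positivity
  have hLδ : L < δ := by
    have : (1 - τ) * dist x w ≤ dist x w := mul_le_of_le_one_left dxw (by linarith [hτ.1])
    linarith
  have hb : ∀ {z}, IsBtw τ x w z → IsBtw (dist w y / L) y z w := by
    intro z hz
    have e := dz hz
    rw [dist_comm] at e
    refine ⟨?_, ?_⟩
    · rw [e, dist_comm y w]; field_simp
    · rw [e, dist_comm w z, hz.2, hL]
      field_simp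
      linarith
  have := hy z (by rw [mem_ball, dz hz]; exact hLδ) z' (by rw [mem_ball, dz hz']; exact hLδ)
    (dist w y / L) ⟨by positivity, (div_le_one hL0).2 (by linarith)⟩ w w (hb hz) (hb hz')
  rw [dist_self, mul_zero] at this
  have h0 : 0 < dist w y / L := by positivity
  exact dist_le_zero.1 (nonpos_of_mul_nonpos_right this h0)

theorem card_le_of_cantor_embedding {X : Type*} [MetricSpace X] {n : ℕ}
    (hdim : dimH (univ : Set X) ≤ n) {K : ℕ} (hK : 1 < K) {q c : ℝ} (hq : 0 < q) (hq1 : q < 1)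
    (hc : 0 < c) (f : (ℕ → Fin K) → X)
    (hf : ∀ a b j, (∀ i < j, a i = b i) → a j ≠ b j → c * q ^ j ≤ dist (f a) (f b)) :
    (K : ℝ) ≤ (1 / q) ^ n := by
  by_contra! hlt
  have hK0 : (0 : ℝ) < K := by positivity
  have hK1 : (1 : ℝ) < K := by exact_mod_cast hK
  have hlq : 0 < Real.log (1 / q) := Real.log_pos (by rw [one_div]; exact (one_lt_inv₀ hq).2 hq1)
  have hlK : 0 < Real.log K := Real.log_pos hK1
  set α : ℝ := Real.log K / Real.log (1 / q) with hα
  have hαn : (n : ℝ) < α := by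
    rw [hα, lt_div_iff₀ hlq, ← Real.log_pow]
    exact Real.log_lt_log (by positivity) hlt
  have hα0 : 0 < α := by positivity
  have hqα : q ^ α = (K : ℝ)⁻¹ := by
    rw [Real.rpow_def_of_pos hq]
    have : Real.log q * α = -Real.log K := by
      rw [hα, one_div, Real.log_inv]
      rw [one_div, Real.log_inv] at hlq
      have : Real.log q ≠ 0 := by linarith
      field_simp
    rw [this, Real.exp_neg, Real.exp_log hK0]
  have hne : ∀ a b, a ≠ b → ∃ j, (∀ i < j, a i = b i) ∧ (a : ℕ → Fin K) j ≠ b j := by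
    classical
    intro a b hab
    have : ∃ j, a j ≠ b j := Function.ne_iff.1 hab
    exact ⟨Nat.find this, fun i hi => not_not.1 (Nat.find_min this hi), Nat.find_spec this⟩
  have hinj : Function.Injective f := by
    intro a b hab
    by_contra h
    obtain ⟨j, h1, h2⟩ := hne a b h
    have := hf a b j h1 h2
    rw [hab, dist_self] at this
    have : 0 < c * q ^ j := by positivity
    linarith
  have hholder : ∀ a b,
      |Real.ofDigits a - Real.ofDigits b| ≤ (1 / c) ^ α * dist (f a) (f b) ^ α := by
    intro a b
    rcases eq_or_ne a b with rfl | hab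
    · simp [Real.zero_rpow hα0.ne']
    obtain ⟨j, h1, h2⟩ := hne a b hab
    refine (Real.abs_ofDigits_sub_ofDigits_le h1).trans ?_
    have h3 := hf a b j h1 h2
    rw [← Real.mul_rpow (by positivity) dist_nonneg]
    calc _ = (q ^ j) ^ α := by
          rw [← Real.rpow_natCast q j, ← Real.rpow_mul hq.le, mul_comm, Real.rpow_mul hq.le, hqα,
            Real.rpow_natCast, inv_pow]
      _ ≤ _ := Real.rpow_le_rpow (by positivity) (by
          rw [one_div, inv_mul_eq_div, le_div_iff₀ hc, mul_comm]; exact h3) hα0.le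
  have : Nonempty (ℕ → Fin K) := ⟨fun _ => ⟨0, by omega⟩⟩
  set αn : ℝ≥0 := ⟨α, hα0.le⟩
  set h : X → ℝ := fun x => Real.ofDigits (Function.invFun f x) with hh
  have hhf : ∀ a, h (f a) = Real.ofDigits a := fun a => by
    simp only [hh, Function.leftInverse_invFun hinj a]
  have H : HolderOnWith (Real.toNNReal ((1 / c) ^ α)) αn h (range f) := by
    rintro _ ⟨a, rfl⟩ _ ⟨b, rfl⟩
    have hcoe : (αn : ℝ) = α := rfl
    rw [hhf, hhf, edist_dist, edist_dist, hcoe, ENNReal.ofReal_rpow_of_nonneg dist_nonneg hα0.le,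
      Real.dist_eq, ← ENNReal.ofReal.eq_1, ← ENNReal.ofReal_mul (by positivity)]
    exact ENNReal.ofReal_le_ofReal (hholder a b)
  have h1 := H.dimH_image_le (by exact_mod_cast hα0)
  have h2 : Ico (0 : ℝ) 1 ⊆ h '' range f := by
    intro x hx
    obtain ⟨a, -, ha⟩ := Real.ofDigits_SurjOn hK (Ico_subset_Icc_self hx)
    exact ⟨f a, ⟨a, rfl⟩, by rw [hhf, ha]⟩
  have h3 : dimH (Ico (0 : ℝ) 1) = 1 := by
    rw [Real.dimH_of_nonempty_interior (by simp), Module.finrank_self, Nat.cast_one]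
  have h4 : (1 : ℝ≥0∞) ≤ n / αn := by
    calc (1 : ℝ≥0∞) = dimH (Ico (0 : ℝ) 1) := h3.symm
      _ ≤ _ := dimH_mono h2
      _ ≤ _ := h1
      _ ≤ _ := ENNReal.div_le_div_right ((dimH_mono (subset_univ _)).trans hdim) _
  have hαn0 : (αn : ℝ≥0∞) ≠ 0 := by
    have : 0 < αn := by exact_mod_cast hα0
    exact_mod_cast this.ne'
  rw [ENNReal.le_div_iff_mul_le (.inl hαn0) (by simp), one_mul] at h4
  have h5 : αn ≤ (n : ℝ≥0) := by exact_mod_cast h4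
  have h6 : α ≤ n := by exact_mod_cast h5
  linarith

theorem card_le_of_separated {M : Type*} [MetricSpace M] (hG : GeodesicSpace M) {n : ℕ}
    (hdim : dimH (univ : Set M) ≤ n) {x₀ : M} {R : ℝ} (hR : 0 < R)
    (hcpt : IsCompact (closedBall x₀ R))
    (key : ∀ p ∈ closedBall x₀ R, ∀ y ∈ ball p (3 * R), ∀ y' ∈ ball p (3 * R),
      ∀ s ∈ Ioc (0 : ℝ) 1, ∀ z z', IsBtw s p y z → IsBtw s p y' z' →
        s * dist y y' ≤ 2 * dist z z')
    {r : ℝ} (hr : 0 < r) (hrR : r ≤ 24 * R) {K : ℕ} (e : Fin K → M) (he : ∀ i, e i ∈ ball x₀ R)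
    (hsep : ∀ i j, i ≠ j → r ≤ dist (e i) (e j)) :
    (K : ℝ) ≤ (48 * R / r) ^ n := by
  rcases le_or_gt K 1 with hK | hK
  · calc (K : ℝ) ≤ 1 := by exact_mod_cast hK
      _ ≤ _ := one_le_pow₀ (by rw [le_div_iff₀ hr]; linarith)
  set q := r / (48 * R) with hq
  have hq0 : 0 < q := by positivity
  have hq2 : q ≤ 1 / 2 := by rw [hq, div_le_iff₀ (by positivity)]; linarith
  have hqr : q * R = r / 48 := by rw [hq]; field_simp
  set s : ℕ → ℝ := fun j => q ^ j / 6 with hs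
  have hqj : ∀ j, 0 < q ^ j := fun j => by positivity
  have hs01 : ∀ j, s j ∈ Ioc (0 : ℝ) 1 := fun j => by
    have := pow_le_one₀ (n := j) hq0.le (by linarith)
    exact ⟨by positivity, by simp only [hs]; linarith⟩
  choose! con hcon using fun (p y : M) (t : ℝ) (ht : t ∈ Icc (0 : ℝ) 1) => hG.exists_isBtw p y ht
  let pt : (ℕ → Fin K) → ℕ → M := fun a j =>
    Nat.rec x₀ (fun j x => con x (e (a j)) (s j)) j
  have pt0 : ∀ a, pt a 0 = x₀ := fun a => rfl
  have ptS : ∀ a j, IsBtw (s j) (pt a j) (e (a j)) (pt a (j + 1)) := fun a j =>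
    hcon _ _ _ (Ioc_subset_Icc_self (hs01 j))
  have hstep : ∀ a j, dist x₀ (pt a j) ≤ R → dist (pt a j) (pt a (j + 1)) ≤ R / 2 * q ^ j := by
    intro a j hj
    have h1 : dist x₀ (e (a j)) < R := by rw [dist_comm]; exact he _
    have h2 := dist_triangle_left (pt a j) (e (a j)) x₀
    have h3 : dist (pt a j) (e (a j)) ≤ 3 * R := by linarith
    rw [(ptS a j).1]
    calc s j * dist (pt a j) (e (a j)) ≤ s j * (3 * R) :=
          mul_le_mul_of_nonneg_left h3 (hs01 j).1.le
      _ = _ := by simp only [hs]; ring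
  have hin : ∀ a j, dist x₀ (pt a j) ≤ R * (1 - q ^ j) := by
    intro a j
    induction j with
    | zero => simp [pt0]
    | succ j ih =>
      have h0 := hqj j
      have h1 := hstep a j (ih.trans (by nlinarith))
      have h2 := dist_triangle x₀ (pt a j) (pt a (j + 1))
      have h3 : R * (q ^ j * q) ≤ R * (q ^ j * (1 / 2)) := by gcongr
      rw [pow_succ]
      linarith
  have hinR : ∀ a j, dist x₀ (pt a j) ≤ R := fun a j =>
    (hin a j).trans (by have := hqj j; nlinarith)
  have hlim : ∀ a, ∃ x, Tendsto (pt a) atTop (𝓝 x) := by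
    intro a
    have := cauchySeq_of_le_geometric q (R / 2) (by linarith) (fun j => hstep a j (hinR a j))
    obtain ⟨x, -, hx⟩ := cauchySeq_tendsto_of_isComplete hcpt.isComplete
      (fun j => by rw [mem_closedBall, dist_comm]; exact hinR a j) this
    exact ⟨x, hx⟩
  choose f hf using hlim
  have htail : ∀ a j, dist (pt a j) (f a) ≤ R * q ^ j := by
    intro a j
    have h1 := dist_le_of_le_geometric_of_tendsto q (R / 2) (by linarith)
      (fun j => hstep a j (hinR a j)) (hf a) j
    refine h1.trans ?_
    rw [div_le_iff₀ (by linarith)]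
    have := mul_pos hR (hqj j)
    nlinarith
  have hagree : ∀ a b j, (∀ i < j, a i = b i) → pt a j = pt b j := by
    intro a b j
    induction j with
    | zero => intro _; rfl
    | succ j ih =>
      intro h
      have h1 := ih fun i hi => h i (by omega)
      have h2 := h j (by omega)
      change con (pt a j) (e (a j)) (s j) = con (pt b j) (e (b j)) (s j)
      rw [h1, h2]
  have hfin := card_le_of_cantor_embedding hdim hK hq0 (by linarith) (c := r / 24) (by positivity) f
    (by
      intro a b j h1 h2
      have e1 := hagree a b j h1
      have b1 := ptS a j
      have b2 := ptS b j
      rw [← e1] at b2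
      have hball : ∀ i, e i ∈ ball (pt a j) (3 * R) := fun i => by
        have h1 : dist (e i) x₀ < R := he _
        have h2 := dist_triangle (e i) x₀ (pt a j)
        have h3 := hinR a j
        rw [mem_ball]; linarith
      have h3 := key (pt a j) (by rw [mem_closedBall, dist_comm]; exact hinR a j) _ (hball (a j))
        _ (hball (b j)) (s j) (hs01 j) _ _ b1 b2
      have h4 := mul_le_mul_of_nonneg_left (hsep _ _ h2) (hs01 j).1.le
      have h5 := htail a (j + 1)
      have h6 := htail b (j + 1)
      have h7 := dist_triangle4_right (pt a (j + 1)) (pt b (j + 1)) (f a) (f b)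
      have h8 : R * q ^ (j + 1) = r / 48 * q ^ j := by rw [pow_succ, ← hqr]; ring
      rw [h8] at h5 h6
      simp only [hs] at h4 h3
      linarith)
  rwa [hq, one_div_div] at hfin

theorem encard_le_of_forall_fin {X : Type*} {C : Set X} {m : ℕ}
    (h : ∀ (K : ℕ) (e : Fin K → X), Function.Injective e → (∀ i, e i ∈ C) → K ≤ m) :
    C.encard ≤ m := by
  by_contra! hlt
  obtain ⟨t, htC, ht⟩ := Set.exists_subset_encard_eq (k := ((m + 1 : ℕ) : ℕ∞)) (s := C)
    (by push_cast; exact Order.add_one_le_of_lt hlt)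
  have hfin : t.Finite := Set.finite_of_encard_eq_coe ht
  have hcard : t.ncard = m + 1 := by
    rw [Set.ncard, ht]; rfl
  have := hfin.to_subtype
  let f := Finite.equivFin t
  have hK : Nat.card t = m + 1 := hcard
  have := h (Nat.card t) (fun i => (f.symm i : X))
    (Subtype.val_injective.comp f.symm.injective) (fun i => htC (f.symm i).2)
  omega

theorem hausdorffMeasure_ball_lt_top {M : Type*} [MetricSpace M] [MeasurableSpace M]
    [BorelSpace M] (hG : GeodesicSpace M) {n : ℕ}
    (hdim : dimH (univ : Set M) ≤ n) {x₀ : M} {R : ℝ} (hR : 0 < R)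
    (hcpt : IsCompact (closedBall x₀ R))
    (key : ∀ p ∈ closedBall x₀ R, ∀ y ∈ ball p (3 * R), ∀ y' ∈ ball p (3 * R),
      ∀ s ∈ Ioc (0 : ℝ) 1, ∀ z z', IsBtw s p y z → IsBtw s p y' z' →
        s * dist y y' ≤ 2 * dist z z') :
    (μH[(n : ℝ)] : Measure M) (ball x₀ R) < ∞ := by
  have hpack : ∀ r : ℝ≥0, 0 < r → (r : ℝ) ≤ 24 * R →
      packingNumber r (ball x₀ R) ≤ ((⌊(48 * R / r) ^ n⌋₊ : ℕ) : ℕ∞) := by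
    intro r hr hrR
    refine iSup_le fun C => iSup_le fun hC => iSup_le fun hsep => ?_
    refine encard_le_of_forall_fin fun K e he heC => Nat.le_floor ?_
    refine card_le_of_separated hG hdim hR hcpt key (by exact_mod_cast hr) hrR e
      (fun i => hC (heC i)) fun i j hij => ?_
    have : (r : ℝ≥0∞) < edist (e i) (e j) := hsep (heC i) (heC j) (he.ne hij)
    rw [edist_dist, ← ENNReal.ofReal_coe_nnreal] at this
    exact (ENNReal.ofReal_lt_ofReal_iff'.1 this).1.le
  let r : ℕ → ℝ≥0 := fun m => Real.toNNReal (R / (m + 1))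
  have hr : ∀ m, (r m : ℝ) = R / (m + 1) := fun m => Real.coe_toNNReal _ (by positivity)
  have hr0 : ∀ m, 0 < r m := fun m => by
    have : (0 : ℝ) < r m := by rw [hr]; positivity
    exact_mod_cast this
  have hrR : ∀ m, (r m : ℝ) ≤ 24 * R := fun m => by
    rw [hr, div_le_iff₀ (by positivity)]
    have : (0 : ℝ) ≤ m := by positivity
    nlinarith
  let N : ℕ → Set M := fun m => maximalSeparatedSet (r m) (ball x₀ R)
  have htop : ∀ m, packingNumber (r m) (ball x₀ R) ≠ ⊤ := fun m =>
    ((hpack (r m) (hr0 m) (hrR m)).trans_lt (ENat.natCast_lt_top _)).ne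
  have hNenc : ∀ m, (N m).encard ≤ ((⌊(48 * R / r m) ^ n⌋₊ : ℕ) : ℕ∞) := fun m => by
    rw [encard_maximalSeparatedSet (htop m)]
    exact hpack (r m) (hr0 m) (hrR m)
  have hNfin : ∀ m, (N m).Finite := fun m =>
    Set.finite_of_encard_le_coe (hNenc m)
  have hNcard : ∀ m, ((N m).ncard : ℝ) ≤ (48 * R / r m) ^ n := fun m => by
    have h1 := hNenc m
    rw [← (hNfin m).cast_ncard_eq] at h1
    have h2 : (N m).ncard ≤ ⌊(48 * R / r m) ^ n⌋₊ := by exact_mod_cast h1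
    have h3 : (0 : ℝ) ≤ (48 * R / r m) ^ n := by positivity
    exact (Nat.cast_le.2 h2).trans (Nat.floor_le h3)
  have hfty : ∀ m, Fintype (N m) := fun m => (hNfin m).fintype
  have hrlim : Tendsto (fun m => 2 * (r m : ℝ≥0∞)) atTop (𝓝 0) := by
    have h1 : Tendsto (fun m : ℕ => R / ((m : ℝ) + 1)) atTop (𝓝 0) :=
      tendsto_const_nhds.div_atTop (tendsto_natCast_atTop_atTop.atTop_add tendsto_const_nhds)
    have h2 : Tendsto (fun m => (r m : ℝ≥0∞)) atTop (𝓝 0) := by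
      have := ENNReal.tendsto_ofReal h1
      rwa [ENNReal.ofReal_zero] at this
    have := ENNReal.Tendsto.const_mul (a := 2) h2 (.inr (by simp))
    rwa [mul_zero] at this
  have hmain := Measure.hausdorffMeasure_le_liminf_sum (n : ℝ) (ball x₀ R) (l := atTop)
    (fun m => 2 * (r m : ℝ≥0∞)) hrlim (fun m (i : N m) => Metric.closedEBall (i : M) (r m))
    (.of_forall fun m i => Metric.ediam_closedEBall_le)
    (.of_forall fun m x hx => by
      obtain ⟨y, hy, hxy⟩ := isCover_maximalSeparatedSet (htop m) hx
      exact mem_iUnion.2 ⟨⟨y, hy⟩, hxy⟩)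
  refine hmain.trans_lt (lt_of_le_of_lt ?_ (ENNReal.ofReal_lt_top (r := (96 * R) ^ n)))
  refine (liminf_le_liminf (.of_forall fun m => ?_)).trans_eq (liminf_const _)
  calc ∑ i : N m, ediam (Metric.closedEBall (i : M) (r m)) ^ (n : ℝ)
      ≤ ∑ i : N m, (2 * (r m : ℝ≥0∞)) ^ n := by
        refine Finset.sum_le_sum fun i _ => ?_
        rw [ENNReal.rpow_natCast]
        exact pow_le_pow_left' Metric.ediam_closedEBall_le n
    _ = (N m).ncard * (2 * (r m : ℝ≥0∞)) ^ n := by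
        rw [Finset.sum_const, Finset.card_univ, nsmul_eq_mul, Set.ncard_eq_toFinset_card',
          Set.toFinset_card]
    _ = ENNReal.ofReal ((N m).ncard * (2 * r m) ^ n) := by
        rw [ENNReal.ofReal_mul (by positivity), ENNReal.ofReal_natCast,
          ENNReal.ofReal_pow (by positivity), ENNReal.ofReal_mul (by norm_num),
          ENNReal.ofReal_coe_nnreal, ENNReal.ofReal_ofNat]
    _ ≤ ENNReal.ofReal ((96 * R) ^ n) := by
        refine ENNReal.ofReal_le_ofReal ?_
        have h0 : (0 : ℝ) < r m := by exact_mod_cast hr0 m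
        calc _ ≤ (48 * R / r m) ^ n * (2 * r m) ^ n :=
              mul_le_mul_of_nonneg_right (hNcard m) (by positivity)
          _ = (96 * R) ^ n := by
            rw [← mul_pow]; congr 1; field_simp; norm_num

theorem GoodBall.measure_lt_top {M : Type*} [MetricSpace M] [MeasurableSpace M]
    [BorelSpace M] (hG : GeodesicSpace M) {n : ℕ}
    (hdim : dimH (univ : Set M) ≤ n) {x₀ : M} {R : ℝ} (h : GoodBall x₀ R) :
    ∃ r > 0, (μH[(n : ℝ)] : Measure M) (ball x₀ r) < ∞ := by
  obtain ⟨hR, hc, hk⟩ := h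
  obtain ⟨δ, hδ, key⟩ := hk 1 one_pos
  have hr : 0 < min (R / 2) (δ / 3) := by positivity
  have h1 := min_le_left (R / 2) (δ / 3)
  have h2 := min_le_right (R / 2) (δ / 3)
  refine ⟨min (R / 2) (δ / 3), hr, hausdorffMeasure_ball_lt_top hG hdim hr
    (hc.of_isClosed_subset isClosed_closedBall (closedBall_subset_closedBall (by linarith)))
    fun p hp y hy y' hy' s hs z z' hz hz' => ?_⟩
  have hb : ∀ p : M, ball p (3 * min (R / 2) (δ / 3)) ⊆ ball p δ := fun p =>
    ball_subset_ball (by linarith)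
  have := key p (closedBall_subset_ball (by linarith) hp) y (hb p hy) y' (hb p hy') s hs z z' hz hz'
  linarith

theorem AlexandrovSpace.isLocallyFiniteMeasure {M : Type*} [MetricSpace M] [MeasurableSpace M]
    [BorelSpace M] {n : ℕ} {k : ℝ} (hM : AlexandrovSpace M n k) :
    IsLocallyFiniteMeasure (μH[(n : ℝ)] : Measure M) := by
  refine ⟨fun x => ?_⟩
  obtain ⟨R, hR⟩ := hM.curv.exists_goodBall x
  obtain ⟨r, hr, h⟩ := hR.measure_lt_top hM.curv.geodesic hM.dim.le
  exact ⟨ball x r, ball_mem_nhds x hr, h⟩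

theorem secondCountableTopology_of_dimH_lt_top {X : Type*} [MetricSpace X]
    (h : dimH (univ : Set X) < ⊤) : SecondCountableTopology X := by
  borelize X
  refine Metric.secondCountable_of_almost_dense_set fun ε hε => ?_
  obtain ⟨d, hd, hd'⟩ := ENNReal.lt_iff_exists_nnreal_btwn.1 h
  have h0 := hausdorffMeasure_of_dimH_lt hd
  rw [Measure.hausdorffMeasure_apply, ENNReal.iSup_eq_zero] at h0
  have h1 := h0 (ENNReal.ofReal ε)
  rw [ENNReal.iSup_eq_zero] at h1
  have h2 := h1 (ENNReal.ofReal_pos.2 hε)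
  have h3 : ∃ t : ℕ → Set X, univ ⊆ (⋃ n, t n) ∧ ∀ n, ediam (t n) ≤ ENNReal.ofReal ε := by
    by_contra! hne
    refine absurd h2 (ne_of_gt (lt_of_lt_of_le ENNReal.zero_lt_top ?_))
    refine le_iInf fun t => le_iInf fun ht => le_iInf fun ht' => ?_
    obtain ⟨n, hn⟩ := hne t ht
    exact absurd (ht' n) (not_le.2 hn)
  obtain ⟨t, ht, htd⟩ := h3
  classical
  rcases isEmpty_or_nonempty X with hX | ⟨⟨x0⟩⟩
  · exact ⟨∅, countable_empty, fun x => isEmptyElim x⟩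
  let c : ℕ → X := fun n => if hn : (t n).Nonempty then hn.some else x0
  refine ⟨range c, countable_range c, fun x => ?_⟩
  obtain ⟨n, hn⟩ := mem_iUnion.1 (ht (mem_univ x))
  refine ⟨c n, mem_range_self n, ?_⟩
  have hne : (t n).Nonempty := ⟨x, hn⟩
  have hc : c n ∈ t n := by simp only [c, hne, dif_pos]; exact hne.some_mem
  have := (Metric.edist_le_ediam_of_mem hn hc).trans (htd n)
  rw [edist_dist] at this
  exact (ENNReal.ofReal_le_ofReal_iff hε.le).1 this

/-- Homothetic contractions by the factor `s` centred in `ball x₀ R` shrink distances between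
points at distance `< δ` from the centre at most by the factor `s / C`. -/
def ContractsOn {M : Type*} [MetricSpace M] (x₀ : M) (R C δ : ℝ) : Prop :=
  ∀ p ∈ ball x₀ R, ∀ y ∈ ball p δ, ∀ y' ∈ ball p δ, ∀ s ∈ Ioc (0 : ℝ) 1, ∀ z z',
    IsBtw s p y z → IsBtw s p y' z' → s * dist y y' ≤ C * dist z z'

section Contraction

variable {M : Type*} [MetricSpace M] [MeasurableSpace M] [BorelSpace M] {x₀ : M} {R C δ : ℝ}

theorem ContractsOn.measure_le_image (h : ContractsOn x₀ R C δ) (hC : 0 ≤ C) (n : ℕ) {c : M}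
    (hc : c ∈ ball x₀ R) {s : ℝ} (hs : s ∈ Ioc (0 : ℝ) 1) {S : Set M} (hS : S ⊆ ball c δ)
    {f : M → M} (hf : ∀ y ∈ S, IsBtw s c y (f y)) :
    (μH[(n : ℝ)] : Measure M) S ≤ ENNReal.ofReal ((C / s) ^ n) * μH[(n : ℝ)] (f '' S) := by
  have hs0 := hs.1
  have key : ∀ y ∈ S, ∀ y' ∈ S, dist y y' ≤ C / s * dist (f y) (f y') := by
    intro y hy y' hy'
    have := h c hc y (hS hy) y' (hS hy') s hs _ _ (hf y hy) (hf y' hy')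
    rw [div_mul_eq_mul_div, le_div_iff₀ hs0]
    linarith
  have hinj : InjOn f S := fun y hy y' hy' he => by
    have := key y hy y' hy'
    rw [he, dist_self, mul_zero] at this
    exact dist_le_zero.1 this
  rcases S.eq_empty_or_nonempty with rfl | ⟨y₀, -⟩
  · simp
  have : Nonempty M := ⟨y₀⟩
  have hL : LipschitzOnWith (Real.toNNReal (C / s)) (Function.invFunOn f S) (f '' S) := by
    refine LipschitzOnWith.of_dist_le_mul ?_
    rintro _ ⟨y, hy, rfl⟩ _ ⟨y', hy', rfl⟩
    rw [hinj.leftInvOn_invFunOn hy, hinj.leftInvOn_invFunOn hy',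
      Real.coe_toNNReal _ (by positivity)]
    exact key y hy y' hy'
  have h1 := hL.hausdorffMeasure_image_le (d := n) (by positivity)
  rw [hinj.leftInvOn_invFunOn.image_image, ENNReal.rpow_natCast] at h1
  rwa [ENNReal.ofReal_pow (by positivity)]

theorem ContractsOn.lintegral_le (h : ContractsOn x₀ R C δ) (hC : 0 ≤ C) (n : ℕ) {c : M}
    (hc : c ∈ ball x₀ R) {s r : ℝ} (hs : s ∈ Ioc (0 : ℝ) 1) (hr : r ≤ δ) {S : Set M}
    (hS : S ⊆ ball c r)
    {f : M → M} (hfm : Measurable f) (hf : ∀ y ∈ S, IsBtw s c y (f y))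
    {G : M → ℝ≥0∞} (hG : Measurable G) :
    ∫⁻ y in S, G (f y) ∂μH[(n : ℝ)] ≤
      ENNReal.ofReal ((C / s) ^ n) * ∫⁻ z in ball c (s * r), G z ∂μH[(n : ℝ)] := by
  rw [← lintegral_map hG hfm, ← smul_eq_mul, ← lintegral_smul_measure]
  refine lintegral_mono' (Measure.le_iff.2 fun T hT => ?_) le_rfl
  rw [Measure.map_apply hfm hT, Measure.restrict_apply (hfm hT), Measure.smul_apply, smul_eq_mul,
    Measure.restrict_apply hT]
  refine (h.measure_le_image hC n hc hs (inter_subset_right.trans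
    (hS.trans (ball_subset_ball hr))) (f := f) fun y hy => hf y hy.2).trans ?_
  gcongr
  rintro _ ⟨y, ⟨hyT, hyS⟩, rfl⟩
  refine ⟨hyT, ?_⟩
  have h1 : dist c y < r := by rw [dist_comm]; exact hS hyS
  rw [mem_ball, dist_comm, (hf y hyS).1]
  exact mul_lt_mul_of_pos_left h1 hs.1

end Contraction

/-- The pairs `(x, w)` for which some geodesic from `x` to `w` can be prolonged beyond `w`
within distance `δ` of `x`, together with the diagonal. -/
def extPairs {M : Type*} [MetricSpace M] (x₀ : M) (R δ : ℝ) : Set (M × M) :=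
  {q | q.1 ∈ closedBall x₀ R ∧ (q.1 = q.2 ∨ ∃ y, dist q.1 y ≤ δ ∧
    dist q.1 q.2 + dist q.2 y = dist q.1 y ∧ 0 < dist q.2 y)}

/-- The part of `extPairs` where the prolongation has length at least `1 / (j + 1)`. -/
def extPairsCore {M : Type*} [MetricSpace M] (x₀ : M) (R δ : ℝ) (j : ℕ) : Set (M × M) :=
  {q | q.1 ∈ closedBall x₀ R ∧ (q.1 = q.2 ∨ ∃ y, dist q.1 y ≤ δ ∧
    dist q.1 q.2 + dist q.2 y = dist q.1 y ∧ 1 / ((j : ℝ) + 1) ≤ dist q.2 y)}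

theorem iUnion_extPairsCore {M : Type*} [MetricSpace M] (x₀ : M) (R δ : ℝ) :
    ⋃ j, extPairsCore x₀ R δ j = extPairs x₀ R δ := by
  ext q
  simp only [mem_iUnion, extPairsCore, extPairs, mem_ofPred_eq]
  constructor
  · rintro ⟨j, h, h' | ⟨y, h1, h2, h3⟩⟩
    · exact ⟨h, .inl h'⟩
    · exact ⟨h, .inr ⟨y, h1, h2, lt_of_lt_of_le (by positivity) h3⟩⟩
  · rintro ⟨h, h' | ⟨y, h1, h2, h3⟩⟩
    · exact ⟨0, h, .inl h'⟩
    · obtain ⟨j, hj⟩ := exists_nat_one_div_lt h3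
      exact ⟨j, h, .inr ⟨y, h1, h2, hj.le⟩⟩

theorem extPairs.dist_le {M : Type*} [MetricSpace M] {x₀ : M} {R δ : ℝ} {q : M × M}
    (hq : q ∈ extPairs x₀ R δ) (hδ : 0 < δ) : dist q.1 q.2 ≤ δ := by
  rcases hq.2 with h | ⟨y, h1, h2, h3⟩
  · rw [h, dist_self]; exact hδ.le
  · linarith

theorem isCompact_extPairsCore {M : Type*} [MetricSpace M] {x₀ : M} {R R' δ : ℝ}
    (hK : IsCompact (closedBall x₀ R)) (hδ : 0 < δ) (hR : R' + δ ≤ R) (j : ℕ) :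
    IsCompact (extPairsCore x₀ R' δ j) := by
  have hfar : ∀ {x w : M}, dist x x₀ ≤ R' → dist x w ≤ δ → w ∈ closedBall x₀ R := by
    intro x w h1 h2
    have := dist_triangle_left w x₀ x
    rw [mem_closedBall]; linarith
  have h1 : IsCompact {q : M × M | q.1 ∈ closedBall x₀ R' ∧ q.1 = q.2} := by
    refine (hK.prod hK).of_isClosed_subset ?_ ?_
    · exact (isClosed_closedBall.preimage continuous_fst).inter
        (isClosed_eq continuous_fst continuous_snd)
    · rintro ⟨x, w⟩ ⟨hx, hxw⟩
      simp only at hx hxw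
      subst hxw
      have := hfar (w := x) hx (by rw [dist_self]; exact hδ.le)
      exact ⟨this, this⟩
  have h2 : IsCompact {a : (M × M) × M | a.1.1 ∈ closedBall x₀ R' ∧ dist a.1.1 a.2 ≤ δ ∧
      dist a.1.1 a.1.2 + dist a.1.2 a.2 = dist a.1.1 a.2 ∧
      1 / ((j : ℝ) + 1) ≤ dist a.1.2 a.2} := by
    refine ((hK.prod hK).prod hK).of_isClosed_subset ?_ ?_
    · have c1 : Continuous fun a : (M × M) × M => a.1.1 := by fun_prop
      have c2 : Continuous fun a : (M × M) × M => dist a.1.1 a.2 := by fun_prop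
      have c3 : Continuous fun a : (M × M) × M => dist a.1.2 a.2 := by fun_prop
      have c4 : Continuous fun a : (M × M) × M => dist a.1.1 a.1.2 + dist a.1.2 a.2 := by fun_prop
      exact (isClosed_closedBall.preimage c1).inter ((isClosed_le c2 continuous_const).inter
        ((isClosed_eq c4 c2).inter (isClosed_le continuous_const c3)))
    · rintro ⟨⟨x, w⟩, y⟩ ⟨hx, hxy, hadd, -⟩
      simp only at hx hxy hadd
      have := dist_nonneg (x := w) (y := y)
      exact ⟨⟨hfar hx (by rw [dist_self]; exact hδ.le), hfar hx (by linarith)⟩, hfar hx hxy⟩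
  convert! h1.union (h2.image continuous_fst) using 1
  ext ⟨x, w⟩
  simp only [extPairsCore, mem_ofPred_eq, mem_union, mem_image, Prod.exists, Prod.mk.injEq]
  constructor
  · rintro ⟨hx, h | ⟨y, hy⟩⟩
    · exact .inl ⟨hx, h⟩
    · exact .inr ⟨x, w, y, ⟨hx, hy⟩, rfl, rfl⟩
  · rintro (⟨hx, h⟩ | ⟨x', w', y, ⟨hx, hy⟩, rfl, rfl⟩)
    · exact ⟨hx, .inl h⟩
    · exact ⟨hx, .inr ⟨y, hy⟩⟩

theorem measurableSet_extPairs {M : Type*} [MetricSpace M] [MeasurableSpace M] [BorelSpace M]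
    [SecondCountableTopology M] {x₀ : M} {R R' δ : ℝ}
    (hK : IsCompact (closedBall x₀ R)) (hδ : 0 < δ) (hR : R' + δ ≤ R) :
    MeasurableSet (extPairs x₀ R' δ) := by
  rw [← iUnion_extPairsCore]
  exact .iUnion fun j => (isCompact_extPairsCore hK hδ hR j).measurableSet

theorem extPairs.unique {M : Type*} [MetricSpace M] {x₀ : M} {R R' C δ δ' t : ℝ}
    (h : ContractsOn x₀ R C δ) (hδ : δ' < δ) (hR : R' + δ' < R) {q : M × M}
    (hq : q ∈ extPairs x₀ R' δ') (ht : t ∈ Icc (0 : ℝ) 1) {z z' : M}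
    (hz : IsBtw t q.1 q.2 z) (hz' : IsBtw t q.1 q.2 z') : z = z' := by
  obtain ⟨x, w⟩ := q
  obtain ⟨hx, hxw | ⟨y, h1, h2, h3⟩⟩ := hq
  · simp only at hxw
    subst hxw
    have h1 := hz.1
    have h2 := hz'.1
    simp only [dist_self, mul_zero] at h1 h2
    rw [← dist_eq_zero.1 h1, ← dist_eq_zero.1 h2]
  · refine IsBtw.unique (h y ?_) (h1.trans_lt hδ) h2 h3 ht hz hz'
    have hx : dist x x₀ ≤ R' := hx
    have := dist_triangle_left y x₀ x
    simp only at h1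
    rw [mem_ball]; linarith

theorem extPairs.of_isBtw {M : Type*} [MetricSpace M] {x₀ : M} {R δ s : ℝ} {x y w : M}
    (hq : (x, y) ∈ extPairs x₀ R δ) (hw : IsBtw s x y w) : (x, w) ∈ extPairs x₀ R δ := by
  refine ⟨hq.1, ?_⟩
  obtain ⟨-, h | ⟨a, h1, h2, h3⟩⟩ := hq
  · left
    simp only at h
    subst h
    have h1 := hw.1
    simp only [dist_self, mul_zero] at h1
    exact dist_eq_zero.1 h1
  · right
    simp only at h1 h2 h3 ⊢
    have e1 := hw.dist_add
    have e2 := dist_triangle w y a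
    have e3 := dist_triangle x w a
    have e4 := dist_nonneg (x := w) (y := y)
    exact ⟨a, h1, by linarith, by linarith⟩

theorem extPairs.of_isBtw_of_lt {M : Type*} [MetricSpace M] {x₀ : M} {R δ s : ℝ} {x y w : M}
    (hx : x ∈ closedBall x₀ R) (hxy : dist x y ≤ δ) (hs : s < 1) (hw : IsBtw s x y w) :
    (x, w) ∈ extPairs x₀ R δ := by
  refine ⟨hx, ?_⟩
  rcases eq_or_ne x y with rfl | hne
  · left
    have h1 := hw.1
    simp only [dist_self, mul_zero] at h1
    exact dist_eq_zero.1 h1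
  · exact .inr ⟨y, hxy, hw.dist_add, by
      rw [hw.2]; exact mul_pos (by linarith) (dist_pos.2 hne)⟩

/-- A point dividing the segment from `x` to a point of `[x, y]` divides `[x, y]`. -/
theorem IsBtw.trans {M : Type*} [MetricSpace M] {s τ : ℝ} {x y w z : M} (hw : IsBtw s x y w)
    (hz : IsBtw τ x w z) : IsBtw (τ * s) x y z := by
  have h1 := hw.1
  have h2 := hw.2
  have h3 := hz.1
  have h4 := hz.2
  rw [h1] at h3 h4
  have h5 := dist_triangle z w y
  have h6 := dist_triangle x z y
  refine ⟨by rw [h3]; ring, le_antisymm ?_ ?_⟩ <;> linarith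

theorem exists_measurable_geodesics {M : Type*} [MetricSpace M] [MeasurableSpace M] [BorelSpace M]
    [SecondCountableTopology M] (hG : GeodesicSpace M) {x₀ : M} {R R' C δ δ' : ℝ}
    (h : ContractsOn x₀ R C δ) (hK : IsCompact (closedBall x₀ R)) (hδ0 : 0 < δ') (hδ : δ' < δ)
    (hR : R' + δ' < R) :
    ∃ m : (M × M) × ℝ → M, Measurable m ∧
      ∀ q ∈ extPairs x₀ R' δ', ∀ t ∈ Icc (0 : ℝ) 1, IsBtw t q.1 q.2 (m (q, t)) := by
  classical
  have : Nonempty M := ⟨x₀⟩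
  choose! g hg using fun (q : M × M) (t : ℝ) (ht : t ∈ Icc (0 : ℝ) 1) => hG.exists_isBtw q.1 q.2 ht
  set D : Set ((M × M) × ℝ) := extPairs x₀ R' δ' ×ˢ Icc (0 : ℝ) 1 with hD
  have hDm : MeasurableSet D := (measurableSet_extPairs hK hδ0 hR.le).prod measurableSet_Icc
  refine ⟨fun a => if a ∈ D then g a.1 a.2 else x₀, ?_, fun q hq t ht => ?_⟩
  swap
  · have : (q, t) ∈ D := ⟨hq, ht⟩
    simp only [this, if_true]
    exact hg q t ht
  refine measurable_of_isClosed fun T hT => ?_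
  have hpre : (fun a : (M × M) × ℝ => if a ∈ D then g a.1 a.2 else x₀) ⁻¹' T =
      (⋃ j, Prod.fst '' {b : ((M × M) × ℝ) × M | b.1.1 ∈ extPairsCore x₀ R' δ' j ∧
        b.1.2 ∈ Icc (0 : ℝ) 1 ∧ b.2 ∈ T ∧ IsBtw b.1.2 b.1.1.1 b.1.1.2 b.2}) ∪
      (Dᶜ ∩ {_a | x₀ ∈ T}) := by
    ext ⟨q, t⟩
    simp only [mem_preimage, mem_union, mem_iUnion, mem_image, mem_inter_iff, mem_compl_iff,
      mem_ofPred_eq]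
    constructor
    · intro ha
      split_ifs at ha with hin
      · left
        have h1 := hin.1
        rw [← iUnion_extPairsCore] at h1
        obtain ⟨j, hj⟩ := mem_iUnion.1 h1
        exact ⟨j, ((q, t), g q t), ⟨hj, hin.2, ha, hg q t hin.2⟩, rfl⟩
      · exact .inr ⟨hin, ha⟩
    · rintro (⟨j, ⟨⟨q', t'⟩, z⟩, ⟨hj, ht, hz, hb⟩, he⟩ | ⟨hn, hx⟩)
      · simp only [Prod.mk.injEq] at he
        obtain ⟨rfl, rfl⟩ := he
        have hq : q' ∈ extPairs x₀ R' δ' := by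
          rw [← iUnion_extPairsCore]; exact mem_iUnion.2 ⟨j, hj⟩
        have : (q', t') ∈ D := ⟨hq, ht⟩
        simp only [this, if_true]
        rwa [extPairs.unique h hδ hR hq ht (hg q' t' ht) hb]
      · simp only [hn, if_false]
        exact hx
  rw [hpre]
  refine (MeasurableSet.iUnion fun j => IsCompact.measurableSet ?_).union
    (hDm.compl.inter (.const _))
  refine IsCompact.image ?_ continuous_fst
  have hcore := isCompact_extPairsCore hK hδ0 hR.le j
  refine ((hcore.prod (isCompact_Icc (a := (0 : ℝ)) (b := 1))).prod hK).of_isClosed_subset ?_ ?_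
  · have c1 : Continuous fun b : ((M × M) × ℝ) × M => b.1.1 := by fun_prop
    have c2 : Continuous fun b : ((M × M) × ℝ) × M => b.1.2 := by fun_prop
    have c3 : Continuous fun b : ((M × M) × ℝ) × M => b.2 := by fun_prop
    have c4 : Continuous fun b : ((M × M) × ℝ) × M => dist b.1.1.1 b.2 := by fun_prop
    have c5 : Continuous fun b : ((M × M) × ℝ) × M => b.1.2 * dist b.1.1.1 b.1.1.2 := by fun_prop
    have c6 : Continuous fun b : ((M × M) × ℝ) × M => dist b.2 b.1.1.2 := by fun_prop
    have c7 : Continuous fun b : ((M × M) × ℝ) × M => (1 - b.1.2) * dist b.1.1.1 b.1.1.2 := by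
      fun_prop
    exact (hcore.isClosed.preimage c1).inter ((isClosed_Icc.preimage c2).inter
      ((hT.preimage c3).inter ((isClosed_eq c4 c5).inter (isClosed_eq c6 c7))))
  · rintro ⟨⟨⟨x, w⟩, t⟩, z⟩ ⟨hj, ht, -, hb⟩
    refine ⟨⟨hj, ht⟩, ?_⟩
    have hq : (x, w) ∈ extPairs x₀ R' δ' := by
      rw [← iUnion_extPairsCore]; exact mem_iUnion.2 ⟨j, hj⟩
    have h1 : dist x w ≤ δ' := extPairs.dist_le hq hδ0
    have h2 : dist x z = t * dist x w := hb.1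
    have h3 : t * dist x w ≤ dist x w := mul_le_of_le_one_left dist_nonneg ht.2
    have h4 : dist x x₀ ≤ R' := hq.1
    have := dist_triangle_left z x₀ x
    rw [mem_closedBall]; linarith

theorem ae_mem_extPairs {M : Type*} [MetricSpace M] [MeasurableSpace M] [BorelSpace M]
    [SecondCountableTopology M] (hG : GeodesicSpace M) (n : ℕ)
    [IsLocallyFiniteMeasure (μH[(n : ℝ)] : Measure M)] {x₀ : M} {R R' C δ δ' : ℝ} (hC : 0 ≤ C)
    (h : ContractsOn x₀ R C δ) (hK : IsCompact (closedBall x₀ R)) (hδ0 : 0 < δ') (hδ : δ' ≤ δ)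
    (hR : R' + δ' < R) {x : M} (hx : x ∈ closedBall x₀ R') :
    ∀ᵐ y ∂(μH[(n : ℝ)] : Measure M).restrict (ball x δ'), (x, y) ∈ extPairs x₀ R' δ' := by
  set μ : Measure M := μH[(n : ℝ)] with hμ
  have hE := measurableSet_extPairs (R' := R') hK hδ0 hR.le
  have hEx : MeasurableSet {y | (x, y) ∈ extPairs x₀ R' δ'} := hE.preimage measurable_prodMk_left
  have hx' : dist x x₀ ≤ R' := hx
  have hxR : x ∈ ball x₀ R := by rw [mem_ball]; linarith
  have hballK : ball x δ' ⊆ closedBall x₀ R := by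
    intro y hy
    have hy : dist y x < δ' := hy
    have := dist_triangle y x x₀
    rw [mem_closedBall]; linarith
  rw [ae_iff, Measure.restrict_apply' measurableSet_ball]
  have hSm : MeasurableSet ({y | (x, y) ∉ extPairs x₀ R' δ'} ∩ ball x δ') :=
    hEx.compl.inter measurableSet_ball
  have hfin : μ ({y | (x, y) ∉ extPairs x₀ R' δ'} ∩ ball x δ') ≠ ∞ :=
    ((measure_mono (inter_subset_right.trans hballK)).trans_lt hK.measure_lt_top).ne
  by_contra hpos
  obtain ⟨S, hSsub, hSc, hSpos⟩ := hSm.exists_lt_isClosed_of_ne_top hfin (pos_iff_ne_zero.2 hpos)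
  have hScpt : IsCompact S := hK.of_isClosed_subset hSc
    (hSsub.trans (inter_subset_right.trans hballK))
  have hth : Tendsto (fun r => μ (cthickening r S)) (𝓝 0) (𝓝 (μ S)) := by
    refine tendsto_measure_cthickening_of_isClosed ⟨R - (R' + δ'), by linarith, ?_⟩ hSc
    refine ((measure_mono (t := closedBall x₀ R) ?_).trans_lt hK.measure_lt_top).ne
    rw [hScpt.cthickening_eq_biUnion_closedBall (by linarith)]
    refine iUnion₂_subset fun y hy z hz => ?_
    have h1 : dist y x < δ' := (hSsub hy).2
    have h2 : dist z y ≤ R - (R' + δ') := hz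
    have := dist_triangle4 z y x x₀
    rw [mem_closedBall]; linarith
  have hSfin : μ S ≠ ∞ := hScpt.measure_lt_top.ne
  have hbound : ∀ s ∈ Ioo (0 : ℝ) 1, μ S ≤ ENNReal.ofReal ((C / s) ^ n) *
      (μ (cthickening ((1 - s) * δ') S) - μ S) := by
    intro s hs
    choose f hf using fun y => hG.exists_isBtw x y (Ioo_subset_Icc_self hs)
    refine (h.measure_le_image hC n hxR (Ioo_subset_Ioc_self hs)
      (hSsub.trans (inter_subset_right.trans (ball_subset_ball hδ))) fun y _ => hf y).trans ?_
    gcongr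
    refine (measure_mono (t := cthickening ((1 - s) * δ') S \ S) ?_).trans_eq
      (measure_sdiff (self_subset_cthickening _) hSc.measurableSet.nullMeasurableSet hSfin)
    rintro _ ⟨y, hy, rfl⟩
    have hyx : dist x y < δ' := by rw [dist_comm]; exact (hSsub hy).2
    refine ⟨?_, fun hmem => ?_⟩
    · refine mem_cthickening_of_dist_le _ y _ _ hy ?_
      rw [(hf y).2]
      exact mul_le_mul_of_nonneg_left hyx.le (by linarith [hs.2])
    · exact (hSsub hmem).1 (extPairs.of_isBtw_of_lt hx hyx.le hs.2 (hf y))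
  have hlim : Tendsto (fun s : ℝ => ENNReal.ofReal ((C / s) ^ n) *
      (μ (cthickening ((1 - s) * δ') S) - μ S)) (𝓝[<] 1) (𝓝 0) := by
    have h1 : Tendsto (fun s : ℝ => (1 - s) * δ') (𝓝[<] 1) (𝓝 0) := by
      have : Continuous fun s : ℝ => (1 - s) * δ' := by fun_prop
      have := (this.tendsto 1).mono_left (nhdsWithin_le_nhds (s := Iio 1))
      simpa using this
    have h2 : Tendsto (fun s : ℝ => μ (cthickening ((1 - s) * δ') S) - μ S) (𝓝[<] 1) (𝓝 0) := by
      have := ENNReal.Tendsto.sub (hth.comp h1) (tendsto_const_nhds (x := μ S)) (.inl hSfin)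
      rwa [tsub_self] at this
    have h3 : Tendsto (fun s : ℝ => ENNReal.ofReal ((C / s) ^ n)) (𝓝[<] 1)
        (𝓝 (ENNReal.ofReal ((C / 1) ^ n))) := by
      refine ENNReal.tendsto_ofReal (Tendsto.mono_left ?_ nhdsWithin_le_nhds)
      exact ((tendsto_const_nhds.div tendsto_id one_ne_zero).pow n)
    have := ENNReal.Tendsto.mul h3 (.inr (by simp)) h2 (.inr (by simp))
    rwa [mul_zero] at this
  have hle : μ S ≤ 0 := ge_of_tendsto hlim
    (Filter.eventually_of_mem (Ioo_mem_nhdsLT one_pos) fun s hs => hbound s hs)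
  exact absurd hSpos (not_lt.2 hle)

section Transport

variable {M : Type*} [MetricSpace M] [MeasurableSpace M] [BorelSpace M]

theorem lintegral_ball_eq_indicator (μ : Measure M) (r : ℝ) (F : M × M → ℝ≥0∞) (x : M) :
    ∫⁻ y in ball x r, F (x, y) ∂μ =
      ∫⁻ y, {q : M × M | dist q.2 q.1 < r}.indicator F (x, y) ∂μ := by
  rw [← lintegral_indicator measurableSet_ball]
  rfl

variable [SecondCountableTopology M]

theorem measurableSet_dist_lt (r : ℝ) : MeasurableSet {q : M × M | dist q.2 q.1 < r} :=
  measurableSet_lt (measurable_snd.dist measurable_fst) measurable_const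

theorem lintegral_ball_swap (μ : Measure M) [SFinite μ] (r : ℝ) {F : M × M → ℝ≥0∞}
    (hF : Measurable F) :
    ∫⁻ y, ∫⁻ x in ball y r, F (x, y) ∂μ ∂μ = ∫⁻ x, ∫⁻ y in ball x r, F (x, y) ∂μ ∂μ := by
  have h1 : ∀ y, ∫⁻ x in ball y r, F (x, y) ∂μ =
      ∫⁻ x, {q : M × M | dist q.2 q.1 < r}.indicator F (x, y) ∂μ := by
    intro y
    rw [← lintegral_indicator measurableSet_ball]
    refine lintegral_congr fun x => ?_
    simp only [indicator, mem_ball, mem_ofPred_eq, dist_comm]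
  simp_rw [h1, lintegral_ball_eq_indicator]
  exact lintegral_lintegral_swap
    ((hF.indicator (measurableSet_dist_lt r)).comp measurable_swap).aemeasurable

theorem measurable_lintegral_ball (μ : Measure M) [SFinite μ] (r : ℝ) {F : M × M → ℝ≥0∞}
    (hF : Measurable F) : Measurable fun x => ∫⁻ y in ball x r, F (x, y) ∂μ := by
  simp_rw [lintegral_ball_eq_indicator]
  exact (hF.indicator (measurableSet_dist_lt r)).lintegral_prod_right'

theorem lintegral_geodesic_le (hG : GeodesicSpace M) (n : ℕ)
    [IsLocallyFiniteMeasure (μH[(n : ℝ)] : Measure M)] {x₀ : M} {R R' C δ δ' : ℝ} (hC : 0 ≤ C)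
    (h : ContractsOn x₀ R C δ) (hK : IsCompact (closedBall x₀ R)) (hδ0 : 0 < δ') (hδ : δ' < δ)
    (hR : R' + δ' < R) {m : (M × M) × ℝ → M} (hm : Measurable m)
    (hb : ∀ q ∈ extPairs x₀ R' δ', ∀ t ∈ Icc (0 : ℝ) 1, IsBtw t q.1 q.2 (m (q, t)))
    {t l ε : ℝ} (ht : 0 ≤ t) (hl : 0 < l) (htl : t + l ≤ 1) (hε : ε ≤ δ')
    {H : M × M → ℝ≥0∞} (hH : Measurable H) :
    ∫⁻ x in ball x₀ R', ∫⁻ y in ball x ε, H (m ((x, y), t), m ((x, y), t + l))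
        ∂μH[(n : ℝ)] ∂μH[(n : ℝ)] ≤
      ENNReal.ofReal ((C ^ 2 / l) ^ n) *
        ∫⁻ z, ∫⁻ w in ball z (l * ε), H (z, w) ∂μH[(n : ℝ)] ∂μH[(n : ℝ)] := by
  set μ : Measure M := μH[(n : ℝ)] with hμ
  set s := t + l with hs
  have hs0 : 0 < s := by positivity
  set τ := t / s with hτ
  have hτs : τ * s = t := by rw [hτ]; field_simp
  have hτ1 : (1 - τ) * s = l := by linarith [hτs]
  have hτ1' : 0 < 1 - τ := by
    by_contra hcon
    have := mul_nonpos_of_nonpos_of_nonneg (not_lt.1 hcon) hs0.le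
    linarith
  have hτ0 : 0 ≤ τ := by positivity
  have hτI : τ ∈ Icc (0 : ℝ) 1 := ⟨hτ0, by linarith⟩
  have hsI : s ∈ Ioc (0 : ℝ) 1 := ⟨hs0, htl⟩
  set E := extPairs x₀ R' δ' with hE
  have hEm : MeasurableSet E := measurableSet_extPairs hK hδ0 hR.le
  set J : M × M → ℝ≥0∞ := fun q => H (m (q, τ), q.2) with hJ
  have hJm : Measurable J := by
    refine hH.comp ((hm.comp ?_).prodMk measurable_snd)
    exact measurable_id.prodMk measurable_const
  set T : Set (M × M) := {q | q.1 ∈ ball x₀ R'} ∩ E ∩ {q | dist q.2 q.1 < s * ε} with hT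
  have hTm : MeasurableSet T :=
    ((measurableSet_ball.preimage measurable_fst).inter hEm).inter (measurableSet_dist_lt _)
  have hmx : ∀ (r : ℝ) (x : M), Measurable fun y => m ((x, y), r) := fun r x =>
    hm.comp ((measurable_const.prodMk measurable_id).prodMk measurable_const)
  have hmy : ∀ (r : ℝ) (y : M), Measurable fun x => m ((x, y), r) := fun r x =>
    hm.comp ((measurable_id.prodMk measurable_const).prodMk measurable_const)
  have step1 : ∀ x ∈ ball x₀ R', ∫⁻ y in ball x ε, H (m ((x, y), t), m ((x, y), s)) ∂μ ≤
      ENNReal.ofReal ((C / s) ^ n) * ∫⁻ w, T.indicator J (x, w) ∂μ := by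
    intro x hx
    have hx' : dist x x₀ < R' := hx
    have hxR : x ∈ ball x₀ R := by rw [mem_ball]; linarith
    set S : Set M := {y | y ∈ ball x ε ∧ (x, y) ∈ E} with hS
    have hSball : (ball x ε : Set M) =ᵐ[μ] S := by
      have := ae_mem_extPairs hG n hC h hK hδ0 hδ.le hR (ball_subset_closedBall hx)
      have := (ae_restrict_iff' measurableSet_ball).1 this
      filter_upwards [this] with y hy
      exact propext ⟨fun h1 => ⟨h1, hy (ball_subset_ball hε h1)⟩, fun h1 => h1.1⟩
    have hSm : MeasurableSet S := measurableSet_ball.inter (hEm.preimage measurable_prodMk_left)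
    have hfS : ∀ y ∈ S, IsBtw s x y (m ((x, y), s)) := fun y hy =>
      hb (x, y) hy.2 s (Ioc_subset_Icc_self hsI)
    have hGm : Measurable fun w => E.indicator J (x, w) :=
      (hJm.indicator hEm).comp measurable_prodMk_left
    rw [Measure.restrict_congr_set hSball]
    calc ∫⁻ y in S, H (m ((x, y), t), m ((x, y), s)) ∂μ
        = ∫⁻ y in S, E.indicator J (x, m ((x, y), s)) ∂μ := by
          refine setLIntegral_congr_fun hSm fun y hy => ?_
          have hin : (x, m ((x, y), s)) ∈ E := extPairs.of_isBtw hy.2 (hfS y hy)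
          have h1 := hb _ hin τ hτI
          have h2 := (hfS y hy).trans h1
          rw [hτs] at h2
          have h3 := extPairs.unique h hδ hR hy.2 (t := t) ⟨ht, by linarith⟩ h2
            (hb (x, y) hy.2 t ⟨ht, by linarith⟩)
          simp only [indicator_of_mem hin, hJ, h3]
      _ ≤ ENNReal.ofReal ((C / s) ^ n) * ∫⁻ w in ball x (s * ε), E.indicator J (x, w) ∂μ :=
          h.lintegral_le hC n hxR hsI (hε.trans hδ.le) (fun y hy => hy.1) (hmx s x) hfS hGm
      _ = _ := by
          congr 1
          rw [← lintegral_indicator measurableSet_ball]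
          refine lintegral_congr fun w => ?_
          have hiff : (x, w) ∈ T ↔ dist w x < s * ε ∧ (x, w) ∈ E :=
            ⟨fun h1 => ⟨h1.2, h1.1.2⟩, fun h1 => ⟨⟨hx, h1.2⟩, h1.1⟩⟩
          by_cases h1 : dist w x < s * ε <;> by_cases h2 : (x, w) ∈ E <;>
            simp [indicator, h1, h2, hiff]
  have step2 : ∀ w, ∫⁻ x, T.indicator J (x, w) ∂μ ≤ ENNReal.ofReal ((C / (1 - τ)) ^ n) *
      ∫⁻ z in ball w (l * ε), H (z, w) ∂μ := by
    intro w
    set S : Set M := {x | (x, w) ∈ T} with hS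
    have hSm : MeasurableSet S := hTm.preimage measurable_prodMk_right
    have e1 : ∫⁻ x, T.indicator J (x, w) ∂μ = ∫⁻ x in S, H (m ((x, w), τ), w) ∂μ := by
      rw [← lintegral_indicator hSm]; rfl
    rw [e1]
    rcases S.eq_empty_or_nonempty with he | ⟨x, hx⟩
    · simp [he]
    have hwR : w ∈ ball x₀ R := by
      have h1 : dist x x₀ < R' := hx.1.1
      have h2 : dist x w ≤ δ' := extPairs.dist_le hx.1.2 hδ0
      have := dist_triangle_left w x₀ x
      rw [mem_ball]; linarith
    have hε0 : s * ε ≤ δ := by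
      have : dist w x < s * ε := hx.2
      have h0 : 0 < ε := by
        by_contra hcon
        have := mul_nonpos_of_nonneg_of_nonpos hs0.le (not_lt.1 hcon)
        have := dist_nonneg (x := w) (y := x)
        linarith
      nlinarith [hsI.2]
    have := h.lintegral_le hC n hwR (s := 1 - τ) (r := s * ε) ⟨hτ1', by linarith⟩ hε0 (S := S)
      (fun x hx => by rw [mem_ball, dist_comm]; exact hx.2) (hmy τ w)
      (fun x hx => (hb (x, w) hx.1.2 τ hτI).symm) (G := fun z => H (z, w))
      (hH.comp measurable_prodMk_right)
    rwa [← mul_assoc, hτ1] at this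
  calc ∫⁻ x in ball x₀ R', ∫⁻ y in ball x ε, H (m ((x, y), t), m ((x, y), s)) ∂μ ∂μ
      ≤ ∫⁻ x in ball x₀ R', ENNReal.ofReal ((C / s) ^ n) * ∫⁻ w, T.indicator J (x, w) ∂μ ∂μ :=
        setLIntegral_mono' measurableSet_ball step1
    _ ≤ ∫⁻ x, ENNReal.ofReal ((C / s) ^ n) * ∫⁻ w, T.indicator J (x, w) ∂μ ∂μ :=
        setLIntegral_le_lintegral _ _
    _ = ENNReal.ofReal ((C / s) ^ n) * ∫⁻ w, ∫⁻ x, T.indicator J (x, w) ∂μ ∂μ := by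
        rw [lintegral_const_mul' _ _ ENNReal.ofReal_ne_top, lintegral_lintegral_swap]
        exact (hJm.indicator hTm).aemeasurable
    _ ≤ ENNReal.ofReal ((C / s) ^ n) * ∫⁻ w, ENNReal.ofReal ((C / (1 - τ)) ^ n) *
          ∫⁻ z in ball w (l * ε), H (z, w) ∂μ ∂μ := by
        gcongr with w; exact step2 w
    _ = _ := by
        rw [lintegral_const_mul' _ _ ENNReal.ofReal_ne_top, lintegral_ball_swap μ _ hH,
          ← mul_assoc, ← ENNReal.ofReal_mul (by positivity), ← mul_pow]
        congr 3
        rw [div_mul_div_comm, mul_comm s, hτ1, sq]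

theorem GoodBall.exists_transport (hG : GeodesicSpace M) (n : ℕ)
    [IsLocallyFiniteMeasure (μH[(n : ℝ)] : Measure M)] {x₀ : M} {R : ℝ} (h : GoodBall x₀ R)
    {C : ℝ} (hC : 1 < C) :
    ∃ δ, 0 < δ ∧ δ ≤ R / 8 ∧ ∃ m : (M × M) × ℝ → M, Measurable m ∧
      (∀ x ∈ ball x₀ (R / 2), ∀ᵐ y ∂(μH[(n : ℝ)] : Measure M).restrict (ball x δ),
        ∀ t ∈ Icc (0 : ℝ) 1, IsBtw t x y (m ((x, y), t))) ∧
      ∀ t l ε : ℝ, 0 ≤ t → 0 < l → t + l ≤ 1 → ε ≤ δ → ∀ H : M × M → ℝ≥0∞, Measurable H →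
        ∫⁻ x in ball x₀ (R / 2), ∫⁻ y in ball x ε, H (m ((x, y), t), m ((x, y), t + l))
            ∂μH[(n : ℝ)] ∂μH[(n : ℝ)] ≤
          ENNReal.ofReal (C / l ^ n) *
            ∫⁻ z, ∫⁻ w in ball z (l * ε), H (z, w) ∂μH[(n : ℝ)] ∂μH[(n : ℝ)] := by
  obtain ⟨hR, hK, hgood⟩ := h
  have hcont : Tendsto (fun η : ℝ => ((1 + η) ^ 2) ^ n) (𝓝[>] 0) (𝓝 1) := by
    have : Continuous fun η : ℝ => ((1 + η) ^ 2) ^ n := by fun_prop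
    simpa using (this.tendsto 0).mono_left (nhdsWithin_le_nhds (s := Ioi 0))
  obtain ⟨η, hη1, hη⟩ := ((hcont.eventually_lt_const hC).and self_mem_nhdsWithin).exists
  have hη : 0 < η := hη
  obtain ⟨δ₀, hδ₀, hcon⟩ := hgood η hη
  have hcon : ContractsOn x₀ R (1 + η) δ₀ := hcon
  have hδ0 : 0 < min (δ₀ / 2) (R / 8) := by positivity
  have hδ1 : min (δ₀ / 2) (R / 8) < δ₀ := (min_le_left _ _).trans_lt (by linarith)
  have hδ2 : min (δ₀ / 2) (R / 8) ≤ R / 8 := min_le_right _ _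
  have hRR : R / 2 + min (δ₀ / 2) (R / 8) < R := by linarith
  obtain ⟨m, hm, hb⟩ := exists_measurable_geodesics hG hcon hK hδ0 hδ1 hRR
  refine ⟨_, hδ0, hδ2, m, hm, fun x hx => ?_, fun t l ε ht hl htl hε H hH => ?_⟩
  · filter_upwards [ae_mem_extPairs hG n (by positivity) hcon hK hδ0 hδ1.le hRR
      (ball_subset_closedBall hx)] with y hy
    exact hb _ hy
  · refine (lintegral_geodesic_le hG n (by positivity) hcon hK hδ0 hδ1 hRR hm hb ht hl htl hε
      hH).trans ?_
    gcongr
    rw [div_pow]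
    gcongr

end Transport

section Scalar

variable {p : ℝ}

theorem exists_const_one_sub_rpow_le (hp : 1 < p) {τ : ℝ} (hτ : 0 < τ) :
    ∃ K : ℝ, 0 ≤ K ∧ ∀ s : ℝ, 0 ≤ s →
      max (1 - s ^ p) 0 ≤ τ + K * (s ^ p - 1 - p * (s - 1)) := by
  have hp0 : 0 < p := by linarith
  have hg0 : ∀ s : ℝ, 0 ≤ s → 0 ≤ s ^ p - 1 - p * (s - 1) := fun s hs => by
    have := one_add_mul_self_le_rpow_one_add (s := s - 1) (by linarith) hp.le
    rw [add_sub_cancel] at this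
    linarith
  have hcont : Continuous fun s : ℝ => s ^ p := Real.continuous_rpow_const hp0.le
  set S : Set ℝ := {s | s ∈ Icc (0 : ℝ) 1 ∧ s ^ p ≤ 1 - τ} with hS
  have hSc : IsCompact S := isCompact_Icc.inter_right (isClosed_le hcont continuous_const)
  obtain ⟨c, hc, hcS⟩ : ∃ c > 0, ∀ s ∈ S, c ≤ s ^ p - 1 - p * (s - 1) := by
    rcases S.eq_empty_or_nonempty with he | hne
    · exact ⟨1, one_pos, by simp [he]⟩
    obtain ⟨s₀, hs₀, hmin⟩ := hSc.exists_isMinOn hne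
      (f := fun s : ℝ => s ^ p - 1 - p * (s - 1)) (by fun_prop)
    refine ⟨_, ?_, fun s hs => hmin hs⟩
    have hs1 : s₀ ≠ 1 := by
      rintro rfl
      have := hs₀.2
      rw [Real.one_rpow] at this
      linarith
    have := one_add_mul_self_lt_rpow_one_add (s := s₀ - 1) (by linarith [hs₀.1.1])
      (sub_ne_zero.2 hs1) hp
    rw [add_sub_cancel] at this
    simp only
    linarith
  refine ⟨1 / c, by positivity, fun s hs => ?_⟩
  have h1 : 0 ≤ 1 / c * (s ^ p - 1 - p * (s - 1)) := mul_nonneg (by positivity) (hg0 s hs)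
  refine max_le ?_ (by linarith)
  have hsp : 0 ≤ s ^ p := Real.rpow_nonneg hs p
  by_cases hcase : s ^ p ≤ 1 - τ
  · have hs1 : s ≤ 1 := by
      by_contra hcon
      have := Real.one_le_rpow (not_le.1 hcon).le hp0.le
      linarith
    have := hcS s ⟨⟨hs, hs1⟩, hcase⟩
    have h2 : 1 ≤ 1 / c * (s ^ p - 1 - p * (s - 1)) := by
      rw [one_div, ← div_eq_inv_mul, le_div_iff₀ hc]; linarith
    linarith
  · linarith

theorem exists_const_rpow_sub_rpow_le (hp : 1 < p) {τ : ℝ≥0∞} (hτ : τ ≠ 0) :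
    ∃ K : ℝ≥0∞, K ≠ ∞ ∧ ∀ a A : ℝ≥0∞, A ≠ ∞ →
      (A ^ p - a ^ p) + K * (A ^ p + ENNReal.ofReal p * A ^ (p - 1) * a) ≤
        τ * (A ^ p + a ^ p) + K * (a ^ p + ENNReal.ofReal p * A ^ p) := by
  have hp0 : 0 < p := by linarith
  have hp1 : 0 < p - 1 := by linarith
  rcases eq_or_ne τ ∞ with rfl | hτt
  · refine ⟨0, by simp, fun a A _ => ?_⟩
    simp only [zero_mul, add_zero]
    refine tsub_le_self.trans (le_self_add.trans (le_mul_of_one_le_left' le_top))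
  obtain ⟨K, hK0, hK⟩ := exists_const_one_sub_rpow_le hp (ENNReal.toReal_pos hτ hτt)
  set τ' := τ.toReal with hτ'
  have hτ'0 : 0 < τ' := ENNReal.toReal_pos hτ hτt
  refine ⟨ENNReal.ofReal K, ENNReal.ofReal_ne_top, fun a A hA => ?_⟩
  rcases eq_or_ne a ∞ with rfl | ha
  · simp [ENNReal.top_rpow_of_pos hp0, ENNReal.mul_top hτ]
  rcases eq_or_ne A 0 with rfl | hA0
  · simp [ENNReal.zero_rpow_of_pos hp0, ENNReal.zero_rpow_of_pos hp1]
  have hb : 0 < A.toReal := ENNReal.toReal_pos hA0 hA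
  have hreal : max (A.toReal ^ p - a.toReal ^ p) 0 + K * (A.toReal ^ p +
      p * A.toReal ^ (p - 1) * a.toReal) ≤ τ' * (A.toReal ^ p + a.toReal ^ p) +
        K * (a.toReal ^ p + p * A.toReal ^ p) := by
    have h1 := hK (a.toReal / A.toReal) (by positivity)
    rw [Real.div_rpow (by positivity) (by positivity)] at h1
    have hAp : 0 < A.toReal ^ p := Real.rpow_pos_of_pos hb p
    have h2 := mul_le_mul_of_nonneg_left h1 hAp.le
    have e1 : A.toReal ^ p * max (1 - a.toReal ^ p / A.toReal ^ p) 0 =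
        max (A.toReal ^ p - a.toReal ^ p) 0 := by
      rw [mul_max_of_nonneg _ _ hAp.le, mul_zero, mul_sub, mul_one, mul_div_cancel₀ _ hAp.ne']
    have e2 : A.toReal ^ (p - 1) = A.toReal ^ p / A.toReal := Real.rpow_sub_one hb.ne' p
    rw [e1] at h2
    rw [e2]
    have e3 : A.toReal ^ p * (τ' + K * (a.toReal ^ p / A.toReal ^ p - 1 -
        p * (a.toReal / A.toReal - 1))) = τ' * A.toReal ^ p + K * (a.toReal ^ p - A.toReal ^ p -
          p * (A.toReal ^ p / A.toReal * a.toReal - A.toReal ^ p)) := by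
      field_simp
    rw [e3] at h2
    have h3 : 0 ≤ τ' * a.toReal ^ p := by positivity
    linarith
  have ea : a ^ p = ENNReal.ofReal (a.toReal ^ p) := by
    rw [← ENNReal.ofReal_rpow_of_nonneg ENNReal.toReal_nonneg hp0.le, ENNReal.ofReal_toReal ha]
  have eA : A ^ p = ENNReal.ofReal (A.toReal ^ p) := by
    rw [← ENNReal.ofReal_rpow_of_nonneg ENNReal.toReal_nonneg hp0.le, ENNReal.ofReal_toReal hA]
  have eA1 : A ^ (p - 1) = ENNReal.ofReal (A.toReal ^ (p - 1)) := by
    rw [← ENNReal.ofReal_rpow_of_nonneg ENNReal.toReal_nonneg hp1.le, ENNReal.ofReal_toReal hA]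
  have hsub : A ^ p - a ^ p = ENNReal.ofReal (max (A.toReal ^ p - a.toReal ^ p) 0) := by
    rw [ea, eA, ← ENNReal.ofReal_sub _ (by positivity)]
    rcases le_total (A.toReal ^ p - a.toReal ^ p) 0 with h | h
    · rw [max_eq_right h, ENNReal.ofReal_of_nonpos h, ENNReal.ofReal_zero]
    · rw [max_eq_left h]
  have ea1 : a = ENNReal.ofReal a.toReal := (ENNReal.ofReal_toReal ha).symm
  have eτ : τ = ENNReal.ofReal τ' := (ENNReal.ofReal_toReal hτt).symm
  have key := ENNReal.ofReal_le_ofReal hreal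
  rw [ENNReal.ofReal_add (by positivity) (by positivity),
    ENNReal.ofReal_add (by positivity) (by positivity), ENNReal.ofReal_mul hK0,
    ENNReal.ofReal_mul hK0, ENNReal.ofReal_mul hτ'0.le, ENNReal.ofReal_add (by positivity)
      (by positivity), ENNReal.ofReal_add (by positivity) (by positivity),
    ENNReal.ofReal_add (by positivity) (by positivity), ENNReal.ofReal_mul (by positivity),
    ENNReal.ofReal_mul (by positivity), ENNReal.ofReal_mul (by positivity), ← ea, ← eA, ← eA1,
    ← ea1, ← eτ, ← hsub] at key
  exact key

end Scalar

/-- The projection of the line to the unit interval. -/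
def clip (t : ℝ) : ℝ := max 0 (min 1 t)

theorem clip_mem (t : ℝ) : clip t ∈ Icc (0 : ℝ) 1 :=
  ⟨le_max_left _ _, max_le zero_le_one (min_le_left _ _)⟩

theorem clip_of_nonpos {t : ℝ} (ht : t ≤ 0) : clip t = 0 :=
  max_eq_left ((min_le_right _ _).trans ht)

theorem clip_of_one_le {t : ℝ} (ht : 1 ≤ t) : clip t = 1 := by
  rw [clip, min_eq_left ht, max_eq_right zero_le_one]

theorem clip_of_mem {t : ℝ} (ht : t ∈ Icc (0 : ℝ) 1) : clip t = t := by
  rw [clip, min_eq_right ht.2, max_eq_right ht.1]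

theorem clip_mono : Monotone clip := fun _ _ h => max_le_max le_rfl (min_le_min le_rfl h)

theorem continuous_clip : Continuous clip := by unfold clip; fun_prop

/-- The length of the part of `[t, t + l]` lying in the unit interval. -/
def pieceLength (l t : ℝ) : ℝ≥0∞ := ENNReal.ofReal (clip (t + l) - clip t)

theorem measurable_pieceLength (l : ℝ) : Measurable (pieceLength l) := by
  have := continuous_clip
  exact (by fun_prop : Continuous fun t => clip (t + l) - clip t).measurable.ennreal_ofReal

theorem pieceLength_of_mem {l t : ℝ} (hl : 0 ≤ l) (ht : t ∈ Icc (0 : ℝ) (1 - l)) :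
    pieceLength l t = ENNReal.ofReal l := by
  rw [pieceLength, clip_of_mem ⟨by linarith [ht.1], by linarith [ht.2]⟩,
    clip_of_mem ⟨ht.1, by linarith [ht.2]⟩, add_sub_cancel_left]

theorem pieceLength_le {l : ℝ} (hl : 0 ≤ l) (t : ℝ) :
    pieceLength l t ≤ volume (Ioc t (t + l) ∩ Ioc 0 1) := by
  rw [Ioc_inter_Ioc, Real.volume_Ioc]
  rcases le_total (t + l) 0 with h | h
  · rw [pieceLength, clip_of_nonpos h, clip_of_nonpos (by linarith)]; simp
  rcases le_total 1 t with h' | h'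
  · rw [pieceLength, clip_of_one_le h', clip_of_one_le (by linarith)]; simp
  · refine ENNReal.ofReal_le_ofReal (le_of_eq ?_)
    rw [clip, clip, max_eq_right (le_min zero_le_one h), min_eq_right h', min_comm, max_comm]

/-- The distribution of the starting point of a random piece of the unit interval. -/
def pieceMeasure (l : ℝ) : Measure ℝ :=
  volume.withDensity fun t => pieceLength l t / ENNReal.ofReal l

instance (l : ℝ) : SFinite (pieceMeasure l) := by unfold pieceMeasure; infer_instance

theorem lintegral_pieceMeasure (l : ℝ) {F : ℝ → ℝ≥0∞} (hF : Measurable F) :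
    ∫⁻ t, F t ∂pieceMeasure l = ∫⁻ t, pieceLength l t / ENNReal.ofReal l * F t :=
  lintegral_withDensity_eq_lintegral_mul _ ((measurable_pieceLength l).div_const _) hF

theorem pieceMeasure_univ_le {l : ℝ} (hl : 0 < l) : pieceMeasure l univ ≤ 1 := by
  have hl0 : ENNReal.ofReal l ≠ 0 := (ENNReal.ofReal_pos.2 hl).ne'
  rw [pieceMeasure, withDensity_apply _ .univ, setLIntegral_univ]
  simp_rw [div_eq_mul_inv]
  rw [lintegral_mul_const _ (measurable_pieceLength l), ← div_eq_mul_inv,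
    ENNReal.div_le_iff hl0 ENNReal.ofReal_ne_top, one_mul]
  have hm : MeasurableSet {q : ℝ × ℝ | q.2 ∈ Ioc q.1 (q.1 + l) ∧ q.2 ∈ Ioc (0 : ℝ) 1} := by
    refine ((measurableSet_lt measurable_fst measurable_snd).inter
      (measurableSet_le measurable_snd (measurable_fst.add_const l))).inter
        (measurableSet_Ioc.preimage measurable_snd)
  calc ∫⁻ t, pieceLength l t
      ≤ ∫⁻ t, ∫⁻ s, {q : ℝ × ℝ | q.2 ∈ Ioc q.1 (q.1 + l) ∧ q.2 ∈ Ioc (0 : ℝ) 1}.indicator 1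
          (t, s) := by
        refine lintegral_mono fun t => (pieceLength_le hl.le t).trans_eq ?_
        rw [← lintegral_indicator_one (measurableSet_Ioc.inter measurableSet_Ioc)]
        rfl
    _ = ∫⁻ s, ∫⁻ t, {q : ℝ × ℝ | q.2 ∈ Ioc q.1 (q.1 + l) ∧ q.2 ∈ Ioc (0 : ℝ) 1}.indicator 1
          (t, s) := lintegral_lintegral_swap ((measurable_one.indicator hm).aemeasurable)
    _ ≤ ∫⁻ s in Ioc (0 : ℝ) 1, ENNReal.ofReal l := by
        rw [← lintegral_indicator measurableSet_Ioc]
        refine lintegral_mono fun s => ?_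
        by_cases hs : s ∈ Ioc (0 : ℝ) 1
        · have : (fun t => {q : ℝ × ℝ | q.2 ∈ Ioc q.1 (q.1 + l) ∧
              q.2 ∈ Ioc (0 : ℝ) 1}.indicator (1 : ℝ × ℝ → ℝ≥0∞) (t, s)) =
              (Ico (s - l) s).indicator 1 := by
            funext t
            have : (t, s) ∈ {q : ℝ × ℝ | q.2 ∈ Ioc q.1 (q.1 + l) ∧ q.2 ∈ Ioc (0 : ℝ) 1} ↔
                t ∈ Ico (s - l) s := by
              rw [mem_ofPred_eq, and_iff_left hs]
              simp only [mem_Ioc, mem_Ico, sub_le_iff_le_add]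
              exact and_comm
            by_cases h : t ∈ Ico (s - l) s
            · rw [indicator_of_mem h, indicator_of_mem (this.2 h)]; rfl
            · rw [indicator_of_notMem h, indicator_of_notMem (fun h' => h (this.1 h'))]
          rw [this, lintegral_indicator_one measurableSet_Ico, indicator_of_mem hs]
          simp
        · rw [indicator_of_notMem hs]
          refine le_of_eq ((lintegral_congr fun t => ?_).trans lintegral_zero)
          exact indicator_of_notMem (fun h => hs h.2) _
    _ = ENNReal.ofReal l := by simp

theorem setLIntegral_le_pieceMeasure {l : ℝ} (hl : 0 < l) {F : ℝ → ℝ≥0∞} (hF : Measurable F) :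
    ∫⁻ t in Icc 0 (1 - l), F t ≤ ∫⁻ t, F t ∂pieceMeasure l := by
  have hl0 : ENNReal.ofReal l ≠ 0 := (ENNReal.ofReal_pos.2 hl).ne'
  rw [lintegral_pieceMeasure l hF]
  refine le_trans (setLIntegral_mono' measurableSet_Icc fun t ht => ?_)
    (setLIntegral_le_lintegral _ _)
  rw [pieceLength_of_mem hl.le ht, ENNReal.div_self hl0 ENNReal.ofReal_ne_top, one_mul]

section Path

variable {d : ℝ → ℝ → ℝ≥0∞}

theorem le_tsum_pieces (htri : ∀ r s t, d r t ≤ d r s + d s t) {l : ℝ}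
    (hl : 0 < l) {σ : ℝ} (hσ : σ ∈ Ioc 0 l) :
    d 0 1 ≤ ∑' i : ℤ, d (clip (σ + i * l)) (clip (σ + i * l + l)) := by
  have hfin : ∀ N : ℕ, d 0 (clip (σ + ((N : ℤ) - 1 : ℤ) * l + l)) ≤ ∑ i ∈ Finset.range (N + 1),
      d (clip (σ + ((i : ℤ) - 1 : ℤ) * l)) (clip (σ + ((i : ℤ) - 1 : ℤ) * l + l)) := by
    intro N
    induction N with
    | zero =>
      rw [zero_add, Finset.sum_range_one]
      have : clip (σ + (((0 : ℕ) : ℤ) - 1 : ℤ) * l) = 0 := by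
        refine clip_of_nonpos ?_
        push_cast
        linarith [hσ.2]
      rw [this]
    | succ N ih =>
      rw [Finset.sum_range_succ]
      refine (htri _ (clip (σ + ((N : ℤ) - 1 : ℤ) * l + l)) _).trans (add_le_add ih ?_)
      have : σ + ((N : ℤ) - 1 : ℤ) * l + l = σ + (((N + 1 : ℕ) : ℤ) - 1 : ℤ) * l := by
        push_cast; ring
      rw [this]
  obtain ⟨N, hN⟩ := exists_nat_ge (1 / l)
  have h1 : clip (σ + ((N : ℤ) - 1 : ℤ) * l + l) = 1 := by
    refine clip_of_one_le ?_
    push_cast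
    have := (div_le_iff₀ hl).1 hN
    linarith [hσ.1]
  have h2 := hfin N
  rw [h1] at h2
  refine h2.trans ?_
  have hinj : Function.Injective fun i : ℕ => ((i : ℤ) - 1 : ℤ) := fun i j hij => by
    simpa using hij
  refine le_trans ?_ (ENNReal.tsum_comp_le_tsum_of_injective hinj
    fun i : ℤ => d (clip (σ + i * l)) (clip (σ + i * l + l)))
  exact ENNReal.sum_le_tsum _

theorem le_lintegral_pieces (htri : ∀ r s t, d r t ≤ d r s + d s t) {l : ℝ} (hl : 0 < l)
    (hm : Measurable fun t => d (clip t) (clip (t + l))) :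
    ENNReal.ofReal l * d 0 1 ≤ ∫⁻ t, d (clip t) (clip (t + l)) := by
  have hdom := isAddFundamentalDomain_Ioc hl 0 (μ := volume)
  rw [hdom.lintegral_eq_tsum'', zero_add]
  have hinj : Function.Injective fun i : ℤ =>
      (⟨i • l, AddSubgroup.zsmul_mem_zmultiples l i⟩ : AddSubgroup.zmultiples l) := fun i j hij =>
    (zsmul_left_strictMono hl).injective (congrArg Subtype.val hij)
  refine le_trans ?_ (ENNReal.tsum_comp_le_tsum_of_injective hinj _)
  have hmi : ∀ i : ℤ, Measurable fun σ : ℝ => d (clip (σ + i * l)) (clip (σ + i * l + l)) :=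
    fun i => hm.comp (measurable_id.add_const _)
  calc ENNReal.ofReal l * d 0 1 = ∫⁻ σ in Ioc 0 l, d 0 1 := by
        rw [setLIntegral_const, Real.volume_Ioc, sub_zero, mul_comm]
    _ ≤ ∫⁻ σ in Ioc 0 l, ∑' i : ℤ, d (clip (σ + i * l)) (clip (σ + i * l + l)) :=
        setLIntegral_mono' measurableSet_Ioc fun σ hσ => le_tsum_pieces htri hl hσ
    _ = ∑' i : ℤ, ∫⁻ σ in Ioc 0 l, d (clip (σ + i * l)) (clip (σ + i * l + l)) :=
        lintegral_tsum fun i => (hmi i).aemeasurable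
    _ ≤ _ := by
        refine ENNReal.tsum_le_tsum fun i => lintegral_mono fun σ => le_of_eq ?_
        simp only [AddSubgroup.vadd_def, vadd_eq_add, zsmul_eq_mul, add_comm]

/-- The average speed of a path on the piece of the unit interval starting at `t`. -/
def pieceSpeed (d : ℝ → ℝ → ℝ≥0∞) (l t : ℝ) : ℝ≥0∞ :=
  d (clip t) (clip (t + l)) / pieceLength l t

theorem pieceLength_mul_pieceSpeed (h0 : ∀ t, d t t = 0) {l : ℝ} (hl : 0 < l) (t : ℝ) :
    pieceLength l t * pieceSpeed d l t = d (clip t) (clip (t + l)) := by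
  rcases eq_or_ne (pieceLength l t) 0 with h | h
  · have : clip (t + l) = clip t := by
      have h1 : clip t ≤ clip (t + l) := clip_mono (by linarith)
      have h2 := ENNReal.ofReal_eq_zero.1 h
      linarith
    rw [this, h0, h, zero_mul]
  · exact ENNReal.mul_div_cancel h ENNReal.ofReal_ne_top

theorem le_lintegral_pieceSpeed (h0 : ∀ t, d t t = 0) (htri : ∀ r s t, d r t ≤ d r s + d s t)
    {l : ℝ} (hl : 0 < l) (hm : Measurable fun t => d (clip t) (clip (t + l))) :
    d 0 1 ≤ ∫⁻ t, pieceSpeed d l t ∂pieceMeasure l := by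
  have hl0 : ENNReal.ofReal l ≠ 0 := (ENNReal.ofReal_pos.2 hl).ne'
  have hsm : Measurable fun t => pieceSpeed d l t := hm.div (measurable_pieceLength l)
  rw [lintegral_pieceMeasure l hsm]
  have : ∀ t, pieceLength l t / ENNReal.ofReal l * pieceSpeed d l t =
      (ENNReal.ofReal l)⁻¹ * d (clip t) (clip (t + l)) := fun t => by
    rw [← pieceLength_mul_pieceSpeed h0 hl, div_eq_mul_inv]; ring
  simp_rw [this]
  rw [lintegral_const_mul _ hm, ← ENNReal.div_eq_inv_mul,
    ENNReal.le_div_iff_mul_le (.inl hl0) (.inl ENNReal.ofReal_ne_top), mul_comm]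
  exact le_lintegral_pieces htri hl hm

theorem pieceMeasure_univ {l : ℝ} (hl : 0 < l) : pieceMeasure l univ = 1 := by
  refine le_antisymm (pieceMeasure_univ_le hl) ?_
  have hm : Measurable fun t : ℝ => edist (clip t) (clip (t + l)) := by
    have := continuous_clip
    exact Measurable.edist this.measurable (this.measurable.comp (measurable_id.add_const l))
  have h := le_lintegral_pieceSpeed (d := edist) (fun t => edist_self t)
    (fun r s t => edist_triangle r s t) hl hm
  have h01 : edist (0 : ℝ) 1 = 1 := by rw [edist_dist]; simp
  rw [h01] at h
  refine h.trans ((lintegral_mono (g := fun _ => 1) fun t => ?_).trans_eq (by simp))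
  have h1 : clip t ≤ clip (t + l) := clip_mono (by linarith)
  rw [pieceSpeed, edist_comm, edist_dist, Real.dist_eq, abs_of_nonneg (sub_nonneg.2 h1)]
  exact ENNReal.div_self_le_one

theorem lintegral_pieceSpeed_deficit_le {p : ℝ} (hp : 1 < p) {τ K : ℝ≥0∞} (hK0 : K ≠ ∞)
    (hK : ∀ a A : ℝ≥0∞, A ≠ ∞ →
      (A ^ p - a ^ p) + K * (A ^ p + ENNReal.ofReal p * A ^ (p - 1) * a) ≤
        τ * (A ^ p + a ^ p) + K * (a ^ p + ENNReal.ofReal p * A ^ p))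
    (h0 : ∀ t, d t t = 0) (htri : ∀ r s t, d r t ≤ d r s + d s t) (hfin : d 0 1 ≠ ∞)
    {l : ℝ} (hl : 0 < l) (hm : Measurable fun t => d (clip t) (clip (t + l))) :
    ∫⁻ t, (d 0 1 ^ p - pieceSpeed d l t ^ p) ∂pieceMeasure l + K * d 0 1 ^ p ≤
      τ * (d 0 1 ^ p + ∫⁻ t, pieceSpeed d l t ^ p ∂pieceMeasure l) +
        K * ∫⁻ t, pieceSpeed d l t ^ p ∂pieceMeasure l := by
  set π := pieceMeasure l with hπ
  set A := d 0 1 with hA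
  have hp0 : 0 < p := by linarith
  have hsm : Measurable fun t => pieceSpeed d l t := hm.div (measurable_pieceLength l)
  have hspm : Measurable fun t => pieceSpeed d l t ^ p := hsm.pow_const p
  have hconst : ∀ c : ℝ≥0∞, ∫⁻ _t, c ∂π = c := fun c => by
    rw [lintegral_const, pieceMeasure_univ hl, mul_one]
  have e1 : ENNReal.ofReal p * A ^ p ≤
      ENNReal.ofReal p * A ^ (p - 1) * ∫⁻ t, pieceSpeed d l t ∂π := by
    have : A ^ p = A ^ (p - 1) * A := by
      conv_rhs => rw [← ENNReal.rpow_one A, ← ENNReal.rpow_mul, one_mul]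
      rw [← ENNReal.rpow_add_of_nonneg _ _ (by linarith) zero_le_one, sub_add_cancel]
    rw [this, mul_assoc]
    gcongr
    exact le_lintegral_pieceSpeed h0 htri hl hm
  have e2 := lintegral_mono (μ := π) fun t => hK (pieceSpeed d l t) A hfin
  have hr : ∫⁻ t, (τ * (A ^ p + pieceSpeed d l t ^ p) +
      K * (pieceSpeed d l t ^ p + ENNReal.ofReal p * A ^ p)) ∂π =
      τ * (A ^ p + ∫⁻ t, pieceSpeed d l t ^ p ∂π) + K * ∫⁻ t, pieceSpeed d l t ^ p ∂π +
        K * (ENNReal.ofReal p * A ^ p) := by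
    rw [lintegral_add_left (by fun_prop), lintegral_const_mul _ (by fun_prop),
      lintegral_const_mul _ (by fun_prop), lintegral_add_left (by fun_prop),
      lintegral_add_left (by fun_prop), hconst, hconst, mul_add K, add_assoc]
  have hl' : ∫⁻ t, (A ^ p - pieceSpeed d l t ^ p + K * (A ^ p + ENNReal.ofReal p * A ^ (p - 1) *
      pieceSpeed d l t)) ∂π = ∫⁻ t, (A ^ p - pieceSpeed d l t ^ p) ∂π + K * A ^ p +
        K * (ENNReal.ofReal p * A ^ (p - 1) * ∫⁻ t, pieceSpeed d l t ∂π) := by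
    rw [lintegral_add_right _ (by fun_prop), lintegral_const_mul _ (by fun_prop),
      lintegral_add_left (by fun_prop), lintegral_const_mul _ (by fun_prop), hconst, mul_add K,
      add_assoc]
  rw [hr, hl'] at e2
  have hcan : K * (ENNReal.ofReal p * A ^ p) ≠ ∞ :=
    ENNReal.mul_ne_top hK0 (ENNReal.mul_ne_top ENNReal.ofReal_ne_top
      (ENNReal.rpow_ne_top_of_nonneg hp0.le hfin))
  refine (ENNReal.add_le_add_iff_right hcan).1 (le_trans ?_ e2)
  gcongr

end Path

section Energy

variable {M : Type*} [MetricSpace M] [MeasurableSpace M]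

/-- The Korevaar-Schoen energy at scale `r`, without the normalizing constant, of a map that
pulls back the distance to `D`. -/
def scaleEnergy (μ : Measure M) (n : ℕ) (p : ℝ) (D : M × M → ℝ≥0∞) (h : M → ℝ≥0∞) (r : ℝ) : ℝ≥0∞ :=
  ENNReal.ofReal (r ^ (-((n : ℝ) + p))) *
    ∫⁻ z, ∫⁻ w in ball z r, h z * D (z, w) ^ p ∂μ ∂μ

theorem scaleEnergy_mono (μ : Measure M) (n : ℕ) (p : ℝ) (D : M × M → ℝ≥0∞) {h h' : M → ℝ≥0∞}
    (hh : ∀ x, h x ≤ h' x) (r : ℝ) : scaleEnergy μ n p D h r ≤ scaleEnergy μ n p D h' r := by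
  unfold scaleEnergy
  gcongr
  exact hh _

/-- `m (·, t)` selects points on geodesics of length `< δ` issuing from `B`, whose joint
distributions are controlled by the constant `C`. -/
structure IsTransport (μ : Measure M) (n : ℕ) (B : Set M) (C δ : ℝ) (m : (M × M) × ℝ → M) :
    Prop where
  measurable : Measurable m
  ae_isBtw : ∀ x ∈ B, ∀ᵐ y ∂μ.restrict (ball x δ), ∀ t ∈ Icc (0 : ℝ) 1, IsBtw t x y (m ((x, y), t))
  lintegral_le : ∀ t l ε : ℝ, 0 ≤ t → 0 < l → t + l ≤ 1 → ε ≤ δ → ∀ H : M × M → ℝ≥0∞,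
    Measurable H → ∫⁻ x in B, ∫⁻ y in ball x ε, H (m ((x, y), t), m ((x, y), t + l)) ∂μ ∂μ ≤
      ENNReal.ofReal (C / l ^ n) * ∫⁻ z, ∫⁻ w in ball z (l * ε), H (z, w) ∂μ ∂μ

/-- The normalized product measure on pairs of points of `B` at distance `< ε`. -/
def pairMeasure (μ : Measure M) (n : ℕ) (p : ℝ) (B : Set M) (ε : ℝ) : Measure (M × M) :=
  ENNReal.ofReal (ε ^ (-((n : ℝ) + p))) •
    (μ.prod μ).restrict {q | q.1 ∈ B ∧ dist q.2 q.1 < ε}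

instance (μ : Measure M) [SFinite μ] (n : ℕ) (p : ℝ) (B : Set M) (ε : ℝ) :
    SFinite (pairMeasure μ n p B ε) := by
  unfold pairMeasure; infer_instance

variable [BorelSpace M] [SecondCountableTopology M] {μ : Measure M} [SFinite μ] {n : ℕ} {p : ℝ}
  {B : Set M} {ε : ℝ}

theorem measurableSet_near (hB : MeasurableSet B) (ε : ℝ) :
    MeasurableSet {q : M × M | q.1 ∈ B ∧ dist q.2 q.1 < ε} :=
  (hB.preimage measurable_fst).inter (measurableSet_dist_lt ε)

theorem lintegral_pairMeasure (hB : MeasurableSet B) {F : M × M → ℝ≥0∞} (hF : Measurable F) :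
    ∫⁻ q, F q ∂pairMeasure μ n p B ε =
      ENNReal.ofReal (ε ^ (-((n : ℝ) + p))) * ∫⁻ x in B, ∫⁻ y in ball x ε, F (x, y) ∂μ ∂μ := by
  rw [pairMeasure, lintegral_smul_measure, smul_eq_mul,
    ← lintegral_indicator (measurableSet_near hB ε),
    lintegral_prod _ (hF.indicator (measurableSet_near hB ε)).aemeasurable,
    ← lintegral_indicator hB]
  congr 1
  refine lintegral_congr fun x => ?_
  by_cases hx : x ∈ B
  · rw [indicator_of_mem hx, ← lintegral_indicator measurableSet_ball]
    refine lintegral_congr fun y => ?_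
    by_cases hy : y ∈ ball x ε
    · rw [indicator_of_mem hy, indicator_of_mem]; exact ⟨hx, hy⟩
    · rw [indicator_of_notMem hy, indicator_of_notMem]; exact fun h => hy h.2
  · rw [indicator_of_notMem hx]
    refine (lintegral_congr fun y => ?_).trans lintegral_zero
    exact indicator_of_notMem (fun h => hx h.1) _

theorem lintegral_pairMeasure_eq_scaleEnergy (hB : MeasurableSet B) {D : M × M → ℝ≥0∞}
    (hD : Measurable D) {h : M → ℝ≥0∞} (hh : Measurable h) (hhB : ∀ x ∉ B, h x = 0) :
    ∫⁻ q, h q.1 * D q ^ p ∂pairMeasure μ n p B ε = scaleEnergy μ n p D h ε := by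
  have hF : Measurable fun q : M × M => h q.1 * D q ^ p := by fun_prop
  rw [lintegral_pairMeasure hB hF, scaleEnergy]
  congr 1
  refine setLIntegral_eq_of_support_subset ?_
  intro x hx
  by_contra hxB
  exact hx (by simp [hhB x hxB])

variable {C δ : ℝ} {m : (M × M) × ℝ → M} {D : M × M → ℝ≥0∞}

theorem IsTransport.ae_pairMeasure (hm : IsTransport μ n B C δ m) (hB : MeasurableSet B)
    (hεδ : ε ≤ δ) {t : ℝ} (ht : t ∈ Icc (0 : ℝ) 1) :
    ∀ᵐ q ∂pairMeasure μ n p B ε, IsBtw t q.1 q.2 (m (q, t)) ∧ dist q.2 q.1 < ε := by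
  have hmt : Measurable fun q : M × M => m (q, t) :=
    hm.measurable.comp (measurable_id.prodMk measurable_const)
  have hS : MeasurableSet {q : M × M | IsBtw t q.1 q.2 (m (q, t))} := by
    have : Measurable fun q : M × M => t * dist q.1 q.2 := by fun_prop
    have h' : Measurable fun q : M × M => (1 - t) * dist q.1 q.2 := by fun_prop
    exact (measurableSet_eq_fun (measurable_fst.dist hmt) this).inter
      (measurableSet_eq_fun (hmt.dist measurable_snd) h')
  refine Measure.ae_smul_measure ?_ _
  refine Eventually.and ?_ ?_
  · have hN := measurableSet_near hB (M := M) ε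
    rw [ae_restrict_iff (by exact hS)]
    have hmeas : MeasurableSet {q : M × M | q ∈ {q : M × M | q.1 ∈ B ∧ dist q.2 q.1 < ε} →
        IsBtw t q.1 q.2 (m (q, t))} := by
      simp only [imp_iff_not_or]
      exact hN.compl.union hS
    refine (Measure.ae_prod_iff_ae_ae hmeas).2 (Eventually.of_forall fun x => ?_)
    by_cases hx : x ∈ B
    · filter_upwards [(ae_restrict_iff' measurableSet_ball).1 (hm.ae_isBtw x hx)] with y hy hq
      exact hy (ball_subset_ball hεδ hq.2) t ht
    · exact Eventually.of_forall fun y hq => absurd hq.1 hx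
  · filter_upwards [ae_restrict_mem (measurableSet_near hB ε)] with q hq using hq.2

theorem IsTransport.lintegral_speed_le (hm : IsTransport μ n B C δ m) (hB : MeasurableSet B)
    (hp : 0 < p) (hC : 0 ≤ C) (hD : Measurable D) (hε : 0 < ε) (hεδ : ε ≤ δ) {t l : ℝ}
    (ht : 0 ≤ t) (hl : 0 < l) (htl : t + l ≤ 1) {h : M → ℝ≥0∞} (hh : Measurable h) :
    ∫⁻ q, h (m (q, t)) * (D (m (q, t), m (q, t + l)) / ENNReal.ofReal l) ^ p
        ∂pairMeasure μ n p B ε ≤ ENNReal.ofReal C * scaleEnergy μ n p D h (l * ε) := by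
  have hmt : ∀ t, Measurable fun q : M × M => m (q, t) := fun t =>
    hm.measurable.comp (measurable_id.prodMk measurable_const)
  have hl0 : ENNReal.ofReal l ≠ 0 := (ENNReal.ofReal_pos.2 hl).ne'
  have hH : Measurable fun q : M × M => h q.1 * (D q / ENNReal.ofReal l) ^ p :=
    (hh.comp measurable_fst).mul ((hD.div_const _).pow_const p)
  rw [lintegral_pairMeasure hB (F := fun q => h (m (q, t)) *
    (D (m (q, t), m (q, t + l)) / ENNReal.ofReal l) ^ p) (hH.comp ((hmt t).prodMk (hmt (t + l))))]
  refine (mul_le_mul_right (hm.lintegral_le t l ε ht hl htl hεδ _ hH) _).trans (le_of_eq ?_)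
  have e1 : ∀ z w, h z * (D (z, w) / ENNReal.ofReal l) ^ p =
      ENNReal.ofReal (l ^ (-p)) * (h z * D (z, w) ^ p) := by
    intro z w
    rw [ENNReal.div_rpow_of_nonneg _ _ hp.le, div_eq_mul_inv, ← ENNReal.rpow_neg,
      ENNReal.ofReal_rpow_of_pos hl]
    ring
  simp only [e1]
  simp_rw [lintegral_const_mul' _ _ ENNReal.ofReal_ne_top]
  rw [scaleEnergy, ← mul_assoc, ← mul_assoc, ← mul_assoc, ← ENNReal.ofReal_mul (by positivity),
    ← ENNReal.ofReal_mul (by positivity), ← ENNReal.ofReal_mul (by positivity)]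
  congr 2
  rw [Real.mul_rpow hl.le hε.le, neg_add, Real.rpow_add hl, Real.rpow_neg hl.le (n : ℝ),
    Real.rpow_natCast]
  ring

theorem IsTransport.lintegral_pieceSpeed_le (hm : IsTransport μ n B C δ m) (hB : MeasurableSet B)
    (hp : 0 < p) (hC : 0 ≤ C) (hD : Measurable D) (hD0 : ∀ x, D (x, x) = 0) (hε : 0 < ε)
    (hεδ : ε ≤ δ) {l : ℝ} (hl : 0 < l) (t : ℝ) {h : M → ℝ≥0∞} (hh : Measurable h) {b : ℝ≥0∞}
    (hb : ∀ r ∈ Ioc 0 ε, scaleEnergy μ n p D h r ≤ b) :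
    ∫⁻ q, h (m (q, clip t)) * pieceSpeed (fun s s' => D (m (q, s), m (q, s'))) l t ^ p
        ∂pairMeasure μ n p B ε ≤ ENNReal.ofReal C * b := by
  have hle : clip t ≤ clip (t + l) := clip_mono (by linarith)
  rcases hle.eq_or_lt with he | hlt
  · refine (le_of_eq ?_).trans zero_le
    refine (lintegral_congr fun q => ?_).trans lintegral_zero
    simp [pieceSpeed, ← he, hD0, ENNReal.zero_rpow_of_pos hp]
  · set l' := clip (t + l) - clip t with hl'
    have hl'0 : 0 < l' := sub_pos.2 hlt
    have h1 := (clip_mem t).1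
    have h2 := (clip_mem (t + l)).2
    have h3 : clip t + l' = clip (t + l) := by rw [hl']; ring
    have h4 : l' * ε ≤ ε := mul_le_of_le_one_left hε.le (by linarith)
    have := hm.lintegral_speed_le hB hp hC hD hε hεδ h1 hl'0 (h3.trans_le h2) hh
    rw [h3] at this
    refine this.trans ?_
    gcongr
    exact hb _ ⟨by positivity, h4⟩

end Energy

theorem measurable_pieceSpeed_comp {M : Type*} [MeasurableSpace M] {m : (M × M) × ℝ → M}
    {D : M × M → ℝ≥0∞} (hm : Measurable m) (hD : Measurable D) (l : ℝ) :
    Measurable fun z : (M × M) × ℝ =>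
      pieceSpeed (fun s s' => D (m (z.1, s), m (z.1, s'))) l z.2 := by
  have h := continuous_clip.measurable
  have h1 := measurable_pieceLength l
  unfold pieceSpeed
  fun_prop

section Subpartition

/-- A measurable, finite pseudo-distance. -/
structure IsMeasurableDist {M : Type*} [MeasurableSpace M] (D : M × M → ℝ≥0∞) : Prop where
  measurable : Measurable D
  self : ∀ x, D (x, x) = 0
  triangle : ∀ x y z, D (x, z) ≤ D (x, y) + D (y, z)
  ne_top : ∀ q, D q ≠ ∞

variable {M : Type*} [MetricSpace M] [MeasurableSpace M]

/-- At scale `ε`, the function `φ` oscillates by at most `ω` times the values of `ψ`. -/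
def OscLe (φ ψ : M → ℝ≥0∞) (ω : ℝ≥0∞) (ε : ℝ) : Prop :=
  ∀ x z, dist x z < ε → φ x ≤ φ z + ω * ψ x ∧ φ x ≤ φ z + ω * ψ z

/-- The mean over short pieces of the loss of `p`-energy in passing from a geodesic to its
pieces. -/
def energyDeficit (μ : Measure M) (n : ℕ) (p : ℝ) (B : Set M) (D : M × M → ℝ≥0∞)
    (m : (M × M) × ℝ → M) (φ : M → ℝ≥0∞) (ε l : ℝ) : ℝ≥0∞ :=
  ∫⁻ t, ∫⁻ q, φ q.1 * (D q ^ p - pieceSpeed (fun s s' => D (m (q, s), m (q, s'))) l t ^ p)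
    ∂pairMeasure μ n p B ε ∂pieceMeasure l

/-- The energy at scale `ε`, with the weight evaluated at a uniformly chosen point of the
geodesic. -/
def spreadEnergy (μ : Measure M) (n : ℕ) (p : ℝ) (B : Set M) (D : M × M → ℝ≥0∞)
    (m : (M × M) × ℝ → M) (ψ : M → ℝ≥0∞) (ε : ℝ) : ℝ≥0∞ :=
  ∫⁻ t in Icc (0 : ℝ) 1, ∫⁻ q, ψ (m (q, t)) * D q ^ p ∂pairMeasure μ n p B ε

variable [BorelSpace M] [SecondCountableTopology M] {μ : Measure M} [SFinite μ] {n : ℕ} {p : ℝ}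
  {B : Set M} {ε : ℝ} {C δ : ℝ} {m : (M × M) × ℝ → M} {D : M × M → ℝ≥0∞}
  {φ φ' : M → ℝ≥0∞} {ω b b' : ℝ≥0∞} {l : ℝ}

theorem IsTransport.ae_mono (hm : IsTransport μ n B C δ m) (hB : MeasurableSet B)
    (hεδ : ε ≤ δ) (hφ : OscLe φ φ' ω ε) {t : ℝ} (ht : t ∈ Icc (0 : ℝ) 1) :
    ∀ᵐ q ∂pairMeasure μ n p B ε, φ q.1 ≤ φ (m (q, t)) + ω * φ' (m (q, t)) ∧
      φ q.1 ≤ φ (m (q, t)) + ω * φ' q.1 ∧ φ (m (q, t)) ≤ φ q.1 + ω * φ' q.1 := by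
  filter_upwards [hm.ae_pairMeasure hB hεδ ht] with q hq
  have h : dist q.1 (m (q, t)) < ε := by
    rw [hq.1.1]
    refine (mul_le_of_le_one_left dist_nonneg ht.2).trans_lt ?_
    rw [dist_comm]
    exact hq.2
  exact ⟨(hφ _ _ h).2, (hφ _ _ h).1, (hφ _ _ (by rwa [dist_comm])).2⟩

theorem IsTransport.ae_endpoints (hm : IsTransport μ n B C δ m) (hB : MeasurableSet B)
    (hεδ : ε ≤ δ) :
    ∀ᵐ q ∂pairMeasure μ n p B ε, D (m (q, 0), m (q, 1)) = D q := by
  filter_upwards [hm.ae_pairMeasure hB hεδ (left_mem_Icc.2 zero_le_one),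
    hm.ae_pairMeasure hB hεδ (right_mem_Icc.2 zero_le_one)] with q h0 h1
  have e0 : q.1 = m (q, 0) := dist_eq_zero.1 (by rw [h0.1.1, zero_mul])
  have e1 : m (q, 1) = q.2 := dist_eq_zero.1 (by rw [h1.1.2, sub_self, zero_mul])
  rw [← e0, e1]

theorem IsTransport.lintegral_pieces_le (hm : IsTransport μ n B C δ m) (hB : MeasurableSet B)
    (hp : 0 < p) (hC : 0 ≤ C) (hD : IsMeasurableDist D) (hε : 0 < ε) (hεδ : ε ≤ δ) (hl : 0 < l)
    (hφm : Measurable φ) (hφm' : Measurable φ') (hφ : OscLe φ φ' ω ε)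
    (hb : ∀ r ∈ Ioc 0 ε, scaleEnergy μ n p D φ r ≤ b)
    (hb' : ∀ r ∈ Ioc 0 ε, scaleEnergy μ n p D φ' r ≤ b') :
    ∫⁻ t, ∫⁻ q, φ q.1 * pieceSpeed (fun s s' => D (m (q, s), m (q, s'))) l t ^ p
      ∂pairMeasure μ n p B ε ∂pieceMeasure l ≤ ENNReal.ofReal C * (b + ω * b') := by
  have hmt : ∀ t, Measurable fun q : M × M => m (q, t) := fun t =>
    hm.measurable.comp (measurable_id.prodMk measurable_const)
  have key : ∀ t, ∫⁻ q, φ q.1 * pieceSpeed (fun s s' => D (m (q, s), m (q, s'))) l t ^ p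
      ∂pairMeasure μ n p B ε ≤ ENNReal.ofReal C * (b + ω * b') := by
    intro t
    have hS : Measurable fun q : M × M =>
        pieceSpeed (fun s s' => D (m (q, s), m (q, s'))) l t :=
      (measurable_pieceSpeed_comp hm.measurable hD.measurable l).comp
        (measurable_id.prodMk measurable_const)
    calc ∫⁻ q, φ q.1 * pieceSpeed (fun s s' => D (m (q, s), m (q, s'))) l t ^ p
          ∂pairMeasure μ n p B ε
        ≤ ∫⁻ q, φ (m (q, clip t)) * pieceSpeed (fun s s' => D (m (q, s), m (q, s'))) l t ^ p +
          ω * (φ' (m (q, clip t)) * pieceSpeed (fun s s' => D (m (q, s), m (q, s'))) l t ^ p)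
            ∂pairMeasure μ n p B ε := by
          refine lintegral_mono_ae ?_
          filter_upwards [hm.ae_mono (p := p) hB hεδ hφ (clip_mem t)] with q hq
          rw [← mul_assoc, ← add_mul]
          gcongr
          exact hq.1
      _ ≤ ENNReal.ofReal C * (b + ω * b') := by
          rw [lintegral_add_left (by exact (hφm.comp (hmt _)).mul (hS.pow_const p)),
            lintegral_const_mul _ (by exact (hφm'.comp (hmt _)).mul (hS.pow_const p))]
          have h1 := hm.lintegral_pieceSpeed_le hB hp hC hD.measurable hD.self hε hεδ hl t hφm hb
          have h2 := hm.lintegral_pieceSpeed_le hB hp hC hD.measurable hD.self hε hεδ hl t hφm' hb'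
          calc _ ≤ ENNReal.ofReal C * b + ω * (ENNReal.ofReal C * b') := by gcongr
            _ = _ := by ring
  refine (lintegral_mono key).trans ?_
  rw [lintegral_const, pieceMeasure_univ hl, mul_one]

theorem IsTransport.energyDeficit_add_le (hm : IsTransport μ n B C δ m) (hB : MeasurableSet B)
    (hp : 1 < p) (hC : 0 ≤ C) (hD : IsMeasurableDist D) (hε : 0 < ε) (hεδ : ε ≤ δ) (hl : 0 < l)
    (hφm : Measurable φ) (hφm' : Measurable φ') (hφ : OscLe φ φ' ω ε)
    (hφB : ∀ x ∉ B, φ x = 0)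
    (hb : ∀ r ∈ Ioc 0 ε, scaleEnergy μ n p D φ r ≤ b)
    (hb' : ∀ r ∈ Ioc 0 ε, scaleEnergy μ n p D φ' r ≤ b')
    {τ K : ℝ≥0∞} (hK0 : K ≠ ∞) (hK : ∀ a A : ℝ≥0∞, A ≠ ∞ →
      (A ^ p - a ^ p) + K * (A ^ p + ENNReal.ofReal p * A ^ (p - 1) * a) ≤
        τ * (A ^ p + a ^ p) + K * (a ^ p + ENNReal.ofReal p * A ^ p)) :
    energyDeficit μ n p B D m φ ε l + K * scaleEnergy μ n p D φ ε ≤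
      τ * (scaleEnergy μ n p D φ ε + ENNReal.ofReal C * (b + ω * b')) +
        K * (ENNReal.ofReal C * (b + ω * b')) := by
  have hDm := hD.measurable
  have hS := measurable_pieceSpeed_comp hm.measurable hDm l
  set P := pairMeasure μ n p B ε with hP
  set S : (M × M) × ℝ → ℝ≥0∞ :=
    fun z => pieceSpeed (fun s s' => D (m (z.1, s), m (z.1, s'))) l z.2 with hSdef
  have hSq : ∀ q, Measurable fun t => S (q, t) := fun q =>
    hS.comp (measurable_const.prodMk measurable_id)
  have hX := hm.lintegral_pieces_le hB (by linarith) hC hD hε hεδ hl hφm hφm' hφ hb hb'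
  rw [lintegral_lintegral_swap (by
    have : Measurable fun z : ℝ × (M × M) => φ z.2.1 * S (z.2, z.1) ^ p := by fun_prop
    exact this.aemeasurable)] at hX
  have hW : energyDeficit μ n p B D m φ ε l =
      ∫⁻ q, ∫⁻ t, φ q.1 * (D q ^ p - S (q, t) ^ p) ∂pieceMeasure l ∂P := by
    rw [energyDeficit, lintegral_lintegral_swap]
    have : Measurable fun z : ℝ × (M × M) => φ z.2.1 * (D z.2 ^ p - S (z.2, z.1) ^ p) := by
      fun_prop
    exact this.aemeasurable
  rw [hW, ← lintegral_pairMeasure_eq_scaleEnergy hB hDm hφm hφB]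
  rw [← hP]
  set X := ∫⁻ q, ∫⁻ t, φ q.1 * S (q, t) ^ p ∂pieceMeasure l ∂P with hXdef
  have hi : Measurable fun q : M × M => ∫⁻ t, φ q.1 * S (q, t) ^ p ∂pieceMeasure l := by
    refine Measurable.lintegral_prod_right' (f := fun z : (M × M) × ℝ => φ z.1.1 * S z ^ p) ?_
    fun_prop
  have hi' : Measurable fun q : M × M => φ q.1 * D q ^ p := by fun_prop
  calc ∫⁻ q, ∫⁻ t, φ q.1 * (D q ^ p - S (q, t) ^ p) ∂pieceMeasure l ∂P +
        K * ∫⁻ q, φ q.1 * D q ^ p ∂P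
      = ∫⁻ q, (∫⁻ t, φ q.1 * (D q ^ p - S (q, t) ^ p) ∂pieceMeasure l +
          K * (φ q.1 * D q ^ p)) ∂P := by
        rw [lintegral_add_right _ (hi'.const_mul K), lintegral_const_mul _ hi']
    _ ≤ ∫⁻ q, (τ * (φ q.1 * D q ^ p + ∫⁻ t, φ q.1 * S (q, t) ^ p ∂pieceMeasure l) +
          K * ∫⁻ t, φ q.1 * S (q, t) ^ p ∂pieceMeasure l) ∂P := by
        refine lintegral_mono_ae ?_
        filter_upwards [hm.ae_endpoints (p := p) (D := D) hB hεδ] with q hq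
        have hdm : Measurable fun t => D (m (q, clip t), m (q, clip (t + l))) := by
          have h := continuous_clip.measurable
          have h' := hm.measurable
          fun_prop
        have := lintegral_pieceSpeed_deficit_le hp hK0 hK
          (d := fun s s' => D (m (q, s), m (q, s'))) (fun t => hD.self _)
          (fun r s t => hD.triangle _ _ _) (hD.ne_top _) hl hdm
        simp only [hq] at this
        have hSqp : Measurable fun t => S (q, t) ^ p := (hSq q).pow_const p
        rw [lintegral_const_mul _ hSqp, lintegral_const_mul _ (by fun_prop)]
        calc _ = φ q.1 * (∫⁻ t, (D q ^ p - S (q, t) ^ p) ∂pieceMeasure l + K * D q ^ p) := by ring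
          _ ≤ φ q.1 * _ := mul_le_mul_right this _
          _ = _ := by ring
    _ = τ * (∫⁻ q, φ q.1 * D q ^ p ∂P + X) + K * X := by
        rw [lintegral_add_right _ (hi.const_mul K), lintegral_const_mul _ hi,
          lintegral_const_mul _ (by exact hi'.add hi), lintegral_add_left hi']
    _ ≤ _ := by gcongr

theorem IsTransport.spreadEnergy_le (hm : IsTransport μ n B C δ m) (hB : MeasurableSet B)
    (hp : 0 < p) (hC : 0 ≤ C) (hD : IsMeasurableDist D) (hε : 0 < ε) (hεδ : ε ≤ δ)
    (hl : 0 < l) (hl1 : l ≤ 1) (hφm : Measurable φ) (hφm' : Measurable φ')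
    (hφ : OscLe φ φ' ω ε) (hφB : ∀ x ∉ B, φ x = 0) (hφB' : ∀ x ∉ B, φ' x = 0)
    {ψ : M → ℝ≥0∞} (hψ : Measurable ψ) (hψφ : ∀ x, ψ x ≤ φ x) :
    spreadEnergy μ n p B D m ψ ε ≤ ENNReal.ofReal C * scaleEnergy μ n p D ψ (l * ε) +
      (energyDeficit μ n p B D m φ ε l + ω * scaleEnergy μ n p D φ' ε) +
        ENNReal.ofReal l * (scaleEnergy μ n p D φ ε + ω * scaleEnergy μ n p D φ' ε) := by
  have hDm := hD.measurable
  have hS := measurable_pieceSpeed_comp hm.measurable hDm l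
  have hmm := hm.measurable
  rw [← lintegral_pairMeasure_eq_scaleEnergy hB hDm hφm hφB,
    ← lintegral_pairMeasure_eq_scaleEnergy hB hDm hφm' hφB']
  set P := pairMeasure μ n p B ε with hP
  set S : (M × M) × ℝ → ℝ≥0∞ :=
    fun z => pieceSpeed (fun s s' => D (m (z.1, s), m (z.1, s'))) l z.2 with hSdef
  have hi : Measurable fun q : M × M => φ q.1 * D q ^ p := by fun_prop
  have hi' : Measurable fun q : M × M => φ' q.1 * D q ^ p := by fun_prop
  have hmono : ∀ t ∈ Icc (0 : ℝ) 1, ∀ᵐ q ∂P, ψ (m (q, t)) ≤ φ q.1 + ω * φ' q.1 := fun t ht => by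
    filter_upwards [hm.ae_mono (p := p) hB hεδ hφ ht] with q hq using (hψφ _).trans hq.2.2
  have hWm : Measurable fun t => ∫⁻ q, φ q.1 * (D q ^ p - S (q, t) ^ p) ∂P := by
    refine Measurable.lintegral_prod_right'
      (f := fun z : ℝ × (M × M) => φ z.2.1 * (D z.2 ^ p - S (z.2, z.1) ^ p)) ?_
    fun_prop
  have hfirst : ∀ t ∈ Icc (0 : ℝ) (1 - l), ∫⁻ q, ψ (m (q, t)) * D q ^ p ∂P ≤
      ENNReal.ofReal C * scaleEnergy μ n p D ψ (l * ε) +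
        (∫⁻ q, φ q.1 * (D q ^ p - S (q, t) ^ p) ∂P + ω * ∫⁻ q, φ' q.1 * D q ^ p ∂P) := by
    intro t ht
    have ht1 : t ∈ Icc (0 : ℝ) 1 := ⟨ht.1, by linarith [ht.2]⟩
    have hSt : ∀ q, S (q, t) = D (m (q, t), m (q, t + l)) / ENNReal.ofReal l := fun q => by
      rw [hSdef]
      simp only [pieceSpeed]
      rw [pieceLength_of_mem hl.le ht, clip_of_mem ht1,
        clip_of_mem ⟨by linarith [ht.1], by linarith [ht.2]⟩]
    have h1 := hm.lintegral_speed_le hB hp hC hDm hε hεδ ht.1 hl (by linarith [ht.2]) hψ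
    simp only [← hSt] at h1
    have hψS : Measurable fun q : M × M => ψ (m (q, t)) * S (q, t) ^ p := by fun_prop
    have hφS : Measurable fun q : M × M => φ q.1 * (D q ^ p - S (q, t) ^ p) := by fun_prop
    calc ∫⁻ q, ψ (m (q, t)) * D q ^ p ∂P
        ≤ ∫⁻ q, (ψ (m (q, t)) * S (q, t) ^ p + (φ q.1 * (D q ^ p - S (q, t) ^ p) +
            ω * (φ' q.1 * D q ^ p))) ∂P := by
          refine lintegral_mono_ae ?_
          filter_upwards [hmono t ht1] with q hq
          calc ψ (m (q, t)) * D q ^ p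
              ≤ ψ (m (q, t)) * (S (q, t) ^ p + (D q ^ p - S (q, t) ^ p)) := by
                gcongr
                exact le_add_tsub
            _ ≤ ψ (m (q, t)) * S (q, t) ^ p +
                  (φ q.1 + ω * φ' q.1) * (D q ^ p - S (q, t) ^ p) := by
                rw [mul_add]
                gcongr
            _ ≤ ψ (m (q, t)) * S (q, t) ^ p + (φ q.1 * (D q ^ p - S (q, t) ^ p) +
                  ω * φ' q.1 * D q ^ p) := by
                rw [add_mul]
                gcongr
                exact tsub_le_self
            _ = _ := by rw [mul_assoc]
      _ ≤ _ := by
          rw [lintegral_add_left hψS, lintegral_add_left hφS, lintegral_const_mul _ hi']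
          gcongr
  have hsecond : ∀ t ∈ Icc (0 : ℝ) 1, ∫⁻ q, ψ (m (q, t)) * D q ^ p ∂P ≤
      ∫⁻ q, φ q.1 * D q ^ p ∂P + ω * ∫⁻ q, φ' q.1 * D q ^ p ∂P := by
    intro t ht
    rw [← lintegral_const_mul _ hi', ← lintegral_add_left hi]
    refine lintegral_mono_ae ?_
    filter_upwards [hmono t ht] with q hq
    rw [← mul_assoc, ← add_mul]
    gcongr
  have hsplit : Icc (0 : ℝ) 1 = Icc 0 (1 - l) ∪ Icc (1 - l) 1 :=
    (Icc_union_Icc_eq_Icc (by linarith) (by linarith)).symm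
  have hv : volume (Icc (0 : ℝ) (1 - l)) ≤ 1 := by
    rw [Real.volume_Icc]
    exact ENNReal.ofReal_le_one.2 (by linarith)
  have hv' : volume (Icc (1 - l) (1 : ℝ)) = ENNReal.ofReal l := by
    rw [Real.volume_Icc, sub_sub_cancel]
  rw [spreadEnergy, hsplit]
  refine (lintegral_union_le _ _ _).trans (add_le_add ?_ ?_)
  · refine (setLIntegral_mono' measurableSet_Icc hfirst).trans ?_
    rw [lintegral_add_left measurable_const, lintegral_add_right _ measurable_const,
      setLIntegral_const, setLIntegral_const]
    have := setLIntegral_le_pieceMeasure hl hWm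
    refine add_le_add (mul_le_of_le_one_right' hv)
      (add_le_add this (mul_le_of_le_one_right' hv))
  · refine (setLIntegral_mono' measurableSet_Icc fun t ht =>
      hsecond t ⟨by linarith [ht.1], ht.2⟩).trans ?_
    rw [setLIntegral_const, hv', mul_comm]

theorem IsTransport.scaleEnergy_le_spreadEnergy_add (hm : IsTransport μ n B C δ m)
    (hB : MeasurableSet B) (hD : IsMeasurableDist D) (hεδ : ε ≤ δ)
    (hφm : Measurable φ) (hφm' : Measurable φ')
    (hφ : OscLe φ φ' ω ε) (hφB : ∀ x ∉ B, φ x = 0) (hφB' : ∀ x ∉ B, φ' x = 0) :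
    scaleEnergy μ n p D φ ε ≤
      spreadEnergy μ n p B D m φ ε + ω * scaleEnergy μ n p D φ' ε := by
  have hDm := hD.measurable
  have hmm := hm.measurable
  rw [← lintegral_pairMeasure_eq_scaleEnergy hB hDm hφm hφB,
    ← lintegral_pairMeasure_eq_scaleEnergy hB hDm hφm' hφB', spreadEnergy]
  set P := pairMeasure μ n p B ε with hP
  have hi' : Measurable fun q : M × M => φ' q.1 * D q ^ p := by fun_prop
  have key : ∀ t ∈ Icc (0 : ℝ) 1, ∫⁻ q, φ q.1 * D q ^ p ∂P ≤
      ∫⁻ q, φ (m (q, t)) * D q ^ p ∂P + ω * ∫⁻ q, φ' q.1 * D q ^ p ∂P := by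
    intro t ht
    rw [← lintegral_const_mul _ hi', ← lintegral_add_right _ (hi'.const_mul ω)]
    refine lintegral_mono_ae ?_
    filter_upwards [hm.ae_mono (p := p) hB hεδ hφ ht] with q hq
    rw [← mul_assoc, ← add_mul]
    gcongr
    exact hq.2.1
  have hv : volume (Icc (0 : ℝ) 1) = 1 := by simp
  have := setLIntegral_mono' (μ := volume) measurableSet_Icc key
  rwa [lintegral_add_right _ measurable_const, setLIntegral_const, setLIntegral_const, hv,
    mul_one, mul_one] at this

end Subpartition

theorem spreadEnergy_add {M : Type*} [MetricSpace M] [MeasurableSpace M] {μ : Measure M}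
    [SFinite μ] {n : ℕ} {p : ℝ} {B : Set M} {D : M × M → ℝ≥0∞} {m : (M × M) × ℝ → M}
    (hm : Measurable m) (hD : Measurable D) {f : M → ℝ≥0∞} (hf : Measurable f) (g : M → ℝ≥0∞)
    (r : ℝ) :
    spreadEnergy μ n p B D m (fun x => f x + g x) r =
      spreadEnergy μ n p B D m f r + spreadEnergy μ n p B D m g r := by
  have hF : Measurable fun z : ℝ × (M × M) => f (m (z.2, z.1)) * D z.2 ^ p := by fun_prop
  rw [spreadEnergy, spreadEnergy, spreadEnergy,
    ← lintegral_add_left (by exact hF.lintegral_prod_right')]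
  refine lintegral_congr fun t => ?_
  rw [← lintegral_add_left (by exact hF.comp (measurable_const.prodMk measurable_id))]
  simp only [add_mul]

theorem exists_small_param {q q' θ : ℝ≥0∞} (hq : q ≠ ∞) (hq' : q' ≠ ∞) (hθ : θ ≠ 0) :
    ∃ x : ℝ≥0∞, x ≠ 0 ∧ x ≠ ∞ ∧ (1 + x) * (q + x + x * q') + x ≤ q + θ := by
  have h1 : Tendsto (fun x : ℝ≥0∞ => (1 + x) * (q + x + x * q') + x) (𝓝 0)
      (𝓝 ((1 + 0) * (q + 0 + 0 * q') + 0)) := by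
    have hx : Tendsto (fun x : ℝ≥0∞ => x) (𝓝 0) (𝓝 0) := tendsto_id
    refine Tendsto.add (ENNReal.Tendsto.mul (tendsto_const_nhds.add hx) (.inl (by simp))
      ((tendsto_const_nhds.add hx).add (ENNReal.Tendsto.mul_const hx (.inr hq')))
      (.inr (by simp))) hx
  rw [add_zero, add_zero, zero_mul, add_zero, add_zero, one_mul] at h1
  have h2 := h1.eventually (Iio_mem_nhds (ENNReal.lt_add_right hq hθ))
  have h3 := h2.and (Iio_mem_nhds (show (0 : ℝ≥0∞) < 1 by simp))
  have : (𝓝[>] (0 : ℝ≥0∞)).NeBot := nhdsGT_neBot_of_exists_gt ⟨1, by simp⟩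
  obtain ⟨x, ⟨hx, hx1⟩, hx0⟩ := ((h3.filter_mono nhdsWithin_le_nhds).and
    self_mem_nhdsWithin : ∀ᶠ x in 𝓝[>] (0 : ℝ≥0∞), _).exists
  exact ⟨x, (mem_Ioi.1 hx0).ne', (lt_trans (mem_Iio.1 hx1) (by simp)).ne, (mem_Iio.1 hx).le⟩

section AlmostMonotone

variable {M : Type*} [MetricSpace M] [MeasurableSpace M] [BorelSpace M]
  [SecondCountableTopology M] {μ : Measure M} [SFinite μ] {n : ℕ} {p : ℝ} {B : Set M}
  {D : M × M → ℝ≥0∞} {φ φ' : M → ℝ≥0∞}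

theorem scaleEnergy_add (hD : Measurable D) {f : M → ℝ≥0∞} (hf : Measurable f)
    (g : M → ℝ≥0∞) (r : ℝ) : scaleEnergy μ n p D (fun x => f x + g x) r =
      scaleEnergy μ n p D f r + scaleEnergy μ n p D g r := by
  have hF : Measurable fun q : M × M => f q.1 * D q ^ p := by fun_prop
  rw [scaleEnergy, scaleEnergy, scaleEnergy, ← mul_add]
  congr 1
  rw [← lintegral_add_left (measurable_lintegral_ball μ r hF)]
  refine lintegral_congr fun z => ?_
  rw [← lintegral_add_left (by exact hF.comp (measurable_const.prodMk measurable_id))]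
  simp only [add_mul]

theorem exists_scaleEnergy_le_add (hp : 1 < p) (hB : MeasurableSet B)
    (hT : ∀ C : ℝ, 1 < C → ∃ δ, 0 < δ ∧ ∃ m, IsTransport μ n B C δ m)
    (hD : IsMeasurableDist D) (hφm : Measurable φ) (hφm' : Measurable φ')
    (hφB : ∀ x ∉ B, φ x = 0) (hφB' : ∀ x ∉ B, φ' x = 0)
    (hosc : ∀ ω : ℝ≥0∞, ω ≠ 0 → ∀ᶠ ε in 𝓝[>] (0 : ℝ), OscLe φ φ' ω ε)
    {q q' : ℝ≥0∞} (hq : q ≠ ∞) (hq' : q' ≠ ∞)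
    (hφq : Tendsto (scaleEnergy μ n p D φ) (𝓝[>] 0) (𝓝 q))
    (hφq' : Tendsto (scaleEnergy μ n p D φ') (𝓝[>] 0) (𝓝 q')) {η : ℝ≥0∞} (hη : η ≠ 0) :
    ∃ ρ : ℝ, 0 < ρ ∧ ∀ r ∈ Ioo 0 ρ, ∀ r' ∈ Ioo 0 ρ, ∀ ψ : M → ℝ≥0∞, Measurable ψ →
      (∀ x, ψ x ≤ φ x) → scaleEnergy μ n p D ψ r ≤ scaleEnergy μ n p D ψ r' + η := by
  have hDm := hD.measurable
  set τ : ℝ≥0∞ := η / 2 / (4 * (q + 1)) with hτ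
  have hη2 : η / 2 ≠ 0 := ENNReal.div_ne_zero.2 ⟨hη, by simp⟩
  have hq4 : 4 * (q + 1) ≠ ∞ := by finiteness
  obtain ⟨K, hK0, hK⟩ := exists_const_rpow_sub_rpow_le hp
    (τ := τ) (ENNReal.div_ne_zero.2 ⟨hη2, hq4⟩)
  set θ : ℝ≥0∞ := min 1 (η / 2 / (2 * K + 9)) with hθ
  have hK9 : 2 * K + 9 ≠ ∞ := by finiteness
  have hθ0 : θ ≠ 0 := (lt_min (by simp) (ENNReal.div_pos hη2 hK9)).ne'
  have hθ1 : θ ≤ 1 := min_le_left _ _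
  have hθt : θ ≠ ∞ := (hθ1.trans_lt (by simp)).ne
  have hτη : 4 * (τ * (q + 1)) ≤ η / 2 := by
    rw [mul_left_comm, mul_comm]
    exact ENNReal.mul_le_of_le_div' le_rfl
  have hθη : (2 * K + 9) * θ ≤ η / 2 := by
    rw [mul_comm]
    exact ENNReal.mul_le_of_le_div (min_le_right _ _)
  obtain ⟨x, hx0, hxt, hx⟩ := exists_small_param hq (ENNReal.add_ne_top.2 ⟨hq', ENNReal.one_ne_top⟩)
    hθ0
  have hC : (1 : ℝ) < 1 + x.toReal := by linarith [ENNReal.toReal_pos hx0 hxt]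
  have hCx : ENNReal.ofReal (1 + x.toReal) = 1 + x := by
    rw [ENNReal.ofReal_add zero_le_one ENNReal.toReal_nonneg, ENNReal.ofReal_one,
      ENNReal.ofReal_toReal hxt]
  obtain ⟨δ, hδ, m, hm⟩ := hT _ hC
  have hev := ((hosc x hx0).and ((ENNReal.tendsto_nhds hq).1 hφq x (pos_iff_ne_zero.2 hx0))).and
    ((ENNReal.tendsto_nhds hq').1 hφq' 1 one_pos)
  obtain ⟨ρ₀, hρ₀, hsub⟩ := mem_nhdsGT_iff_exists_Ioo_subset.1 hev
  have hρ₀' : (0 : ℝ) < ρ₀ := hρ₀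
  set ε := min δ (ρ₀ / 2) with hε
  have hε0 : 0 < ε := lt_min hδ (half_pos hρ₀')
  have hεδ : ε ≤ δ := min_le_left _ _
  have hr : ∀ r ∈ Ioc 0 ε, OscLe φ φ' x r ∧ q - x ≤ scaleEnergy μ n p D φ r ∧
      scaleEnergy μ n p D φ r ≤ q + x ∧ scaleEnergy μ n p D φ' r ≤ q' + 1 := fun r hr => by
    have hr' : r ∈ Ioo 0 ρ₀ :=
      ⟨hr.1, hr.2.trans_lt ((min_le_right _ _).trans_lt (half_lt_self hρ₀'))⟩
    obtain ⟨⟨h1, h2⟩, h3⟩ := hsub hr'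
    exact ⟨h1, h2.1, h2.2, h3.2⟩
  have hεm : ε ∈ Ioc 0 ε := ⟨hε0, le_rfl⟩
  obtain ⟨ho, hlow, -, hupp'⟩ := hr ε hεm
  have hlow' : q ≤ scaleEnergy μ n p D φ ε + x := tsub_le_iff_right.1 hlow
  have hxθ : x ≤ θ := by
    refine (ENNReal.add_le_add_iff_left hq).1 (le_trans ?_ hx)
    gcongr
    calc q ≤ 1 * (q + 0 + 0) := by simp
      _ ≤ _ := by gcongr <;> simp
  have hX : (1 + x) * (q + x + x * (q' + 1)) ≤ q + 1 :=
    le_self_add.trans (hx.trans (by gcongr))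
  have hxb : x * (q + x) ≤ θ := by
    refine (ENNReal.add_le_add_iff_left hq).1 (le_trans ?_ hx)
    calc q + x * (q + x) ≤ q + x * (q + x) + (x + x * (q' + 1) + x * (x * (q' + 1)) + x) :=
          le_self_add
      _ = _ := by ring
  have hxb' : x * (q' + 1) ≤ θ := by
    refine (ENNReal.add_le_add_iff_left hq).1 (le_trans ?_ hx)
    calc q + x * (q' + 1) ≤ q + x * (q' + 1) + (x + x * (q + x) + x * (x * (q' + 1)) + x) :=
          le_self_add
      _ = _ := by ring
  have hb : ∀ r ∈ Ioc 0 ε, scaleEnergy μ n p D φ r ≤ q + x := fun r h => (hr r h).2.2.1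
  have hb' : ∀ r ∈ Ioc 0 ε, scaleEnergy μ n p D φ' r ≤ q' + 1 := fun r h => (hr r h).2.2.2
  have hW : ∀ l, 0 < l → energyDeficit μ n p B D m φ ε l ≤ 2 * (τ * (q + 1)) + K * θ := by
    intro l hl
    have h := hm.energyDeficit_add_le hB hp (by linarith) hD hε0 hεδ hl hφm hφm' ho hφB hb hb' hK0
      hK
    rw [hCx] at h
    have hKq : K * q ≠ ∞ := ENNReal.mul_ne_top hK0 hq
    refine (ENNReal.add_le_add_iff_right hKq).1 ?_
    calc energyDeficit μ n p B D m φ ε l + K * q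
        ≤ energyDeficit μ n p B D m φ ε l + K * (scaleEnergy μ n p D φ ε + x) := by gcongr
      _ = energyDeficit μ n p B D m φ ε l + K * scaleEnergy μ n p D φ ε + K * x := by ring
      _ ≤ τ * (q + x + (1 + x) * (q + x + x * (q' + 1))) +
            K * ((1 + x) * (q + x + x * (q' + 1))) + K * x := by
          refine add_le_add_left (h.trans ?_) _
          gcongr
          exact hb ε hεm
      _ = τ * (q + x + (1 + x) * (q + x + x * (q' + 1))) +
            K * ((1 + x) * (q + x + x * (q' + 1)) + x) := by ring
      _ ≤ τ * (q + 1 + (q + 1)) + K * (q + θ) := by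
          gcongr
          exact hxθ.trans hθ1
      _ = _ := by ring
  obtain ⟨l₀, hl₀, hl₁, hl₀θ⟩ : ∃ l₀ : ℝ, 0 < l₀ ∧ l₀ ≤ 1 ∧ ENNReal.ofReal l₀ * (q + 1) ≤ θ := by
    have hq1 : q + 1 ≠ ∞ := by finiteness
    have hdiv : θ / (q + 1) ≠ ∞ := ENNReal.div_ne_top hθt (by simp)
    refine ⟨min 1 (θ / (q + 1)).toReal, lt_min one_pos
      (ENNReal.toReal_pos (ENNReal.div_ne_zero.2 ⟨hθ0, hq1⟩) hdiv), min_le_left _ _, ?_⟩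
    refine ENNReal.mul_le_of_le_div ((ENNReal.ofReal_le_ofReal (min_le_right _ _)).trans ?_)
    rw [ENNReal.ofReal_toReal hdiv]
  have hL : ∀ r ∈ Ioo 0 (l₀ * ε), ∀ ψ : M → ℝ≥0∞, Measurable ψ → (∀ x, ψ x ≤ φ x) →
      spreadEnergy μ n p B D m ψ ε ≤
        scaleEnergy μ n p D ψ r + (2 * (τ * (q + 1)) + K * θ + 3 * θ) := by
    intro r hrI ψ hψ hψφ
    have hl : 0 < r / ε := div_pos hrI.1 hε0
    have hl' : r / ε ≤ l₀ := (div_le_iff₀ hε0).2 hrI.2.le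
    have h := hm.spreadEnergy_le (p := p) hB (by linarith) (by linarith) hD hε0 hεδ hl
      (hl'.trans hl₁) hφm hφm' ho hφB hφB' hψ hψφ
    rw [hCx, div_mul_cancel₀ _ hε0.ne'] at h
    have hrε : r ∈ Ioc 0 ε := ⟨hrI.1, hrI.2.le.trans (mul_le_of_le_one_left hε0.le hl₁)⟩
    calc _ ≤ _ := h
      _ = scaleEnergy μ n p D ψ r + x * scaleEnergy μ n p D ψ r +
          (energyDeficit μ n p B D m φ ε (r / ε) + x * scaleEnergy μ n p D φ' ε) +
          ENNReal.ofReal (r / ε) *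
            (scaleEnergy μ n p D φ ε + x * scaleEnergy μ n p D φ' ε) := by ring
      _ ≤ scaleEnergy μ n p D ψ r + x * (q + x) +
          (2 * (τ * (q + 1)) + K * θ + x * (q' + 1)) +
          ENNReal.ofReal l₀ * (1 * (q + x + x * (q' + 1))) := by
          rw [one_mul]
          gcongr
          · exact (scaleEnergy_mono μ n p D hψφ r).trans (hb r hrε)
          · exact hW _ hl
          · exact hb ε hεm
      _ ≤ scaleEnergy μ n p D ψ r + θ + (2 * (τ * (q + 1)) + K * θ + θ) + θ := by
          gcongr
          refine le_trans ?_ hl₀θ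
          gcongr
          refine le_trans ?_ hX
          gcongr
          exact le_self_add
      _ = _ := by ring
  refine ⟨l₀ * ε, mul_pos hl₀ hε0, fun r hrI r' hrI' ψ hψ hψφ => ?_⟩
  have hχ : Measurable fun y => φ y - ψ y := hφm.sub hψ
  have hsum : (fun y => ψ y + (φ y - ψ y)) = φ := funext fun y => add_tsub_cancel_of_le (hψφ y)
  have hrε : r ∈ Ioc 0 ε := ⟨hrI.1, hrI.2.le.trans (mul_le_of_le_one_left hε0.le hl₁)⟩
  have hsplit := scaleEnergy_add (μ := μ) (n := n) (p := p) hDm hψ (fun y => φ y - ψ y) r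
  have hsplit' := spreadEnergy_add (μ := μ) (n := n) (p := p) (B := B) hm.measurable hDm hψ
    (fun y => φ y - ψ y) ε
  rw [hsum] at hsplit hsplit'
  have hχfin : scaleEnergy μ n p D (fun y => φ y - ψ y) r ≠ ∞ :=
    ((scaleEnergy_mono μ n p D (fun y => tsub_le_self) r).trans_lt
      ((hb r hrε).trans_lt (by finiteness))).ne
  refine (ENNReal.add_le_add_iff_right hχfin).1 ?_
  have h4 := hm.scaleEnergy_le_spreadEnergy_add (p := p) hB hD hεδ hφm hφm' ho hφB hφB'
  rw [← hsplit]
  calc scaleEnergy μ n p D φ r ≤ q + x := hb r hrε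
    _ ≤ scaleEnergy μ n p D φ ε + x + x := by gcongr
    _ ≤ spreadEnergy μ n p B D m φ ε + x * (q' + 1) + x + x := by
        gcongr
        refine h4.trans ?_
        gcongr
    _ ≤ scaleEnergy μ n p D ψ r' + (2 * (τ * (q + 1)) + K * θ + 3 * θ) +
          (scaleEnergy μ n p D (fun y => φ y - ψ y) r +
            (2 * (τ * (q + 1)) + K * θ + 3 * θ)) + θ + θ + θ := by
        rw [hsplit']
        gcongr
        · exact hL r' hrI' ψ hψ hψφ
        · exact hL r hrI _ hχ fun y => tsub_le_self
    _ = scaleEnergy μ n p D ψ r' + (4 * (τ * (q + 1)) + (2 * K + 9) * θ) +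
          scaleEnergy μ n p D (fun y => φ y - ψ y) r := by ring
    _ ≤ scaleEnergy μ n p D ψ r' + (η / 2 + η / 2) +
          scaleEnergy μ n p D (fun y => φ y - ψ y) r := by gcongr
    _ = _ := by rw [ENNReal.add_halves]

end AlmostMonotone

theorem exists_tendsto_lintegral_enorm_sub {α ι : Type*} [MeasurableSpace α] {μ : Measure α}
    {l : Filter ι} [l.NeBot] {f : ι → α → ℝ} (hf : ∀ᶠ i in l, Integrable (f i) μ)
    (hc : ∀ η : ℝ≥0∞, η ≠ 0 → ∃ s ∈ l, ∀ i ∈ s, ∀ j ∈ s, ∫⁻ x, ‖f i x - f j x‖ₑ ∂μ ≤ η) :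
    ∃ g, Integrable g μ ∧ Tendsto (fun i => ∫⁻ x, ‖f i x - g x‖ₑ ∂μ) l (𝓝 0) := by
  classical
  set F : ι → Lp ℝ 1 μ := fun i =>
    if h : Integrable (f i) μ then (memLp_one_iff_integrable.2 h).toLp else 0 with hF
  have hFc : Cauchy (map F l) := by
    refine EMetric.cauchy_iff.2 ⟨NeBot.ne inferInstance, fun η hη => ?_⟩
    obtain ⟨η', hη', hlt⟩ := exists_between hη
    obtain ⟨s, hs, h⟩ := hc η' hη'.ne'
    refine ⟨F '' (s ∩ {i | Integrable (f i) μ}), image_mem_map (inter_mem hs hf), ?_⟩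
    rintro _ ⟨i, ⟨hi, hi'⟩, rfl⟩ _ ⟨j, ⟨hj, hj'⟩, rfl⟩
    have hi'' : Integrable (f i) μ := hi'
    have hj'' : Integrable (f j) μ := hj'
    rw [hF]
    simp only [dif_pos hi'', dif_pos hj'']
    rw [Lp.edist_toLp_toLp, eLpNorm_one_eq_lintegral_enorm]
    exact (h i hi j hj).trans_lt hlt
  obtain ⟨g, hg⟩ := cauchy_map_iff_exists_tendsto.1 hFc
  refine ⟨g, memLp_one_iff_integrable.1 (Lp.memLp g), ?_⟩
  refine ((Lp.tendsto_Lp_iff_tendsto_eLpNorm' _ _).1 hg).congr' ?_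
  filter_upwards [hf] with i hi
  rw [eLpNorm_one_eq_lintegral_enorm]
  refine lintegral_congr_ae ?_
  have : F i = (memLp_one_iff_integrable.2 hi).toLp := by rw [hF]; simp only [dif_pos hi]
  rw [this]
  filter_upwards [(memLp_one_iff_integrable.2 hi).coeFn_toLp] with x hx
  rw [Pi.sub_apply, hx]

theorem enorm_toReal_sub_toReal_le {a b : ℝ≥0∞} (ha : a ≠ ∞) (hb : b ≠ ∞) :
    ‖a.toReal - b.toReal‖ₑ ≤ (a - b) + (b - a) := by
  rw [Real.enorm_eq_ofReal_abs]
  rcases le_total a b with h | h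
  · rw [abs_sub_comm, abs_of_nonneg (sub_nonneg.2 (ENNReal.toReal_mono hb h)),
      ENNReal.ofReal_sub _ ENNReal.toReal_nonneg, ENNReal.ofReal_toReal ha,
      ENNReal.ofReal_toReal hb]
    exact le_add_self
  · rw [abs_of_nonneg (sub_nonneg.2 (ENNReal.toReal_mono ha h)),
      ENNReal.ofReal_sub _ ENNReal.toReal_nonneg, ENNReal.ofReal_toReal ha,
      ENNReal.ofReal_toReal hb]
    exact le_self_add

theorem lintegral_tsub_le_of_setLIntegral_le {α : Type*} [MeasurableSpace α] {μ : Measure α}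
    {f g : α → ℝ≥0∞} (hf : Measurable f) (hg : Measurable g) (hgt : ∫⁻ x, g x ∂μ ≠ ∞) {η : ℝ≥0∞}
    (h : ∀ A, MeasurableSet A → ∫⁻ x in A, f x ∂μ ≤ ∫⁻ x in A, g x ∂μ + η) :
    ∫⁻ x, (f x - g x) ∂μ ≤ η := by
  set A := {x | g x < f x} with hA
  have hAm : MeasurableSet A := measurableSet_lt hg hf
  have h1 : ∫⁻ x, (f x - g x) ∂μ = ∫⁻ x in A, (f x - g x) ∂μ := by
    refine (setLIntegral_eq_of_support_subset fun x hx => ?_).symm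
    exact tsub_pos_iff_lt.1 (pos_iff_ne_zero.2 hx)
  have hgA : ∫⁻ x in A, g x ∂μ ≠ ∞ := ((setLIntegral_le_lintegral _ _).trans_lt hgt.lt_top).ne
  rw [h1, lintegral_sub hg hgA ((ae_restrict_mem hAm).mono fun x hx => (mem_ofPred_eq ▸ hx).le)]
  exact tsub_le_iff_left.2 (h A hAm)

section Density

variable {M : Type*} [MetricSpace M] [MeasurableSpace M]

/-- The energy density at scale `r`, without the normalizing constant. -/
def scaleDensity (μ : Measure M) (n : ℕ) (p : ℝ) (D : M × M → ℝ≥0∞) (r : ℝ) (z : M) : ℝ≥0∞ :=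
  ENNReal.ofReal (r ^ (-((n : ℝ) + p))) * ∫⁻ w in ball z r, D (z, w) ^ p ∂μ

variable [BorelSpace M] [SecondCountableTopology M] {μ : Measure M} [SFinite μ] {n : ℕ} {p : ℝ}
  {D : M × M → ℝ≥0∞}

theorem measurable_scaleDensity (hD : Measurable D) (r : ℝ) :
    Measurable (scaleDensity μ n p D r) :=
  (measurable_lintegral_ball μ r (hD.pow_const p)).const_mul _

theorem scaleEnergy_eq_lintegral (hD : Measurable D) {h : M → ℝ≥0∞} (hh : Measurable h) (r : ℝ) :
    scaleEnergy μ n p D h r = ∫⁻ z, h z * scaleDensity μ n p D r z ∂μ := by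
  have hm := measurable_lintegral_ball μ r (hD.pow_const p)
  simp only [scaleEnergy, scaleDensity]
  have : ∀ z, ∫⁻ w in ball z r, h z * D (z, w) ^ p ∂μ = h z * ∫⁻ w in ball z r, D (z, w) ^ p ∂μ :=
    fun z => lintegral_const_mul _ ((hD.comp (measurable_const.prodMk measurable_id)).pow_const p)
  simp_rw [this, mul_left_comm (h _)]
  rw [lintegral_const_mul _ (by exact hh.mul hm)]

theorem exists_tendsto_scaleDensity (hD : Measurable D) {φ : M → ℝ≥0∞}
    (hfin : ∀ᶠ r in 𝓝[>] 0, scaleEnergy μ n p D φ r ≠ ∞)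
    (hmono : ∀ η : ℝ≥0∞, η ≠ 0 → ∃ ρ : ℝ, 0 < ρ ∧ ∀ r ∈ Ioo 0 ρ, ∀ r' ∈ Ioo 0 ρ,
      ∀ ψ : M → ℝ≥0∞, Measurable ψ → (∀ x, ψ x ≤ φ x) →
        scaleEnergy μ n p D ψ r ≤ scaleEnergy μ n p D ψ r' + η)
    {V : Set M} (hV : MeasurableSet V) (hφV : ∀ x ∈ V, 1 ≤ φ x) :
    ∃ g : M → ℝ, Integrable g (μ.restrict V) ∧
      Tendsto (fun r => ∫⁻ x in V, ‖(scaleDensity μ n p D r x).toReal - g x‖ₑ ∂μ) (𝓝[>] 0)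
        (𝓝 0) := by
  have hind : ∀ A, MeasurableSet A → ∀ r, scaleEnergy μ n p D ((A ∩ V).indicator 1) r =
      ∫⁻ x in A, scaleDensity μ n p D r x ∂μ.restrict V := by
    intro A hA r
    rw [scaleEnergy_eq_lintegral hD (measurable_one.indicator (hA.inter hV)),
      Measure.restrict_restrict hA, ← lintegral_indicator (hA.inter hV)]
    refine lintegral_congr fun z => ?_
    by_cases hz : z ∈ A ∩ V
    · simp [hz]
    · simp [hz]
  have hle : ∀ A : Set M, ∀ x, (A ∩ V).indicator (1 : M → ℝ≥0∞) x ≤ φ x := by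
    intro A x
    by_cases hx : x ∈ A ∩ V
    · simpa [hx] using hφV x hx.2
    · simp [hx]
  have hfinV : ∀ r, scaleEnergy μ n p D φ r ≠ ∞ → ∫⁻ x in V, scaleDensity μ n p D r x ∂μ ≠ ∞ := by
    intro r hr
    have := hind univ .univ r
    rw [Measure.restrict_univ] at this
    rw [← this]
    exact ((scaleEnergy_mono μ n p D (hle univ) r).trans_lt hr.lt_top).ne
  have hDm := fun r => measurable_scaleDensity (μ := μ) (n := n) (p := p) hD r
  refine exists_tendsto_lintegral_enorm_sub ?_ fun η hη => ?_
  · filter_upwards [hfin] with r hr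
    exact integrable_toReal_of_lintegral_ne_top (hDm r).aemeasurable (hfinV r hr)
  · obtain ⟨ρ, hρ, h⟩ := hmono (η / 2) (ENNReal.div_ne_zero.2 ⟨hη, by simp⟩)
    refine ⟨Ioo 0 ρ ∩ {r | scaleEnergy μ n p D φ r ≠ ∞},
      inter_mem (Ioo_mem_nhdsGT hρ) hfin, fun r hr r' hr' => ?_⟩
    have key : ∀ r ∈ Ioo 0 ρ ∩ {r | scaleEnergy μ n p D φ r ≠ ∞},
        ∀ r' ∈ Ioo 0 ρ ∩ {r | scaleEnergy μ n p D φ r ≠ ∞},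
        ∫⁻ x in V, (scaleDensity μ n p D r x - scaleDensity μ n p D r' x) ∂μ ≤ η / 2 := by
      intro r hr r' hr'
      refine lintegral_tsub_le_of_setLIntegral_le (hDm r) (hDm r') (hfinV r' hr'.2) fun A hA => ?_
      rw [← hind A hA, ← hind A hA]
      exact h r hr.1 r' hr'.1 _ (measurable_one.indicator (hA.inter hV)) (hle A)
    calc ∫⁻ x in V, ‖(scaleDensity μ n p D r x).toReal - (scaleDensity μ n p D r' x).toReal‖ₑ ∂μ
        ≤ ∫⁻ x in V, ((scaleDensity μ n p D r x - scaleDensity μ n p D r' x) +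
            (scaleDensity μ n p D r' x - scaleDensity μ n p D r x)) ∂μ := by
          refine lintegral_mono_ae ?_
          filter_upwards [ae_lt_top (hDm r) (hfinV r hr.2), ae_lt_top (hDm r') (hfinV r' hr'.2)]
            with x h1 h2 using enorm_toReal_sub_toReal_le h1.ne h2.ne
      _ ≤ η / 2 + η / 2 := by
          rw [lintegral_add_left (by exact (hDm r).sub (hDm r'))]
          exact add_le_add (key r hr r' hr') (key r' hr' r hr)
      _ = η := ENNReal.add_halves η

end Density

section KorevaarSchoen

variable {M : Type*} [MeasurableSpace M] {Y : Type*} [MetricSpace Y] {u : M → Y} {n : ℕ} {p : ℝ}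

/-- The distance between the values of `u`. -/
def pullbackDist (u : M → Y) (q : M × M) : ℝ≥0∞ := edist (u q.1) (u q.2)

theorem isMeasurableDist_pullbackDist (hu : ∀ P, Measurable fun x => dist (u x) P)
    (hs : TopologicalSpace.IsSeparable (range u)) : IsMeasurableDist (pullbackDist u) where
  self x := edist_self _
  triangle x y z := edist_triangle _ _ _
  ne_top q := edist_ne_top _ _
  measurable := by
    obtain ⟨c, hc, hcu⟩ := hs
    have hP : ∀ P, Measurable fun x => edist (u x) P := fun P => by
      simp only [edist_dist]
      exact (hu P).ennreal_ofReal
    have : pullbackDist u = fun q : M × M => ⨅ P ∈ c, (edist (u q.1) P + edist (u q.2) P) := by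
      funext q
      refine le_antisymm (le_iInf₂ fun P _ => edist_triangle_right _ _ _) ?_
      refine ENNReal.le_of_forall_pos_le_add fun η hη _ => ?_
      obtain ⟨P, hPc, hPd⟩ := EMetric.mem_closure_iff.1 (hcu (mem_range_self q.1)) (η / 2 : ℝ≥0∞)
        (ENNReal.half_pos (by simpa using hη.ne'))
      refine (iInf₂_le P hPc).trans ?_
      calc edist (u q.1) P + edist (u q.2) P
          ≤ edist (u q.1) P + (edist (u q.1) (u q.2) + edist (u q.1) P) := by
            gcongr
            exact edist_triangle_left _ _ _
        _ ≤ η / 2 + (edist (u q.1) (u q.2) + η / 2) := by gcongr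
        _ = edist (u q.1) (u q.2) + (η / 2 + η / 2) := by ring
        _ = _ := by rw [ENNReal.add_halves, pullbackDist]
    rw [this]
    exact Measurable.biInf c hc fun P _ =>
      ((hP P).comp measurable_fst).add ((hP P).comp measurable_snd)

theorem cnp_pos (n : ℕ) (hp : 0 < p) : 0 < cnp n p := by
  have h1 : 0 < Real.Gamma ((p + 1) / 2) := Real.Gamma_pos_of_pos (by positivity)
  have h2 : 0 < Real.Gamma (((n : ℝ) + p) / 2) := Real.Gamma_pos_of_pos (by positivity)
  have := Real.pi_pos
  unfold cnp
  positivity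

variable [MetricSpace M] {μ : Measure M} {Ω : Set M} {ε : ℝ} {x₀ : M} {R : ℝ}

theorem ksDensity_eq (hp : 0 < p) (hu : ∀ P, Measurable fun x => dist (u x) P) (hε : 0 < ε) {x : M}
    (hx : ball x ε ⊆ Ω) : ksDensity n p μ Ω u ε x =
      ((n : ℝ) + p) / cnp n p * (scaleDensity μ n p (pullbackDist u) ε x).toReal := by
  have hm : Measurable fun y => dist (u x) (u y) ^ p := by
    simp_rw [dist_comm (u x)]
    exact (hu _).pow_const p
  rw [ksDensity, scaleDensity, inter_eq_left.2 hx,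
    integral_eq_lintegral_of_nonneg_ae (Eventually.of_forall fun y => by positivity)
      hm.aestronglyMeasurable, ENNReal.toReal_mul, ENNReal.toReal_ofReal (by positivity),
    Real.rpow_neg hε.le]
  have : ∀ y, ENNReal.ofReal (dist (u x) (u y) ^ p) = pullbackDist u (x, y) ^ p := fun y => by
    rw [pullbackDist, edist_dist, ENNReal.ofReal_rpow_of_nonneg dist_nonneg hp.le]
  simp_rw [this]
  have := cnp_pos n hp
  field_simp

theorem setLIntegral_pullbackDist_lt_top [OpensMeasurableSpace M] (hp : 1 ≤ p)
    (hu : ∀ P, Measurable fun x => dist (u x) P)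
    {P : Y} (hi : IntegrableOn (fun x => dist (u x) P ^ p) Ω μ) {U : Set M} (hU : U ⊆ Ω)
    (hμ : μ U ≠ ∞) : ∫⁻ x in U, ∫⁻ y in U, pullbackDist u (x, y) ^ p ∂μ ∂μ < ∞ := by
  have hp0 : 0 ≤ p := by linarith
  set f : M → ℝ≥0∞ := fun x => edist (u x) P ^ p with hf
  have hfe : ∀ x, ENNReal.ofReal (dist (u x) P ^ p) = f x := fun x => by
    rw [hf, ← ENNReal.ofReal_rpow_of_nonneg dist_nonneg hp0, ← edist_dist]
  have hfm : Measurable f := by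
    have : f = fun x => ENNReal.ofReal (dist (u x) P ^ p) := funext fun x => (hfe x).symm
    rw [this]
    exact ((hu P).pow_const p).ennreal_ofReal
  have hI : ∫⁻ x in U, f x ∂μ < ∞ := by
    have := (hi.mono_set hU).lintegral_lt_top
    simpa only [hfe] using this
  calc ∫⁻ x in U, ∫⁻ y in U, pullbackDist u (x, y) ^ p ∂μ ∂μ
      ≤ ∫⁻ x in U, ∫⁻ y in U, 2 ^ (p - 1) * (f x + f y) ∂μ ∂μ := by
        gcongr with x y
        refine le_trans ?_ (ENNReal.rpow_add_le_mul_rpow_add_rpow _ _ hp)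
        exact ENNReal.rpow_le_rpow (edist_triangle_right _ _ _) hp0
    _ = 2 ^ (p - 1) * ((∫⁻ x in U, f x ∂μ) * μ U + (∫⁻ x in U, f x ∂μ) * μ U) := by
        have h2 : (2 : ℝ≥0∞) ^ (p - 1) ≠ ∞ := by finiteness
        simp_rw [lintegral_const_mul' _ _ h2, lintegral_add_left measurable_const,
          setLIntegral_const]
        rw [lintegral_add_left (hfm.mul_const _), lintegral_mul_const _ hfm, setLIntegral_const]
    _ < ∞ := by finiteness

theorem scaleEnergy_ne_top [BorelSpace M] (hp : 1 < p) (hu : ∀ P, Measurable fun x => dist (u x) P)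
    {P : Y} (hi : IntegrableOn (fun x => dist (u x) P ^ p) Ω μ)
    (hR : ball x₀ R ⊆ Ω) (hμ : μ (ball x₀ R) ≠ ∞) (hε : ε ≤ R / 2) {h : M → ℝ≥0∞} {c : ℝ≥0∞}
    (hc : c ≠ ∞) (hhc : ∀ x, h x ≤ c) (hh : ∀ x ∉ ball x₀ (R / 2), h x = 0) :
    scaleEnergy μ n p (pullbackDist u) h ε ≠ ∞ := by
  have hfin := setLIntegral_pullbackDist_lt_top hp.le hu hi hR hμ
  refine ENNReal.mul_ne_top ENNReal.ofReal_ne_top (ne_top_of_le_ne_top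
    (ENNReal.mul_ne_top hc hfin.ne) ?_)
  calc ∫⁻ z, ∫⁻ w in ball z ε, h z * pullbackDist u (z, w) ^ p ∂μ ∂μ
      = ∫⁻ z in ball x₀ (R / 2), ∫⁻ w in ball z ε, h z * pullbackDist u (z, w) ^ p ∂μ ∂μ := by
        refine (setLIntegral_eq_of_support_subset fun z hz => ?_).symm
        by_contra hzB
        exact hz (by simp [hh z hzB])
    _ ≤ ∫⁻ z in ball x₀ (R / 2), ∫⁻ w in ball x₀ R, c * pullbackDist u (z, w) ^ p ∂μ ∂μ := by
        refine setLIntegral_mono' measurableSet_ball fun z hz => ?_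
        have hsub : ball z ε ⊆ ball x₀ R := ball_subset_ball' (by linarith [mem_ball.1 hz])
        refine (lintegral_mono_set hsub).trans ?_
        gcongr
        exact hhc z
    _ ≤ ∫⁻ z in ball x₀ R, ∫⁻ w in ball x₀ R, c * pullbackDist u (z, w) ^ p ∂μ ∂μ := by
        refine lintegral_mono_set fun z hz => ?_
        have h1 := mem_ball.1 hz
        have h2 : 0 ≤ dist z x₀ := dist_nonneg
        exact mem_ball.2 (by linarith)
    _ = _ := by simp_rw [lintegral_const_mul' _ _ hc]

variable [BorelSpace M] [SecondCountableTopology M] [SFinite μ]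

theorem ofReal_ksApproxEnergy (hp : 1 < p) (hu : ∀ P, Measurable fun x => dist (u x) P)
    (hs : TopologicalSpace.IsSeparable (range u))
    {P : Y} (hi : IntegrableOn (fun x => dist (u x) P ^ p) Ω μ)
    (hR : ball x₀ R ⊆ Ω) (hμ : μ (ball x₀ R) ≠ ∞) (hε0 : 0 < ε) (hε : ε ≤ R / 2) {h : M → ℝ} {c : ℝ}
    (hm : Measurable h) (h0 : ∀ x, 0 ≤ h x) (hhc : ∀ x, h x ≤ c)
    (hh : ∀ x ∉ ball x₀ (R / 2), h x = 0) :
    ENNReal.ofReal (ksApproxEnergy n p μ Ω u h ε) = ENNReal.ofReal (((n : ℝ) + p) / cnp n p) *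
      scaleEnergy μ n p (pullbackDist u) (fun x => ENNReal.ofReal (h x)) ε := by
  have hp0 : 0 < p := by linarith
  have hD := (isMeasurableDist_pullbackDist hu hs).measurable
  have hc0 : 0 ≤ ((n : ℝ) + p) / cnp n p := div_nonneg (by positivity) (cnp_pos n hp0).le
  have hfin := scaleEnergy_ne_top (n := n) hp hu hi hR hμ hε (h := fun x => ENNReal.ofReal (h x))
    ENNReal.ofReal_ne_top (fun x => ENNReal.ofReal_le_ofReal (hhc x))
    (fun x hx => by rw [hh x hx, ENNReal.ofReal_zero])
  have heq := scaleEnergy_eq_lintegral (μ := μ) (n := n) (p := p) hD hm.ennreal_ofReal ε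
  set F : M → ℝ≥0∞ := fun z =>
    ENNReal.ofReal (h z) * scaleDensity μ n p (pullbackDist u) ε z with hF
  have hFm : Measurable F := hm.ennreal_ofReal.mul (measurable_scaleDensity hD ε)
  have hsub : ball x₀ (R / 2) ⊆ ball x₀ R := fun z hz => by
    have h1 := mem_ball.1 hz
    have h2 : 0 ≤ dist z x₀ := dist_nonneg
    exact mem_ball.2 (by linarith)
  have hpt : ∀ x, h x * ksDensity n p μ Ω u ε x = ((n : ℝ) + p) / cnp n p * (F x).toReal := by
    intro x
    by_cases hx : x ∈ ball x₀ (R / 2)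
    · have : ball x ε ⊆ Ω := (ball_subset_ball' (by linarith [mem_ball.1 hx])).trans hR
      rw [ksDensity_eq hp0 hu hε0 this, hF, ENNReal.toReal_mul, ENNReal.toReal_ofReal (h0 x)]
      ring
    · simp [hF, hh x hx]
  have hint : ∫⁻ x in Ω, F x ∂μ = ∫⁻ x, F x ∂μ := by
    refine setLIntegral_eq_of_support_subset fun x hx => ?_
    by_contra hxΩ
    exact hx (by simp [hF, hh x fun h => hxΩ (hR (hsub h))])
  rw [heq] at hfin ⊢
  have hfin' : ∫⁻ x in Ω, F x ∂μ ≠ ∞ := by rw [hint]; exact hfin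
  rw [ksApproxEnergy]
  simp_rw [hpt]
  rw [integral_const_mul, integral_toReal hFm.aemeasurable (ae_lt_top hFm hfin'), hint,
    ENNReal.ofReal_mul hc0, ENNReal.ofReal_toReal hfin]

theorem tendsto_scaleEnergy (hp : 1 < p) (hu : MemKS n p μ Ω u) {ν : Measure M}
    (hν : IsEnergyMeasure n p μ Ω u ν) (hR0 : 0 < R) (hR : ball x₀ R ⊆ Ω) (hμ : μ (ball x₀ R) ≠ ∞)
    {h : M → ℝ} {c : ℝ} (hC0 : IsC0 Ω h) (h0 : ∀ x, 0 ≤ h x) (hhc : ∀ x, h x ≤ c)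
    (hh : ∀ x ∉ ball x₀ (R / 2), h x = 0) :
    Tendsto (fun ε => ENNReal.ofReal (((n : ℝ) + p) / cnp n p) *
      scaleEnergy μ n p (pullbackDist u) (fun x => ENNReal.ofReal (h x)) ε) (𝓝[>] 0)
        (𝓝 (∫⁻ x, ENNReal.ofReal (h x) ∂ν)) := by
  obtain ⟨hu1, hs, ⟨P, hi⟩, -⟩ := hu
  have := hν.1
  have hint : Integrable h ν := by
    refine Integrable.mono' (integrable_const c) hC0.1.measurable.aestronglyMeasurable
      (Eventually.of_forall fun x => ?_)
    rw [Real.norm_of_nonneg (h0 x)]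
    exact hhc x
  rw [← ofReal_integral_eq_lintegral_ofReal hint (Eventually.of_forall h0)]
  refine ((ENNReal.tendsto_ofReal (hν.2 h hC0 h0))).congr' ?_
  filter_upwards [Ioo_mem_nhdsGT (half_pos hR0)] with ε hε
  exact ofReal_ksApproxEnergy hp hu1 hs hi hR hμ hε.1 hε.2.le hC0.1.measurable h0 hhc hh

end KorevaarSchoen

section Identification

open scoped BoundedContinuousFunction

variable {M : Type*} [MetricSpace M] [MeasurableSpace M] [BorelSpace M] {μ ν : Measure M}

theorem rnDeriv_ae_eq_ofReal_of_tendsto [SigmaFinite μ] [IsFiniteMeasure ν] {ι : Type*}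
    {l : Filter ι} [l.NeBot] {e : ι → M → ℝ≥0∞} (he : ∀ i, Measurable (e i)) {g : M → ℝ}
    (hg : Measurable g) {V V' : Set M} (hV : MeasurableSet V) (hV' : MeasurableSet V')
    {χ : M → ℝ≥0∞} (hχ : Measurable χ) (hχ1 : ∀ x, χ x ≤ 1) (hχV : ∀ x ∉ V, χ x = 0)
    (hχV' : ∀ x ∈ V', χ x = 1)
    (hlim : Tendsto (fun i => ∫⁻ x in V, ‖(e i x).toReal - g x‖ₑ ∂μ) l (𝓝 0))
    (hν : ∀ f : M →ᵇ ℝ≥0, Tendsto (fun i => ∫⁻ x, f x * χ x * e i x ∂μ) l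
      (𝓝 (∫⁻ x, f x * χ x ∂ν))) :
    ∀ᵐ x ∂μ.restrict V', ν.rnDeriv μ x = ENNReal.ofReal (g x) := by
  have hint : ∫⁻ x, χ x ∂ν ≠ ∞ := ne_top_of_le_ne_top (measure_ne_top ν univ)
    ((lintegral_mono hχ1).trans (by simp))
  have hfin : ∀ᶠ i in l, ∫⁻ x, χ x * e i x ∂μ ≠ ∞ := by
    have h1 := hν (BoundedContinuousFunction.const M 1)
    simp only [BoundedContinuousFunction.const_apply, ENNReal.coe_one, one_mul] at h1
    exact h1.eventually_ne hint
  have hG : Measurable fun x => ENNReal.ofReal (g x) := hg.ennreal_ofReal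
  have key : ∀ f : M →ᵇ ℝ≥0, ∫⁻ x, f x * χ x ∂ν =
      ∫⁻ x, f x * χ x * ENNReal.ofReal (g x) ∂μ := by
    intro f
    have hf : Measurable fun x => (f x : ℝ≥0∞) := f.continuous.measurable.coe_nnreal_ennreal
    set C : ℝ≥0∞ := ((nndist f 0 : ℝ≥0) : ℝ≥0∞) with hC
    have hfC : ∀ x, (f x : ℝ≥0∞) ≤ C := fun x => by
      rw [hC]
      have := f.nndist_coe_le_nndist (g := 0) x
      rw [BoundedContinuousFunction.coe_zero, Pi.zero_apply, NNReal.nndist_zero_eq_val'] at this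
      exact ENNReal.coe_le_coe.2 this
    have herr : ∀ i, ∫⁻ x, f x * χ x * ‖(e i x).toReal - g x‖ₑ ∂μ ≤
        C * ∫⁻ x in V, ‖(e i x).toReal - g x‖ₑ ∂μ := fun i => by
      rw [← lintegral_const_mul' _ _ ENNReal.coe_ne_top, ← lintegral_indicator hV]
      refine lintegral_mono fun x => ?_
      by_cases hx : x ∈ V
      · rw [indicator_of_mem hx]
        gcongr
        exact (mul_le_mul' (hfC x) (hχ1 x)).trans_eq (mul_one _)
      · simp [hχV x hx]
    have hCd : Tendsto (fun i => C * ∫⁻ x in V, ‖(e i x).toReal - g x‖ₑ ∂μ) l (𝓝 0) := by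
      simpa using ENNReal.Tendsto.const_mul hlim (Or.inr ENNReal.coe_ne_top)
    refine le_antisymm ?_ ?_
    · refine le_of_tendsto_of_tendsto (hν f) ?_ ?_
        (g := fun i => ∫⁻ x, f x * χ x * ENNReal.ofReal (g x) ∂μ +
          C * ∫⁻ x in V, ‖(e i x).toReal - g x‖ₑ ∂μ)
      · simpa using tendsto_const_nhds.add hCd
      · filter_upwards [hfin] with i hi
        refine le_trans ?_ (add_le_add le_rfl (herr i))
        rw [← lintegral_add_left (by exact (hf.mul hχ).mul hG)]
        refine lintegral_mono_ae ?_
        filter_upwards [ae_lt_top (hχ.mul (he i)) hi] with x hx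
        rw [← mul_add]
        rcases eq_or_ne (χ x) 0 with h0 | h0
        · simp [h0]
        have hex : e i x ≠ ∞ := fun h => hx.ne (by simp [h, h0])
        gcongr
        calc e i x = ENNReal.ofReal (g x + ((e i x).toReal - g x)) := by
              rw [add_sub_cancel, ENNReal.ofReal_toReal hex]
          _ ≤ _ := ENNReal.ofReal_add_le.trans (add_le_add le_rfl (Real.ofReal_le_enorm _))
    · have h2 : Tendsto (fun i => ∫⁻ x, f x * χ x * e i x ∂μ +
          C * ∫⁻ x in V, ‖(e i x).toReal - g x‖ₑ ∂μ) l (𝓝 (∫⁻ x, f x * χ x ∂ν)) := by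
        simpa using (hν f).add hCd
      refine ge_of_tendsto' h2 fun i => ?_
      refine le_trans ?_ (add_le_add le_rfl (herr i))
      rw [← lintegral_add_left (by exact (hf.mul hχ).mul (he i))]
      refine lintegral_mono fun x => ?_
      rw [← mul_add]
      gcongr
      calc ENNReal.ofReal (g x)
          = ENNReal.ofReal ((e i x).toReal + (g x - (e i x).toReal)) := by rw [add_sub_cancel]
        _ ≤ ENNReal.ofReal (e i x).toReal + ‖g x - (e i x).toReal‖ₑ :=
          ENNReal.ofReal_add_le.trans (add_le_add le_rfl (Real.ofReal_le_enorm _))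
        _ ≤ _ := by
          rw [← enorm_neg, neg_sub]
          gcongr
          exact ENNReal.ofReal_toReal_le
  have hχG : Measurable fun x => χ x * ENNReal.ofReal (g x) := hχ.mul hG
  have : IsFiniteMeasure (ν.withDensity χ) := isFiniteMeasure_withDensity hint
  have heq : ν.withDensity χ = μ.withDensity fun x => χ x * ENNReal.ofReal (g x) := by
    refine ext_of_forall_lintegral_eq_of_IsFiniteMeasure fun f => ?_
    have hf : Measurable fun x => (f x : ℝ≥0∞) := f.continuous.measurable.coe_nnreal_ennreal
    rw [lintegral_withDensity_eq_lintegral_mul _ hχ hf,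
      lintegral_withDensity_eq_lintegral_mul _ hχG hf]
    simp only [Pi.mul_apply]
    have := key f
    simp only [mul_comm, mul_left_comm, mul_assoc] at this ⊢
    exact this
  have hres : ν.restrict V' =
      (μ.withDensity fun x => χ x * ENNReal.ofReal (g x)).restrict V' := by
    rw [← heq, restrict_withDensity hV', withDensity_congr_ae (g := 1), withDensity_one]
    exact (ae_restrict_iff' hV').2 (Eventually.of_forall hχV')
  have h1 := Measure.rnDeriv_restrict ν μ hV'
  rw [hres] at h1
  have : SigmaFinite (μ.withDensity fun x => χ x * ENNReal.ofReal (g x)) := by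
    rw [← heq]; infer_instance
  have h2 := Measure.rnDeriv_restrict (μ.withDensity fun x => χ x * ENNReal.ofReal (g x)) μ hV'
  have h3 := Measure.rnDeriv_withDensity μ hχG
  refine (ae_restrict_iff' hV').2 ?_
  filter_upwards [h1, h2, h3] with x h1 h2 h3 hx
  rw [h1, indicator_of_mem hx, indicator_of_mem hx, h3, hχV' x hx, one_mul] at h2
  exact h2

theorem exists_strictMono_forall_ae_tendsto_zero {α : Type*} [MeasurableSpace α] {μ : Measure α}
    {F : ℕ → α → ℝ≥0∞} (hF : ∀ j, Measurable (F j)) {V : ℕ → Set α}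
    (h : ∀ i, Tendsto (fun j => ∫⁻ x in V i, F j x ∂μ) atTop (𝓝 0)) :
    ∃ φ : ℕ → ℕ, StrictMono φ ∧
      ∀ i, ∀ᵐ x ∂μ.restrict (V i), Tendsto (fun j => F (φ j) x) atTop (𝓝 0) := by
  have hex : ∀ l : ℕ, ∃ N, ∀ k ≥ N, ∀ i ∈ Finset.range (l + 1),
      ∫⁻ x in V i, F k x ∂μ ≤ 2⁻¹ ^ l := fun l => by
    refine eventually_atTop.1 ((Finset.eventually_all _).2 fun i _ => ?_)
    exact (h i).eventually_le_const (ENNReal.pow_pos (by simp) l)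
  obtain ⟨φ, hφ, hφl⟩ := extraction_forall_of_eventually' hex
  refine ⟨φ, hφ, fun i => ?_⟩
  have hsum : ∫⁻ x in V i, ∑' l, F (φ (l + i)) x ∂μ ≠ ∞ := by
    rw [lintegral_tsum fun l => (hF _).aemeasurable]
    refine ne_top_of_le_ne_top (b := ∑' l : ℕ, (2⁻¹ : ℝ≥0∞) ^ l) ?_
      (ENNReal.tsum_le_tsum fun l => ?_)
    · rw [ENNReal.tsum_geometric, ENNReal.one_sub_inv_two, inv_inv]
      exact ENNReal.ofNat_ne_top
    · refine (hφl (l + i) i (by simp)).trans ?_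
      exact pow_le_pow_right_of_le_one' (by simp) (by omega)
  filter_upwards [ae_lt_top (Measurable.tsum fun l => hF _) hsum] with x hx
  exact (tendsto_add_atTop_iff_nat i).1 (ENNReal.tendsto_atTop_zero_of_tsum_ne_top hx.ne)

end Identification

section Bump

theorem clip_le_add {t t' d : ℝ} (hd : 0 ≤ d) (h : t ≤ t' + d) : clip t ≤ clip t' + d := by
  unfold clip
  refine max_le (add_nonneg (le_max_left _ _) hd) ?_
  rcases le_total 1 t' with h1 | h1
  · have : min 1 t' ≤ max 0 (min 1 t') := le_max_right _ _
    rw [min_eq_left h1] at this ⊢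
    linarith [min_le_left 1 t]
  · have : min 1 t' ≤ max 0 (min 1 t') := le_max_right _ _
    rw [min_eq_right h1] at this ⊢
    linarith [min_le_right 1 t]

variable {M : Type*} [MetricSpace M] {s s' : ℝ} {x₀ x z : M}

/-- A Lipschitz cutoff function that is `1` on the ball of radius `s` and vanishes outside the ball
of radius `2 * s`. -/
def bump (x₀ : M) (s : ℝ) (x : M) : ℝ := clip (2 - dist x x₀ / s)

theorem continuous_bump (x₀ : M) (s : ℝ) : Continuous (bump x₀ s) := by
  have := continuous_clip
  unfold bump
  fun_prop

theorem bump_nonneg (x₀ : M) (s : ℝ) (x : M) : 0 ≤ bump x₀ s x := (clip_mem _).1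

theorem bump_le_one (x₀ : M) (s : ℝ) (x : M) : bump x₀ s x ≤ 1 := (clip_mem _).2

theorem bump_eq_one (hs : 0 < s) (hx : dist x x₀ ≤ s) : bump x₀ s x = 1 :=
  clip_of_one_le (by linarith [(div_le_one hs).2 hx])

theorem bump_eq_zero (hs : 0 < s) (hx : 2 * s ≤ dist x x₀) : bump x₀ s x = 0 :=
  clip_of_nonpos (by linarith [(le_div_iff₀ hs).2 hx])

theorem bump_le_add (hs : 0 < s) : bump x₀ s x ≤ bump x₀ s z + dist x z / s := by
  refine clip_le_add (by positivity) ?_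
  have : dist z x₀ / s ≤ dist x z / s + dist x x₀ / s := by
    rw [← add_div]
    gcongr
    exact dist_triangle_left _ _ _
  linarith

theorem eventually_oscLe_bump (hs : 0 < s) (hss' : 2 * s < s') {ω : ℝ≥0∞} (hω : ω ≠ 0) :
    ∀ᶠ ε in 𝓝[>] (0 : ℝ), OscLe (fun x => ENNReal.ofReal (bump x₀ s x))
      (fun x => ENNReal.ofReal (bump x₀ s' x)) ω ε := by
  have hlim : Tendsto (fun ε : ℝ => ENNReal.ofReal (ε / s)) (𝓝[>] 0) (𝓝 0) := by
    have : Continuous fun ε : ℝ => ENNReal.ofReal (ε / s) :=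
      ENNReal.continuous_ofReal.comp (continuous_id.div_const s)
    simpa using (this.tendsto 0).mono_left nhdsWithin_le_nhds
  filter_upwards [hlim.eventually_le_const (pos_iff_ne_zero.2 hω),
    Ioo_mem_nhdsGT (sub_pos.2 hss')] with ε h1 h2 x z hxz
  rcases le_or_gt (2 * s) (dist x x₀) with hx | hx
  · simp [bump_eq_zero hs hx]
  have hz : dist z x₀ ≤ s' := by linarith [dist_triangle_left z x₀ x, h2.2]
  have hφ : ENNReal.ofReal (bump x₀ s x) ≤ ENNReal.ofReal (bump x₀ s z) + ω := by
    refine (ENNReal.ofReal_le_ofReal (bump_le_add (z := z) hs)).trans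
      (ENNReal.ofReal_add_le.trans ?_)
    gcongr
    refine (ENNReal.ofReal_le_ofReal ?_).trans h1
    gcongr
  simpa [bump_eq_one (by linarith : 0 < s') (by linarith : dist x x₀ ≤ s'),
    bump_eq_one (by linarith : 0 < s') hz] using hφ

theorem isC0_of_forall_notMem_ball {Ω : Set M} {h : M → ℝ} (hc : Continuous h)
    (hK : IsCompact (closedBall x₀ s)) (hs : closedBall x₀ s ⊆ Ω)
    (h0 : ∀ x ∉ ball x₀ s, h x = 0) : IsC0 Ω h := by
  have hsupp : tsupport h ⊆ closedBall x₀ s := by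
    refine closure_minimal (fun x hx => ?_) isClosed_closedBall
    by_contra hxs
    exact hx (h0 x fun hxb => hxs (ball_subset_closedBall hxb))
  exact ⟨hc, hK.of_isClosed_subset (isClosed_tsupport h) hsupp, hsupp.trans hs⟩

end Bump

section LocalConvergence

open scoped BoundedContinuousFunction

variable {M : Type*} [MetricSpace M] [MeasurableSpace M] [BorelSpace M] {n : ℕ} {k p : ℝ}
  {Y : Type*} [MetricSpace Y] {Ω : Set M} {u : M → Y} {ν : Measure M} {x₀ : M}

theorem AlexandrovSpace.exists_tendsto_lintegral_scaleDensity_sub (hM : AlexandrovSpace M n k)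
    (hp : 1 < p) (hΩ : IsOpen Ω) (hu : MemKS n p μH[(n : ℝ)] Ω u)
    (hν : IsEnergyMeasure n p μH[(n : ℝ)] Ω u ν) (hx₀ : x₀ ∈ Ω) :
    ∃ r, 0 < r ∧ Tendsto (fun ε => ∫⁻ x in ball x₀ r, ‖((n : ℝ) + p) / cnp n p *
      (scaleDensity μH[(n : ℝ)] n p (pullbackDist u) ε x).toReal - ksDens μH[(n : ℝ)] ν x‖ₑ
        ∂μH[(n : ℝ)]) (𝓝[>] 0) (𝓝 0) := by
  have := hM.isLocallyFiniteMeasure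
  have : SecondCountableTopology M :=
    secondCountableTopology_of_dimH_lt_top (by rw [hM.dim]; exact ENNReal.natCast_lt_top n)
  have := hν.1
  set μ : Measure M := μH[(n : ℝ)] with hμdef
  set c₀ : ℝ := ((n : ℝ) + p) / cnp n p with hc₀
  have hc₀pos : 0 < c₀ := div_pos (by positivity) (cnp_pos n (by linarith))
  set D := pullbackDist u with hDdef
  have hD : IsMeasurableDist D := isMeasurableDist_pullbackDist hu.1 hu.2.1
  obtain ⟨R₁, hR₁⟩ := hM.curv.exists_goodBall x₀
  obtain ⟨R₂, hR₂, hR₂Ω⟩ := Metric.isOpen_iff.1 hΩ x₀ hx₀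
  set R := min R₁ R₂ with hRdef
  have hR : 0 < R := lt_min hR₁.1 hR₂
  have hgood : GoodBall x₀ R := hR₁.mono hR (min_le_left _ _)
  have hRΩ : ball x₀ R ⊆ Ω := (ball_subset_ball (min_le_right _ _)).trans hR₂Ω
  have hμR : μ (ball x₀ R) ≠ ∞ :=
    ((measure_mono ball_subset_closedBall).trans_lt hgood.2.1.measure_lt_top).ne
  have hhalf : closedBall x₀ (R / 2) ⊆ ball x₀ R := closedBall_subset_ball (by linarith)
  have hK : IsCompact (closedBall x₀ (R / 2)) :=
    hgood.2.1.of_isClosed_subset isClosed_closedBall (hhalf.trans ball_subset_closedBall)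
  have hvan : ∀ s, 0 < s → s ≤ R / 4 → ∀ x ∉ ball x₀ (R / 2), bump x₀ s x = 0 := by
    intro s hs0 hs x hx
    exact bump_eq_zero hs0 (by linarith [not_lt.1 fun h => hx (mem_ball.2 h)])
  have hlim : ∀ h : M → ℝ, Continuous h → (∀ x, 0 ≤ h x) → (∃ c, ∀ x, h x ≤ c) →
      (∀ x ∉ ball x₀ (R / 2), h x = 0) → Tendsto (fun ε => ENNReal.ofReal c₀ *
        scaleEnergy μ n p D (fun x => ENNReal.ofReal (h x)) ε) (𝓝[>] 0)
          (𝓝 (∫⁻ x, ENNReal.ofReal (h x) ∂ν)) := by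
    rintro h hc h0 ⟨c, hhc⟩ hh
    exact tendsto_scaleEnergy hp hu hν hR hRΩ hμR
      (isC0_of_forall_notMem_ball hc hK (hhalf.trans hRΩ) hh) h0 hhc hh
  have hbump : ∀ s, 0 < s → s ≤ R / 4 → ∃ q : ℝ≥0∞, q ≠ ∞ ∧
      Tendsto (scaleEnergy μ n p D fun x => ENNReal.ofReal (bump x₀ s x)) (𝓝[>] 0) (𝓝 q) := by
    intro s hs0 hs
    refine ⟨(ENNReal.ofReal c₀)⁻¹ * ∫⁻ x, ENNReal.ofReal (bump x₀ s x) ∂ν, ?_, ?_⟩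
    · refine ENNReal.mul_ne_top (by simpa using hc₀pos) (ne_top_of_le_ne_top
        (measure_ne_top ν univ) ((lintegral_mono fun x => ?_).trans (lintegral_one).le))
      simpa using bump_le_one x₀ s x
    · have := ENNReal.Tendsto.const_mul (a := (ENNReal.ofReal c₀)⁻¹)
        (hlim _ (continuous_bump x₀ s) (bump_nonneg x₀ s) ⟨1, bump_le_one x₀ s⟩ (hvan s hs0 hs))
        (Or.inr (by simpa using hc₀pos))
      refine this.congr fun ε => ?_
      rw [← mul_assoc, ENNReal.inv_mul_cancel (by simpa using hc₀pos) ENNReal.ofReal_ne_top,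
        one_mul]
  have hbm : ∀ s, Measurable fun x => ENNReal.ofReal (bump x₀ s x) := fun s =>
    (continuous_bump x₀ s).measurable.ennreal_ofReal
  obtain ⟨q, hq, hqlim⟩ := hbump (R / 16) (by linarith) (by linarith)
  obtain ⟨q', hq', hqlim'⟩ := hbump (R / 5) (by linarith) (by linarith)
  have hT : ∀ C : ℝ, 1 < C → ∃ δ, 0 < δ ∧ ∃ m, IsTransport μ n (ball x₀ (R / 2)) C δ m := by
    intro C hC
    obtain ⟨δ, hδ, -, m, hm, hm1, hm2⟩ := hgood.exists_transport hM.curv.geodesic n hC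
    exact ⟨δ, hδ, m, hm, hm1, hm2⟩
  have hzero : ∀ s, 0 < s → s ≤ R / 4 → ∀ x ∉ ball x₀ (R / 2),
      ENNReal.ofReal (bump x₀ s x) = 0 := fun s hs0 hs x hx => by
    rw [hvan s hs0 hs x hx, ENNReal.ofReal_zero]
  obtain ⟨g₀, hg₀, hg₀lim⟩ := exists_tendsto_scaleDensity (V := ball x₀ (R / 16)) hD.measurable
    (hqlim.eventually_ne hq)
    (fun η hη => exists_scaleEnergy_le_add hp measurableSet_ball hT hD (hbm _) (hbm _)
      (hzero _ (by linarith) (by linarith)) (hzero _ (by linarith) (by linarith))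
      (fun ω hω => eventually_oscLe_bump (by linarith) (by linarith) hω) hq hq' hqlim hqlim' hη)
    measurableSet_ball
    (fun x hx => by simp [bump_eq_one (by linarith : 0 < R / 16) (mem_ball.1 hx).le])
  obtain ⟨g, hg, hgg₀⟩ := hg₀.aestronglyMeasurable.aemeasurable
  have hVlim : Tendsto (fun ε => ∫⁻ x in ball x₀ (R / 16),
      ‖c₀ * (scaleDensity μ n p D ε x).toReal - c₀ * g x‖ₑ ∂μ) (𝓝[>] 0) (𝓝 0) := by
    have := ENNReal.Tendsto.const_mul (a := ‖c₀‖ₑ) hg₀lim (Or.inr enorm_ne_top)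
    rw [mul_zero] at this
    refine this.congr fun ε => ?_
    rw [← lintegral_const_mul' _ _ enorm_ne_top]
    refine lintegral_congr_ae ?_
    filter_upwards [hgg₀] with x hx
    rw [hx, ← mul_sub, enorm_mul]
  have hdens : ∀ᵐ x ∂μ.restrict (ball x₀ (R / 32)), ν.rnDeriv μ x = ENNReal.ofReal (c₀ * g x) := by
    refine rnDeriv_ae_eq_ofReal_of_tendsto (l := 𝓝[>] (0 : ℝ)) (V := ball x₀ (R / 16))
      (e := fun ε x => ENNReal.ofReal c₀ * scaleDensity μ n p D ε x)
      (χ := fun x => ENNReal.ofReal (bump x₀ (R / 32) x))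
      (fun ε => (measurable_scaleDensity hD.measurable ε).const_mul _) (hg.const_mul c₀)
      measurableSet_ball measurableSet_ball (hbm _)
      (fun x => by simpa using bump_le_one x₀ (R / 32) x) (fun x hx => ?_) (fun x hx => ?_) ?_
      fun f => ?_
    · rw [bump_eq_zero (by linarith) (by linarith [not_lt.1 fun h => hx (mem_ball.2 h)]),
        ENNReal.ofReal_zero]
    · rw [bump_eq_one (by linarith) (mem_ball.1 hx).le, ENNReal.ofReal_one]
    · simpa only [ENNReal.toReal_mul, ENNReal.toReal_ofReal hc₀pos.le] using hVlim
    · have heq : ∀ x, ENNReal.ofReal (f x * bump x₀ (R / 32) x) =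
          f x * ENNReal.ofReal (bump x₀ (R / 32) x) := fun x => by
        rw [ENNReal.ofReal_mul (NNReal.coe_nonneg (f x)), ENNReal.ofReal_coe_nnreal]
      have hfc : Continuous fun x => (f x : ℝ) * bump x₀ (R / 32) x :=
        (NNReal.continuous_coe.comp f.continuous).mul (continuous_bump _ _)
      have hf := hlim (fun x => f x * bump x₀ (R / 32) x) hfc
        (fun x => mul_nonneg (f x).2 (bump_nonneg _ _ _))
        ⟨nndist f 0, fun x => ?_⟩ (fun x hx => by
          rw [hvan _ (by linarith) (by linarith) x hx, mul_zero])
      · simp only [heq] at hf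
        refine hf.congr fun ε => ?_
        rw [scaleEnergy_eq_lintegral hD.measurable
          (by exact f.continuous.measurable.coe_nnreal_ennreal.mul (hbm _)),
          ← lintegral_const_mul' _ _ ENNReal.ofReal_ne_top]
        exact lintegral_congr fun x => by ring
      · have h1 := f.nndist_coe_le_nndist (g := 0) x
        rw [BoundedContinuousFunction.coe_zero, Pi.zero_apply, NNReal.nndist_zero_eq_val'] at h1
        have h2 : (f x : ℝ) ≤ nndist f 0 := h1
        exact (mul_le_of_le_one_right (f x).2 (bump_le_one _ _ _)).trans h2
  refine ⟨R / 32, by linarith, tendsto_of_tendsto_of_tendsto_of_le_of_le tendsto_const_nhds hVlim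
    (fun _ => zero_le) fun ε => ?_⟩
  refine le_trans (lintegral_mono_ae ?_) (lintegral_mono_set (ball_subset_ball (by linarith)))
  filter_upwards [hdens] with x hx
  rw [ksDens, hx, ENNReal.toReal_ofReal']
  refine enorm_le_iff_norm_le.2 ?_
  have h0 : 0 ≤ c₀ * (scaleDensity μ n p D ε x).toReal := by positivity
  simpa [max_eq_left h0] using
    abs_max_sub_max_le_abs (c₀ * (scaleDensity μ n p D ε x).toReal) (c₀ * g x) 0

end LocalConvergence

section Global

variable {M : Type*} [MetricSpace M] [MeasurableSpace M] [BorelSpace M] {n : ℕ} {k p : ℝ}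
  {Y : Type*} [MetricSpace Y] {Ω : Set M} {u : M → Y} {ν : Measure M}

theorem AlexandrovSpace.exists_strictMono_ae_tendsto_ksDensity (hM : AlexandrovSpace M n k)
    (hp : 1 < p) (hΩ : IsOpen Ω) (hu : MemKS n p μH[(n : ℝ)] Ω u)
    (hν : IsEnergyMeasure n p μH[(n : ℝ)] Ω u ν) {ε : ℕ → ℝ} (hε0 : ∀ j, 0 < ε j)
    (hε : Tendsto ε atTop (𝓝 0)) :
    ∃ φ : ℕ → ℕ, StrictMono φ ∧ ∀ᵐ x ∂(μH[(n : ℝ)] : Measure M).restrict Ω,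
      Tendsto (fun j => ksDensity n p μH[(n : ℝ)] Ω u (ε (φ j)) x) atTop
        (𝓝 (ksDens μH[(n : ℝ)] ν x)) := by
  have := hM.isLocallyFiniteMeasure
  have : SecondCountableTopology M :=
    secondCountableTopology_of_dimH_lt_top (by rw [hM.dim]; exact ENNReal.natCast_lt_top n)
  rcases Ω.eq_empty_or_nonempty with rfl | ⟨a, ha⟩
  · exact ⟨id, strictMono_id, by simp⟩
  set μ : Measure M := μH[(n : ℝ)] with hμ
  have hD := (isMeasurableDist_pullbackDist hu.1 hu.2.1).measurable
  have hε' : Tendsto ε atTop (𝓝[>] 0) :=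
    tendsto_nhdsWithin_iff.2 ⟨hε, Eventually.of_forall hε0⟩
  have hloc : ∀ x, ∃ r, 0 < r ∧ (x ∈ Ω → Tendsto (fun ε =>
      ∫⁻ z in ball x r, ‖((n : ℝ) + p) / cnp n p *
        (scaleDensity μ n p (pullbackDist u) ε z).toReal - ksDens μ ν z‖ₑ ∂μ)
          (𝓝[>] 0) (𝓝 0)) := by
    intro x
    by_cases hx : x ∈ Ω
    · obtain ⟨r, hr0, hr⟩ := hM.exists_tendsto_lintegral_scaleDensity_sub hp hΩ hu hν hx
      exact ⟨r, hr0, fun _ => hr⟩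
    · exact ⟨1, one_pos, fun h => absurd h hx⟩
  choose r hr0 hr using hloc
  obtain ⟨s, hsΩ, hs, hcov⟩ := TopologicalSpace.countable_cover_nhdsWithin (s := Ω)
    (f := fun x => ball x (r x)) fun x _ => mem_nhdsWithin_of_mem_nhds (ball_mem_nhds x (hr0 x))
  have hsne : s.Nonempty := by
    obtain ⟨x, hx, -⟩ := mem_iUnion₂.1 (hcov ha)
    exact ⟨x, hx⟩
  obtain ⟨c, rfl⟩ := hs.exists_eq_range hsne
  obtain ⟨φ, hφ, hφlim⟩ := exists_strictMono_forall_ae_tendsto_zero (μ := μ)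
    (F := fun j x => ‖((n : ℝ) + p) / cnp n p *
      (scaleDensity μ n p (pullbackDist u) (ε j) x).toReal - ksDens μ ν x‖ₑ)
    (fun j => (((measurable_scaleDensity hD _).ennreal_toReal.const_mul _).sub
      (Measure.measurable_rnDeriv ν μ).ennreal_toReal).enorm)
    (V := fun i => ball (c i) (r (c i)))
    fun i => (hr (c i) (hsΩ (mem_range_self i))).comp hε'
  refine ⟨φ, hφ, ?_⟩
  have hall : ∀ᵐ x ∂μ, ∀ i, x ∈ ball (c i) (r (c i)) →
      Tendsto (fun j => ‖((n : ℝ) + p) / cnp n p *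
        (scaleDensity μ n p (pullbackDist u) (ε (φ j)) x).toReal - ksDens μ ν x‖ₑ) atTop (𝓝 0) :=
    ae_all_iff.2 fun i => (ae_restrict_iff' measurableSet_ball).1 (hφlim i)
  refine (ae_restrict_iff' hΩ.measurableSet).2 ?_
  filter_upwards [hall] with x hx hxΩ
  obtain ⟨_, ⟨i, rfl⟩, hxi⟩ := mem_iUnion₂.1 (hcov hxΩ)
  refine (tendsto_iff_enorm_sub_tendsto_zero.2 (hx i hxi)).congr' ?_
  obtain ⟨δ, hδ, hδΩ⟩ := Metric.isOpen_iff.1 hΩ x hxΩ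
  filter_upwards [(hε.comp hφ.tendsto_atTop).eventually_lt_const hδ] with j hj
  exact (ksDensity_eq (by linarith) hu.1 (hε0 _) ((ball_subset_ball hj.le).trans hδΩ)).symm

end Global

end Paper

namespace Paper

/-- Corollary 4.6. `Ω` a bounded domain of an `n`-dimensional
Alexandrov space with curvature `≥ k`, `p > 1`, `Y` complete, `u ∈ W^{1,p}(Ω,Y)`. Every
sequence `ε_j → 0` has a subsequence `ε'_j` along which `e^u_{p,ε'_j}(x) → |∇u|_p(x)`
for almost every `x ∈ Ω`. -/
theorem statement_9 (n : ℕ) (k : ℝ) (p : ℝ) (hp : 1 < p)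
    {M : Type*} [MetricSpace M] [MeasurableSpace M] [BorelSpace M]
    (hM : AlexandrovSpace M n k)
    {Y : Type*} [MetricSpace Y] (hYc : CompleteSpace Y)
    (Ω : Set M) (hΩo : IsOpen Ω) (hΩc : IsConnected Ω) (hΩb : Bornology.IsBounded Ω)
    (u : M → Y) (hu : MemKS n p (μH[(n : ℝ)]) Ω u)
    (ν : Measure M) (hν : IsEnergyMeasure n p (μH[(n : ℝ)]) Ω u ν)
    (ε : ℕ → ℝ) (hεpos : ∀ j, 0 < ε j) (hε : Tendsto ε atTop (𝓝 0)) :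
    ∃ φ : ℕ → ℕ, StrictMono φ ∧
      ∀ᵐ x ∂((μH[(n : ℝ)] : Measure M).restrict Ω),
        Tendsto (fun j => ksDensity n p (μH[(n : ℝ)]) Ω u (ε (φ j)) x) atTop
          (𝓝 (ksDens (μH[(n : ℝ)]) ν x)) := by
  exact hM.exists_strictMono_ae_tendsto_ksDensity hp hΩo hu hν hεpos hε

end Paper
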